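/- Let α, β, γ ∈ ℂ satisfy α + β + γ = −iQ and −Q/2 < Im α, Im β, Im γ < 0, and let u, v, w ∈ ℝ. Set σ⋆ = −iQ/2 − σ for σ ∈ {α, β, γ}. Then ∫_ℝ D_α(x−u)·D_β(x−v)·D_γ(x−w) dx = w_b(2α + iQ/2)·w_b(2β + iQ/2)·w_b(2γ + iQ/2)·D_{α⋆}(w−v)·D_{β⋆}(u−w)·D_{γ⋆}(v−u), the integral converging absolutely. -/

import Mathlib

open MeasureTheory

/-- The non-compact quantum dilogarithm `w_b`. -/
noncomputable def wb (b ε : ℝ) (z : ℂ) : ℂ :=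
  Complex.exp (Complex.I * ((Real.pi : ℝ) : ℂ) / 2 * z ^ 2 +
    Complex.I * ((Real.pi : ℝ) : ℂ) / 24 * ((b : ℂ) ^ 2 + ((b : ℂ))⁻¹ ^ 2) -
    ∫ t : ℝ,
      Complex.exp (-(2 * Complex.I * ((t : ℂ) + Complex.I * (ε : ℂ)) * z)) /
        (4 * ((t : ℂ) + Complex.I * (ε : ℂ)) *
          Complex.sinh ((b : ℂ) * ((t : ℂ) + Complex.I * (ε : ℂ))) *
          Complex.sinh (((t : ℂ) + Complex.I * (ε : ℂ)) / (b : ℂ))))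

/-- The function `D_α`. -/
noncomputable def Dfun (b ε : ℝ) (α z : ℂ) : ℂ :=
  Complex.exp (Complex.I *
    ∫ t : ℝ,
      Complex.cos (2 * ((t : ℂ) + Complex.I * (ε : ℂ)) * z) *
          Complex.sin (2 * α * ((t : ℂ) + Complex.I * (ε : ℂ))) /
        (2 * ((t : ℂ) + Complex.I * (ε : ℂ)) *
          Complex.sinh ((b : ℂ) * ((t : ℂ) + Complex.I * (ε : ℂ))) *
          Complex.sinh (((t : ℂ) + Complex.I * (ε : ℂ)) / (b : ℂ))))

section Helpers

open MeasureTheory Filter Topology Complex Set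

theorem holo_integral_deriv {U : Set ℂ} (hU : IsOpen U) (F : ℂ → ℝ → ℂ)
    (hm : ∀ z ∈ U, AEStronglyMeasurable (F z) volume)
    (hd : ∀ t, DifferentiableOn ℂ (fun z => F z t) U)
    (hb : ∀ z₀ ∈ U, ∃ r > 0, ∃ g : ℝ → ℝ, Integrable g ∧
      ∀ z ∈ Metric.ball z₀ r, ∀ t, ‖F z t‖ ≤ g t) :
    ∀ z₀ ∈ U, HasDerivAt (fun z => ∫ t, F z t) (∫ t, deriv (fun z => F z t) z₀) z₀ := by
  intro z₀ hz₀
  obtain ⟨r, hr, g, hg, hle⟩ := hb z₀ hz₀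
  obtain ⟨r', hr', hball⟩ := Metric.isOpen_iff.1 hU z₀ hz₀
  set ρ := min r r' with hρ
  have hρ0 : 0 < ρ := lt_min hr hr'
  have hda : ∀ t, ∀ z ∈ Metric.ball z₀ ρ, DifferentiableAt ℂ (fun z => F z t) z := by
    intro t z hz
    exact (hd t).differentiableAt (hU.mem_nhds (hball (Metric.ball_subset_ball (min_le_right _ _) hz)))
  have hseq : ∃ s : ℕ → ℂ, Tendsto s atTop (𝓝[≠] z₀) := by
    exact ⟨_, (exists_seq_tendsto (𝓝[≠] z₀)).choose_spec⟩
  obtain ⟨s, hs⟩ := hseq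
  have key := hasDerivAt_integral_of_dominated_loc_of_deriv_le (μ := volume) (F := F)
    (F' := fun z t => deriv (fun z => F z t) z) (x₀ := z₀) (s := Metric.ball z₀ (ρ/2))
    (bound := fun t => g t / (ρ/4)) (Metric.ball_mem_nhds _ (by positivity))
    ?_ ?_ ?_ ?_ ?_ ?_
  · exact key.2
  · filter_upwards [hU.mem_nhds hz₀] with z hz using hm z hz
  · exact hg.mono' (hm z₀ hz₀) (Eventually.of_forall fun t => hle z₀ (Metric.mem_ball_self hr) t)
  · have hU' : ∀ᶠ n in atTop, s n ∈ U := (hs.mono_right nhdsWithin_le_nhds) (hU.mem_nhds hz₀)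
    obtain ⟨N, hN⟩ := eventually_atTop.1 hU'
    refine aestronglyMeasurable_of_tendsto_ae (u := atTop)
      (f := fun n t => slope (fun z => F z t) z₀ (s (n + N))) ?_ ?_
    · intro n
      simp only [slope, vsub_eq_sub]
      exact ((hm _ (hN (n + N) (by omega))).sub (hm _ hz₀)).const_smul (s (n + N) - z₀)⁻¹
    · refine Eventually.of_forall fun t => ?_
      have := hasDerivAt_iff_tendsto_slope.1 (hda t z₀ (Metric.mem_ball_self hρ0)).hasDerivAt
      exact (this.comp hs).comp (tendsto_add_atTop_nat N)
  · refine Eventually.of_forall fun t z hz => ?_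
    refine Complex.norm_deriv_le_of_forall_mem_sphere_norm_le (by positivity) ?_ ?_
    · refine DifferentiableOn.diffContOnCl (fun w hw => (hda t w ?_).differentiableWithinAt)
      have := Metric.closure_ball_subset_closedBall hw
      rw [Metric.mem_closedBall] at this
      rw [Metric.mem_ball] at hz ⊢
      linarith [dist_triangle w z z₀]
    · intro w hw
      apply hle
      rw [mem_sphere_iff_norm, ← dist_eq_norm] at hw
      rw [Metric.mem_ball] at hz ⊢
      linarith [dist_triangle w z z₀, min_le_left r r']
  · exact hg.div_const _
  · exact Eventually.of_forall fun t z hz =>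
      (hda t z (Metric.ball_subset_ball (by linarith) hz)).hasDerivAt

theorem holo_integral {U : Set ℂ} (hU : IsOpen U) (F : ℂ → ℝ → ℂ)
    (hm : ∀ z ∈ U, AEStronglyMeasurable (F z) volume)
    (hd : ∀ t, DifferentiableOn ℂ (fun z => F z t) U)
    (hb : ∀ z₀ ∈ U, ∃ r > 0, ∃ g : ℝ → ℝ, Integrable g ∧
      ∀ z ∈ Metric.ball z₀ r, ∀ t, ‖F z t‖ ≤ g t) :
    DifferentiableOn ℂ (fun z => ∫ t, F z t) U := fun z₀ hz₀ =>
  (holo_integral_deriv hU F hm hd hb z₀ hz₀).differentiableAt.differentiableWithinAt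

theorem shift_line (f : ℂ → ℂ) (y₁ y₂ : ℝ) (C : ℝ)
    (hd : ∀ z : ℂ, z.im ∈ uIcc y₁ y₂ → DifferentiableAt ℂ f z)
    (hb : ∀ x y : ℝ, y ∈ uIcc y₁ y₂ → 1 ≤ |x| → ‖f (x + y * I)‖ ≤ C * (1 + x ^ 2)⁻¹)
    (h1 : Integrable fun x : ℝ => f (x + y₁ * I)) (h2 : Integrable fun x : ℝ => f (x + y₂ * I)) :
    ∫ x : ℝ, f (x + y₁ * I) = ∫ x : ℝ, f (x + y₂ * I) := by
  have t1 := intervalIntegral_tendsto_integral h1 tendsto_neg_atTop_atBot tendsto_id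
  have t2 := intervalIntegral_tendsto_integral h2 tendsto_neg_atTop_atBot tendsto_id
  have hrect : ∀ R : ℝ, (∫ x : ℝ in (-R)..R, f (x + y₁ * I)) - (∫ x : ℝ in (-R)..R, f (x + y₂ * I))
      = - (I • (∫ y : ℝ in y₁..y₂, f (R + y * I))) + I • (∫ y : ℝ in y₁..y₂, f ((-R : ℝ) + y * I)) := by
    intro R
    have := Complex.integral_boundary_rect_eq_zero_of_differentiableOn f (((-R : ℝ):ℂ) + y₁ * I) ((R:ℂ) + y₂ * I)
      (fun z hz => (hd z ?_).differentiableWithinAt)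
    · simp at this ⊢
      linear_combination this
    · have := hz.2
      simpa using this
  have hz : Tendsto (fun R : ℝ => - (I • (∫ y : ℝ in y₁..y₂, f (R + y * I))) +
      I • (∫ y : ℝ in y₁..y₂, f ((-R : ℝ) + y * I))) atTop (𝓝 0) := by
    have hb0 : Tendsto (fun R : ℝ => 2 * (C * (1 + R ^ 2)⁻¹ * |y₂ - y₁|)) atTop (𝓝 0) := by
      have : Tendsto (fun R : ℝ => (1 + R ^ 2)⁻¹) atTop (𝓝 0) := by
        apply tendsto_inv_atTop_zero.comp
        exact tendsto_atTop_add_const_left _ _ (tendsto_pow_atTop (by norm_num))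
      simpa using (((this.const_mul C).mul_const |y₂ - y₁|).const_mul 2)
    refine squeeze_zero_norm' ?_ hb0
    filter_upwards [eventually_ge_atTop 1] with R hR
    have e1 : ∀ S : ℝ, |S| = R → ‖∫ y : ℝ in y₁..y₂, f (S + y * I)‖ ≤ C * (1 + R ^ 2)⁻¹ * |y₂ - y₁| := by
      intro S hS
      apply intervalIntegral.norm_integral_le_of_norm_le_const
      intro y hy
      have := hb S y (uIoc_subset_uIcc hy) (by rw [hS]; exact hR)
      rwa [← sq_abs, hS] at this
    have a1 := e1 R (abs_of_pos (by linarith))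
    have a2 := e1 (-R) (by rw [abs_neg, abs_of_pos (by linarith)])
    calc _ ≤ _ := norm_add_le _ _
      _ ≤ _ := by
        rw [norm_neg, norm_smul, norm_smul, norm_I]
        linarith
  have := t1.sub t2
  simp only [id] at this
  simp_rw [hrect] at this
  exact sub_eq_zero.1 (tendsto_nhds_unique this hz)

theorem exp_le_inv (c : ℝ) (hc : 0 < c) : ∃ K > 0, ∀ x : ℝ, Real.exp (-c * |x|) ≤ K * (1 + x ^ 2)⁻¹ := by
  refine ⟨1 + 2 / c ^ 2, by positivity, fun x => ?_⟩
  rw [← div_eq_mul_inv, le_div_iff₀ (by positivity), neg_mul, Real.exp_neg, inv_mul_le_iff₀ (Real.exp_pos _)]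
  have h := Real.quadratic_le_exp_of_nonneg (x := c * |x|) (by positivity)
  have h2 : 1 + (c * |x|)^2/2 ≤ Real.exp (c * |x|) := by
    have : 0 ≤ c * |x| := by positivity
    linarith
  rw [mul_pow, sq_abs] at h2
  have : 1 + x^2 ≤ (1 + c^2 * x^2/2) * (1 + 2/c^2) := by
    field_simp
    nlinarith [sq_nonneg x, sq_nonneg c, mul_nonneg (sq_nonneg x) (sq_nonneg c), mul_nonneg (sq_nonneg x) (sq_nonneg (c^2)),sq_nonneg (c*c*x)]
  calc _ ≤ _ := this
    _ ≤ _ := by gcongr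

theorem integrable_exp_abs (c : ℝ) (hc : 0 < c) : Integrable fun x : ℝ => Real.exp (-c * |x|) := by
  obtain ⟨K, hK, h⟩ := exp_le_inv c hc
  refine (integrable_inv_one_add_sq.const_mul K).mono' (by fun_prop) (Eventually.of_forall fun x => ?_)
  rw [Real.norm_of_nonneg (Real.exp_pos _).le]
  exact h x

theorem integrable_of_exp_bound (f : ℝ → ℂ) (hf : Continuous f) (C c : ℝ) (hc : 0 < c)
    (hb : ∀ x, ‖f x‖ ≤ C * Real.exp (-c * |x|)) : Integrable f :=
  ((integrable_exp_abs c hc).const_mul C).mono' hf.aestronglyMeasurable (Eventually.of_forall hb)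

theorem shift_exp (f : ℂ → ℂ) (y₁ y₂ : ℝ) (C c : ℝ) (hc : 0 < c)
    (hd : ∀ z : ℂ, z.im ∈ uIcc y₁ y₂ → DifferentiableAt ℂ f z)
    (hb : ∀ x y : ℝ, y ∈ uIcc y₁ y₂ → ‖f (x + y * I)‖ ≤ C * Real.exp (-c * |x|)) :
    (Integrable fun x : ℝ => f (x + y₁ * I)) ∧ (Integrable fun x : ℝ => f (x + y₂ * I)) ∧
    ∫ x : ℝ, f (x + y₁ * I) = ∫ x : ℝ, f (x + y₂ * I) := by
  have hint : ∀ y ∈ uIcc y₁ y₂, Integrable fun x : ℝ => f (x + y * I) := by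
    intro y hy
    refine integrable_of_exp_bound _ ?_ C c hc (fun x => hb x y hy)
    refine continuous_iff_continuousAt.2 fun x => ?_
    have := (hd (x + y * I) (by simpa using hy)).continuousAt
    exact ContinuousAt.comp (f := fun x : ℝ => (x:ℂ) + y * I) this (by fun_prop)
  refine ⟨hint _ left_mem_uIcc, hint _ right_mem_uIcc, ?_⟩
  obtain ⟨K, hK, h⟩ := exp_le_inv c hc
  have hC : 0 ≤ C := by
    have := (norm_nonneg _).trans (hb 0 y₁ left_mem_uIcc)
    simpa using this
  refine shift_line f y₁ y₂ (C * K) hd (fun x y hy _ => (hb x y hy).trans ?_) (hint _ left_mem_uIcc) (hint _ right_mem_uIcc)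
  rw [mul_assoc]
  gcongr
  exact h x

theorem int_lor (p : ℝ) (hp : p ≠ 0) : (Integrable fun y : ℝ => p / (y^2 + p^2)) ∧
    ∫ y : ℝ, p / (y ^ 2 + p ^ 2) = Real.pi * SignType.sign p := by
  have e : (fun y : ℝ => p / (y ^ 2 + p ^ 2)) = fun y => p⁻¹ * (1 + (y / p) ^ 2)⁻¹ := by
    ext y
    have : y^2 + p^2 ≠ 0 := by positivity
    field_simp
    ring
  rw [e]
  refine ⟨(integrable_inv_one_add_sq.comp_div hp).const_mul _, ?_⟩
  rw [integral_const_mul, Measure.integral_comp_div (fun y => (1 + y^2)⁻¹), integral_univ_inv_one_add_sq]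
  rcases lt_or_gt_of_ne hp with h | h
  · simp [sign_neg h, abs_of_neg h]; field_simp
  · simp [sign_pos h, abs_of_pos h]; field_simp

theorem ne_ln (y p : ℝ) (hp : p ≠ 0) : (y:ℂ) + p * I ≠ 0 := by
  intro h
  apply hp
  simpa using congrArg Complex.im h

theorem int_pole_diff (p q : ℝ) (hp : p ≠ 0) (hq : q ≠ 0) :
    (Integrable fun y : ℝ => ((y:ℂ) + p * I)⁻¹ - ((y:ℂ) + q * I)⁻¹) ∧
    ∫ y : ℝ, (((y:ℂ) + p * I)⁻¹ - ((y:ℂ) + q * I)⁻¹)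
      = - I * Real.pi * ((SignType.sign p : ℝ) - (SignType.sign q : ℝ)) := by
  have hp' := fun y => ne_ln y p hp
  have hq' := fun y => ne_ln y q hq
  have nb : ∀ (y p : ℝ), p ≠ 0 → y^2 + p^2 ≤ ‖(y:ℂ) + p * I‖^2 := by
    intro y p hp
    rw [Complex.sq_norm, Complex.normSq_apply]; simp; nlinarith
  have hint : Integrable fun y : ℝ => ((y:ℂ) + p * I)⁻¹ - ((y:ℂ) + q * I)⁻¹ := by
    have l1 := ((int_lor p hp).1.norm).const_mul (|q-p|/ |p|)
    have l2 := ((int_lor q hq).1.norm).const_mul (|q-p|/ |q|)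
    refine (l1.add l2).mono' ?_ (Eventually.of_forall fun y => ?_)
    · apply Continuous.aestronglyMeasurable
      exact (Continuous.inv₀ (by fun_prop) hp').sub (Continuous.inv₀ (by fun_prop) hq')
    · rw [inv_sub_inv (hp' y) (hq' y)]
      have e : (y:ℂ) + q * I - (y + p * I) = ((q - p : ℝ) : ℂ) * I := by push_cast; ring
      rw [e, norm_div, norm_mul, norm_mul, norm_I, mul_one, norm_real, Real.norm_eq_abs]
      simp only [Pi.add_apply, norm_div, Real.norm_eq_abs]
      have h1 := nb y p hp
      have h2 := nb y q hq
      have p1 : 0 < ‖(y:ℂ) + p * I‖ := norm_pos_iff.2 (hp' y)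
      have p2 : 0 < ‖(y:ℂ) + q * I‖ := norm_pos_iff.2 (hq' y)
      have pp : 0 < |p| := abs_pos.2 hp
      have qq : 0 < |q| := abs_pos.2 hq
      have p3 : 0 < y^2 + p^2 := by positivity
      have p4 : 0 < y^2 + q^2 := by positivity
      rw [abs_of_pos p3, abs_of_pos p4]
      set u := ‖(y:ℂ) + p * I‖
      set v := ‖(y:ℂ) + q * I‖
      have : 1/(u * v) ≤ 1/(u^2) + 1/(v^2) := by
        have := sq_nonneg (1/u - 1/v)
        have h3 : 0 ≤ 1/(u*v) := by positivity
        have e2: (1/u - 1/v)^2 = 1/u^2 + 1/v^2 - 2 * (1/(u*v)) := by field_simp; ring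
        linarith
      have a1 : 1/u^2 ≤ 1/(y^2 + p^2) := one_div_le_one_div_of_le p3 h1
      have a2 : 1/v^2 ≤ 1/(y^2 + q^2) := one_div_le_one_div_of_le p4 h2
      calc |q-p|/(u*v) = |q-p| * (1/(u*v)) := by ring
        _ ≤ |q-p| * (1/(y^2+p^2) + 1/(y^2+q^2)) := by gcongr; linarith
        _ = _ := by field_simp
  refine ⟨hint, ?_⟩
  set f := fun y : ℝ => ((y:ℂ) + p * I)⁻¹ - ((y:ℂ) + q * I)⁻¹
  have h2 : ∫ y, f y = ∫ y, f (-y) := (integral_neg_eq_self f volume).symm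
  have h3 : ∫ y, (f y + f (-y)) = (∫ y, f y) + ∫ y, f y := by
    rw [integral_add hint hint.comp_neg, ← h2]
  have h4 : ∀ y, f y + f (-y) = -2 * I * ((p / (y^2+p^2) : ℝ) : ℂ) + 2 * I * ((q / (y^2+q^2) : ℝ) : ℂ) := by
    intro y
    have k : ∀ p : ℝ, p ≠ 0 → ((y:ℂ) + p * I)⁻¹ + (((-y : ℝ):ℂ) + p * I)⁻¹ = -2 * I * ((p / (y^2+p^2) : ℝ) : ℂ) := by
      intro p hp
      have n1 := ne_ln y p hp
      have n2 := ne_ln (-y) p hp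
      have n3 : ((y:ℂ)^2 + p^2) ≠ 0 := by
        have : y^2 + p^2 ≠ 0 := by positivity
        exact_mod_cast this
      push_cast at n2 ⊢
      field_simp
      ring_nf
      have i3 : (Complex.I)^3 = -Complex.I := by rw [pow_succ, I_sq]; ring
      simp only [i3]
      ring
    have := k p hp
    have := k q hq
    simp only [f]
    linear_combination k p hp - k q hq
  simp_rw [h4] at h3
  rw [integral_add (((int_lor p hp).1.ofReal).const_mul _) (((int_lor q hq).1.ofReal).const_mul _), integral_const_mul, integral_const_mul, integral_complex_ofReal, integral_complex_ofReal,
    (int_lor p hp).2, (int_lor q hq).2] at h3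
  push_cast at h3 ⊢
  linear_combination (-1/2) * h3


theorem sq_le_norm_ln (y p : ℝ) : y^2 + p^2 = ‖(y:ℂ) + p * I‖^2 := by
  rw [Complex.sq_norm, Complex.normSq_apply]; simp; ring

theorem int_cube (p : ℝ) (hp : p ≠ 0) :
    (Integrable fun y : ℝ => 1 / ((y:ℂ) + p * I)^3) ∧ ∫ y : ℝ, 1 / ((y:ℂ) + p * I)^3 = 0 := by
  have hint : Integrable fun y : ℝ => 1 / ((y:ℂ) + p * I)^3 := by
    refine (((int_lor p hp).1.norm).const_mul (1/ |p|^2)).mono' ?_ (Eventually.of_forall fun y => ?_)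
    · apply Continuous.aestronglyMeasurable
      exact Continuous.div₀ (by fun_prop) (by fun_prop) (fun y => pow_ne_zero _ (ne_ln y p hp))
    · have h := sq_le_norm_ln y p
      have h1 : |p| ≤ ‖(y:ℂ) + p * I‖ := by
        have := Complex.abs_im_le_norm ((y:ℂ) + p * I)
        simpa using this
      have p3 : 0 < y^2 + p^2 := by positivity
      have pp : 0 < |p| := abs_pos.2 hp
      rw [norm_div, norm_div, Real.norm_eq_abs, Real.norm_eq_abs, abs_of_pos p3, norm_pow, h, norm_one]
      set u := ‖(y:ℂ) + p * I‖
      have : 0 < u := by linarith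
      have e : 1/ |p|^2 * (|p|/u^2) = 1/(|p| * u^2) := by field_simp
      rw [e]
      apply one_div_le_one_div_of_le (by positivity)
      calc |p| * u^2 ≤ u * u^2 := by gcongr
        _ = u^3 := by ring
  refine ⟨hint, ?_⟩
  have hder : ∀ y : ℝ, HasDerivAt (fun y : ℝ => -1/2 * (((y:ℂ) + p * I)^2)⁻¹) (1 / ((y:ℂ) + p * I)^3) y := by
    intro y
    have n := ne_ln y p hp
    have h0 : HasDerivAt (fun y : ℝ => ((y:ℂ) + p * I)) 1 y := by
      simpa using (Complex.ofRealCLM.hasDerivAt (x := y)).add_const (p * I)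
    have := ((h0.pow 2).inv (pow_ne_zero _ n)).const_mul (-1/2 : ℂ)
    refine this.congr_deriv ?_
    simp only [Pi.pow_apply]
    field_simp
    try ring
  have hlim : ∀ l : Filter ℝ, Tendsto (fun y : ℝ => y^2) l atTop →
      Tendsto (fun y : ℝ => -1/2 * (((y:ℂ) + p * I)^2)⁻¹) l (𝓝 0) := by
    intro l hl
    rw [tendsto_zero_iff_norm_tendsto_zero]
    have : Tendsto (fun y : ℝ => 1/2 * (y^2 + p^2)⁻¹) l (𝓝 0) := by
      have := tendsto_inv_atTop_zero.comp (tendsto_atTop_add_const_right l (p^2) hl)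
      simpa using this.const_mul (1/2 : ℝ)
    refine this.congr fun y => ?_
    rw [norm_mul, norm_inv, norm_pow, ← sq_le_norm_ln]
    norm_num
  have a := integral_of_hasDerivAt_of_tendsto hder hint
    (hlim _ ((tendsto_pow_atTop two_ne_zero).comp tendsto_neg_atBot_atTop |>.congr (by simp)))
    (hlim _ (tendsto_pow_atTop two_ne_zero))
  simpa using a

theorem residue_strip (f : ℂ → ℂ) (ε : ℝ) (hε : 0 < ε) (A c : ℂ) (C : ℝ)
    (hd : ∀ z : ℂ, z ≠ 0 → |z.im| ≤ ε → DifferentiableAt ℂ f z)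
    (hlim : Tendsto (fun z => z * (f z - A / z^3 - c / z)) (𝓝[≠] 0) (𝓝 0))
    (hb : ∀ x y : ℝ, |y| ≤ ε → 1 ≤ |x| → ‖f (x + y * I)‖ ≤ C * (1 + x ^ 2)⁻¹)
    (h1 : Integrable fun x : ℝ => f (x + ε * I))
    (h2 : Integrable fun x : ℝ => f (x + (-ε : ℝ) * I)) :
    (∫ x : ℝ, f (x + ε * I)) - ∫ x : ℝ, f (x + (-ε : ℝ) * I) = - 2 * Real.pi * I * c := by
  set M : ℂ := ((2 * ε : ℝ) : ℂ) * I with hM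
  have hMne : ∀ z : ℂ, |z.im| ≤ ε → z + M ≠ 0 := by
    intro z hz h
    have := congrArg Complex.im h
    simp [hM] at this
    have := (abs_le.1 hz).1
    linarith
  set g : ℂ → ℂ := fun z => f z - A * (1 / z^3) - c * (z⁻¹ - (z + M)⁻¹) with hg
  have hgd : ∀ z : ℂ, z ≠ 0 → |z.im| ≤ ε → DifferentiableAt ℂ g z := by
    intro z hz hi
    have := hd z hz hi
    have h3 := hMne z hi
    have h4 : z^3 ≠ 0 := pow_ne_zero _ hz
    simp only [hg]
    fun_prop (disch := assumption)
  set G := Function.update g 0 (limUnder (𝓝[≠] 0) g) with hG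
  have hUo : IsOpen {z : ℂ | |z.im| < ε} := isOpen_lt (by fun_prop) continuous_const
  have hU : {z : ℂ | |z.im| < ε} ∈ 𝓝 (0:ℂ) := hUo.mem_nhds (by simpa using hε)
  have hG0 : DifferentiableAt ℂ G 0 := by
    refine (Complex.differentiableOn_update_limUnder_of_isLittleO hU ?_ ?_).differentiableAt hU
    · intro z hz
      exact (hgd z hz.2 (le_of_lt hz.1)).differentiableWithinAt
    · rw [Asymptotics.isLittleO_iff_tendsto']
      · have e : Tendsto (fun z : ℂ => z * (f z - A / z^3 - c / z) + z * (c * (z + M)⁻¹) - z * g 0) (𝓝[≠] 0) (𝓝 (0 + 0 * (c * (0 + M)⁻¹) - 0 * g 0)) := by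
          have hc : ContinuousAt (fun z : ℂ => z * (c * (z + M)⁻¹)) 0 := by
            have := hMne 0 (by simpa using hε.le)
            fun_prop (disch := assumption)
          exact (hlim.add (hc.tendsto.mono_left nhdsWithin_le_nhds)).sub
            ((continuous_id.mul continuous_const).tendsto (0:ℂ) |>.mono_left nhdsWithin_le_nhds)
        simp only [zero_mul, add_zero, sub_zero] at e
        refine e.congr' ?_
        filter_upwards [self_mem_nhdsWithin] with z hz
        have hz' : z ≠ 0 := hz
        simp only [sub_zero, hg]
        field_simp
        ring
      · filter_upwards [self_mem_nhdsWithin] with z hz h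
        have hz' : z ≠ 0 := hz
        simp [hz'] at h
  have hGd : ∀ z : ℂ, z.im ∈ uIcc ε (-ε) → DifferentiableAt ℂ G z := by
    intro z hz
    rw [uIcc_of_ge (by linarith)] at hz
    by_cases h0 : z = 0
    · rw [h0]; exact hG0
    · refine (hgd z h0 (abs_le.2 hz)).congr_of_eventuallyEq ?_
      filter_upwards [isOpen_ne.mem_nhds h0] with w hw
      simp [hG, Function.update_of_ne hw]
  have hGe : ∀ x y : ℝ, (x:ℂ) + y * I ≠ 0 → G (x + y * I) = f (x + y * I) - A * (1 / ((x:ℂ) + y * I)^3) -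
      c * (((x:ℂ) + y * I)⁻¹ - ((x:ℂ) + (y + 2 * ε : ℝ) * I)⁻¹) := by
    intro x y h
    simp only [hG, Function.update_of_ne h, hg, hM]
    congr 4
    push_cast; ring
  have hline : ∀ y : ℝ, y ≠ 0 → y + 2 * ε ≠ 0 → (Integrable fun x : ℝ => f (x + y * I)) →
      (Integrable fun x : ℝ => G (x + y * I)) ∧ ∫ x : ℝ, G (x + y * I) = (∫ x : ℝ, f (x + y * I)) -
        c * (- I * Real.pi * ((SignType.sign y : ℝ) - (SignType.sign (y + 2 * ε) : ℝ))) := by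
    intro y hy hy2 hi
    have i1 := int_cube y hy
    have i2 := int_pole_diff y (y + 2 * ε) hy hy2
    simp_rw [fun x => hGe x y (ne_ln x y hy)]
    refine ⟨(hi.sub (i1.1.const_mul A)).sub (i2.1.const_mul c), ?_⟩
    rw [integral_sub, integral_sub, integral_const_mul, integral_const_mul, i1.2, i2.2]
    · simp
    · exact hi
    · exact i1.1.const_mul A
    · exact hi.sub (i1.1.const_mul A)
    · exact i2.1.const_mul c
  have l1 := hline ε hε.ne' (by positivity) h1
  have l2 := hline (-ε) (by simpa using hε.ne') (by linarith) h2
  have key := shift_line G ε (-ε) (C + ‖A‖ * 2 + ‖c‖ * (2 * ε * 2)) hGd ?_ l1.1 l2.1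
  · rw [l1.2, l2.2, sign_pos hε, sign_neg (by linarith : -ε < 0), sign_pos (by linarith : (0:ℝ) < ε + 2 * ε), sign_pos (by linarith : (0:ℝ) < -ε + 2 * ε)] at key
    simp only [SignType.coe_one, SignType.coe_neg, ofReal_one, ofReal_neg, sub_self, mul_zero, sub_zero] at key
    rw [key, ← ofReal_neg]
    ring
  · intro x y hy hx
    rw [uIcc_of_ge (by linarith)] at hy
    have hne : (x:ℂ) + y * I ≠ 0 := by
      intro h
      have := congrArg Complex.re h
      simp at this
      rw [this] at hx
      norm_num at hx
    rw [hGe x y hne]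
    have hx2 : 1 ≤ x^2 := by rw [← sq_abs]; nlinarith
    have q : ∀ y : ℝ, (1 + x^2)/2 ≤ ‖(x:ℂ) + y * I‖^2 := by
      intro y; rw [← sq_le_norm_ln]; nlinarith [sq_nonneg y]
    have q1 : ∀ y : ℝ, |x| ≤ ‖(x:ℂ) + y * I‖ := by
      intro y
      have := Complex.abs_re_le_norm ((x:ℂ) + y * I)
      simpa using this
    have b1 := hb x y (abs_le.2 hy) hx
    have hpos : 0 < 1 + x^2 := by positivity
    have b2 : ‖A * (1 / ((x:ℂ) + y * I)^3)‖ ≤ ‖A‖ * (2 * (1 + x^2)⁻¹) := by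
      rw [norm_mul, norm_div, norm_pow, norm_one]
      gcongr
      have := q y
      have h1 := (hx.trans (q1 y))
      set u := ‖(x:ℂ) + y * I‖
      calc 1/u^3 ≤ 1/((1+x^2)/2) := by
            apply one_div_le_one_div_of_le (by positivity)
            nlinarith [sq_nonneg u]
        _ = _ := by field_simp
    have b3 : ‖c * (((x:ℂ) + y * I)⁻¹ - ((x:ℂ) + (y + 2 * ε : ℝ) * I)⁻¹)‖ ≤ ‖c‖ * (2 * ε * (2 * (1 + x^2)⁻¹)) := by
      have hne2 : (x:ℂ) + (y + 2 * ε : ℝ) * I ≠ 0 := by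
        rw [← norm_pos_iff]; linarith [q1 (y + 2 * ε)]
      rw [norm_mul, inv_sub_inv hne hne2]
      have e : (x:ℂ) + (y + 2 * ε : ℝ) * I - (x + y * I) = ((2 * ε : ℝ) : ℂ) * I := by push_cast; ring
      rw [e, norm_div, norm_mul, norm_mul, norm_I, mul_one, norm_real, Real.norm_eq_abs, abs_of_pos (by positivity)]
      gcongr
      have h1 := q1 y
      have h2 := q1 (y + 2 * ε)
      set u := ‖(x:ℂ) + y * I‖
      set v := ‖(x:ℂ) + (y + 2 * ε : ℝ) * I‖
      calc 2 * ε / (u * v) ≤ 2 * ε / ((1 + x^2)/2) := by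
            apply div_le_div_of_nonneg_left (by positivity) (by positivity)
            have : |x| * |x| ≤ u * v := by gcongr
            rw [← sq, sq_abs] at this
            linarith
        _ = _ := by field_simp
    calc _ ≤ _ := norm_sub_le _ _
      _ ≤ _ := add_le_add_left (norm_sub_le _ _) _
      _ ≤ C * (1 + x^2)⁻¹ + ‖A‖ * (2 * (1 + x^2)⁻¹) + ‖c‖ * (2 * ε * (2 * (1 + x^2)⁻¹)) := by gcongr
      _ = _ := by ring


noncomputable def kf (b : ℝ) (z T : ℂ) : ℂ :=
  cexp (-(2 * I * T * z)) / (4 * T * sinh (b * T) * sinh (T / b))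

noncomputable def Iw (b ε : ℝ) (z : ℂ) : ℂ := ∫ t : ℝ, kf b z (t + ε * I)

noncomputable def lw (b ε : ℝ) (z : ℂ) : ℂ :=
  I * Real.pi / 2 * z ^ 2 + I * Real.pi / 24 * ((b:ℂ)^2 + (b:ℂ)⁻¹^2) - Iw b ε z

theorem normsq_sinh (x y : ℝ) : ‖sinh ((x:ℂ) + y * I)‖^2 = Real.sinh x^2 + Real.sin y^2 := by
  rw [Complex.sinh_add, Complex.sinh_mul_I, Complex.cosh_mul_I, Complex.sq_norm, Complex.normSq_apply]
  rw [← ofReal_sinh, ← ofReal_cosh, ← ofReal_sin, ← ofReal_cos]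
  simp only [add_re, mul_re, ofReal_re, ofReal_im, I_re, I_im, add_im, mul_im, mul_zero, mul_one, zero_mul, sub_zero, add_zero, zero_add]
  have h1 := Real.cosh_sq x
  have h2 := Real.sin_sq_add_cos_sq y
  have h3 : Real.cos y^2 = 1 - Real.sin y^2 := by linarith
  linear_combination Real.sinh x ^2 * h3 + Real.sin y^2 * h1

theorem sinh_lb1 (x y : ℝ) : |Real.sin y| * Real.exp |x| / 2 ≤ ‖sinh ((x:ℂ) + y * I)‖ := by
  have h := normsq_sinh x y
  have h1 := Real.cosh_sq x
  have h2 := Real.sin_sq_add_cos_sq y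
  have h3 : Real.exp |x| / 2 ≤ Real.cosh x := by
    rw [← Real.cosh_abs, Real.cosh_eq]; linarith [Real.exp_pos (-|x|)]
  have h4 : |Real.sin y| * Real.cosh x ≤ ‖sinh ((x:ℂ) + y * I)‖ := by
    apply abs_le_of_sq_le_sq' _ (norm_nonneg _) |>.2
    rw [h, mul_pow, sq_abs, h1]
    nlinarith [sq_nonneg (Real.sinh x), sq_nonneg (Real.cos y), mul_nonneg (sq_nonneg (Real.sinh x)) (sq_nonneg (Real.cos y))]
  calc _ = |Real.sin y| * (Real.exp |x| / 2) := by ring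
    _ ≤ |Real.sin y| * Real.cosh x := by gcongr
    _ ≤ _ := h4

theorem sinh_lb2 (x y x0 : ℝ) (h0 : x0 ≤ |x|) :
    (1 - Real.exp (-2 * x0)) / 2 * Real.exp |x| ≤ ‖sinh ((x:ℂ) + y * I)‖ := by
  have h := normsq_sinh x y
  have h4 : |Real.sinh x| ≤ ‖sinh ((x:ℂ) + y * I)‖ := by
    apply abs_le_of_sq_le_sq' _ (norm_nonneg _) |>.2
    rw [h, sq_abs]
    nlinarith [sq_nonneg (Real.sin y)]
  refine le_trans ?_ h4
  rw [Real.abs_sinh, Real.sinh_eq]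
  have : Real.exp (-|x|) ≤ Real.exp (-2 * x0) * Real.exp |x| := by
    rw [← Real.exp_add]; apply Real.exp_le_exp.2; linarith
  linarith

theorem sinh_ne (z : ℂ) (hz : z ≠ 0) (hi : |z.im| < Real.pi) : sinh z ≠ 0 := by
  intro h
  have h1 := normsq_sinh z.re z.im
  rw [re_add_im, h, norm_zero] at h1
  have h2 : Real.sinh z.re = 0 := by nlinarith [sq_nonneg (Real.sinh z.re), sq_nonneg (Real.sin z.im)]
  have h3 : Real.sin z.im = 0 := by nlinarith [sq_nonneg (Real.sinh z.re), sq_nonneg (Real.sin z.im)]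
  have h4 := Real.sinh_eq_zero.1 h2
  have h5 := (Real.sin_eq_zero_iff_of_lt_of_lt (abs_lt.1 hi).1 (abs_lt.1 hi).2).1 h3
  exact hz (Complex.ext h4 h5)

/-- parameters -/
structure PP (b ε : ℝ) : Prop where
  hb : 0 < b
  he : 0 < ε
  h1 : b * ε < Real.pi
  h2 : ε / b < Real.pi

theorem PP.sin1 {b ε : ℝ} (h : PP b ε) : 0 < Real.sin (b * ε) :=
  Real.sin_pos_of_pos_of_lt_pi (mul_pos h.hb h.he) h.h1
theorem PP.sin2 {b ε : ℝ} (h : PP b ε) : 0 < Real.sin (ε / b) :=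
  Real.sin_pos_of_pos_of_lt_pi (div_pos h.he h.hb) h.h2

theorem arg1 (b t y : ℝ) : (b:ℂ) * (t + y * I) = ((b * t : ℝ):ℂ) + ((b * y : ℝ):ℂ) * I := by
  push_cast; ring
theorem arg2 (b t y : ℝ) : ((t:ℂ) + y * I) / b = ((t / b : ℝ):ℂ) + ((y / b : ℝ):ℂ) * I := by
  push_cast; ring

theorem norm_ln_ge (t y : ℝ) : |y| ≤ ‖(t:ℂ) + y * I‖ := by
  have := Complex.abs_im_le_norm ((t:ℂ) + y * I)
  simpa using this

theorem sinh1_ne {b ε : ℝ} (h : PP b ε) (z : ℂ) (hz : z ≠ 0) (hi : |z.im| ≤ ε) : sinh (b * z) ≠ 0 := by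
  refine sinh_ne _ (mul_ne_zero (by exact_mod_cast h.hb.ne') hz) ?_
  rw [im_ofReal_mul, abs_mul, abs_of_pos h.hb]
  have := h.hb
  nlinarith [h.h1]

theorem sinh2_ne {b ε : ℝ} (h : PP b ε) (z : ℂ) (hz : z ≠ 0) (hi : |z.im| ≤ ε) : sinh (z / b) ≠ 0 := by
  refine sinh_ne _ (div_ne_zero hz (by exact_mod_cast h.hb.ne')) ?_
  rw [div_ofReal_im, abs_div, abs_of_pos h.hb]
  have := h.hb
  exact lt_of_le_of_lt (by gcongr) h.h2

theorem norm_exp_arg (t y : ℝ) (z : ℂ) :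
    ‖cexp (-(2 * I * (t + y * I) * z))‖ = Real.exp (2 * (t * z.im + y * z.re)) := by
  rw [Complex.norm_exp]
  congr 1
  simp
  ring

theorem kf_bound {b ε : ℝ} (h : PP b ε) (z : ℂ) (t : ℝ) :
    ‖kf b z (t + ε * I)‖ ≤ 1 / (ε * Real.sin (b * ε) * Real.sin (ε / b)) * Real.exp (2 * ε * z.re) *
      Real.exp (-((b + b⁻¹) - 2 * |z.im|) * |t|) := by
  have hb := h.hb
  have he := h.he
  have s1 := h.sin1
  have s2 := h.sin2
  have l1 := sinh_lb1 (b * t) (b * ε)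
  have l2 := sinh_lb1 (t / b) (ε / b)
  rw [← arg1, abs_of_pos s1, abs_mul, abs_of_pos hb] at l1
  rw [← arg2, abs_of_pos s2, abs_div, abs_of_pos hb] at l2
  have l3 := norm_ln_ge t ε
  rw [abs_of_pos he] at l3
  rw [kf, norm_div, norm_exp_arg, norm_mul, norm_mul, norm_mul, Complex.norm_ofNat]
  calc _ ≤ Real.exp (2 * (t * z.im + ε * z.re)) / (4 * ε * (Real.sin (b * ε) * Real.exp (b * |t|) / 2) * (Real.sin (ε / b) * Real.exp (|t| / b) / 2)) := by
        gcongr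
    _ = 1 / (ε * Real.sin (b * ε) * Real.sin (ε / b)) * (Real.exp (2 * (t * z.im + ε * z.re)) * Real.exp (-(b * |t|)) * Real.exp (-(|t| / b))) := by
        rw [Real.exp_neg, Real.exp_neg]; field_simp; norm_num
    _ ≤ 1 / (ε * Real.sin (b * ε) * Real.sin (ε / b)) * (Real.exp (2 * ε * z.re) * Real.exp (-((b + b⁻¹) - 2 * |z.im|) * |t|)) := by
        refine mul_le_mul_of_nonneg_left ?_ (by positivity)
        rw [← Real.exp_add, ← Real.exp_add, ← Real.exp_add]
        apply Real.exp_le_exp.2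
        have : t * z.im ≤ |t| * |z.im| := by rw [← abs_mul]; exact le_abs_self _
        have e : |t| / b = b⁻¹ * |t| := by ring
        rw [e]
        nlinarith
    _ = _ := by ring

theorem kf_cont {b ε : ℝ} (h : PP b ε) (z : ℂ) : Continuous fun t : ℝ => kf b z (t + ε * I) := by
  unfold kf
  refine Continuous.div₀ (by fun_prop) (by fun_prop) fun t => ?_
  have hn := ne_ln t ε h.he.ne'
  have hi : |((t:ℂ) + ε * I).im| ≤ ε := by simp [abs_of_pos h.he]
  exact mul_ne_zero (mul_ne_zero (mul_ne_zero (by norm_num) hn) (sinh1_ne h _ hn hi)) (sinh2_ne h _ hn hi)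

theorem kf_int {b ε : ℝ} (h : PP b ε) (z : ℂ) (hz : |z.im| < (b + b⁻¹) / 2) :
    Integrable fun t : ℝ => kf b z (t + ε * I) :=
  integrable_of_exp_bound _ (kf_cont h z) _ _ (by linarith) (kf_bound h z)

theorem Iw_bound {b ε : ℝ} (h : PP b ε) (δ : ℝ) (hδ : 0 < δ) : ∃ K, 0 ≤ K ∧ ∀ z : ℂ, |z.im| ≤ (b + b⁻¹) / 2 - δ →
    ‖Iw b ε z‖ ≤ K * Real.exp (2 * ε * z.re) := by
  have s1 := h.sin1
  have s2 := h.sin2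
  have he := h.he
  set M := 1 / (ε * Real.sin (b * ε) * Real.sin (ε / b)) with hM
  have hM0 : 0 < M := by positivity
  have hi := integrable_exp_abs (2 * δ) (by positivity)
  refine ⟨M * ∫ t : ℝ, Real.exp (-(2 * δ) * |t|), mul_nonneg hM0.le (integral_nonneg fun t => (Real.exp_pos _).le), fun z hz => ?_⟩
  calc _ ≤ ∫ t : ℝ, M * Real.exp (2 * ε * z.re) * Real.exp (-(2 * δ) * |t|) := by
        refine norm_integral_le_of_norm_le (hi.const_mul _) (Eventually.of_forall fun t => (kf_bound h z t).trans ?_)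
        rw [← hM]
        gcongr
        linarith
    _ = _ := by rw [integral_const_mul]; ring

theorem strip_open (r : ℝ) : IsOpen {z : ℂ | |z.im| < r} := isOpen_lt (by fun_prop) continuous_const

theorem Iw_diff {b ε : ℝ} (h : PP b ε) : DifferentiableOn ℂ (Iw b ε) {z | |z.im| < (b + b⁻¹) / 2} := by
  refine holo_integral (strip_open _) (fun z t => kf b z (t + ε * I)) (fun z _ => (kf_cont h z).aestronglyMeasurable)
    (fun t => ?_) (fun z₀ hz₀ => ?_)
  · unfold kf
    fun_prop
  · simp only [mem_ofPred_eq] at hz₀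
    have s1 := h.sin1
    have s2 := h.sin2
    have he := h.he
    set d := ((b + b⁻¹) / 2 - |z₀.im|) / 2 with hd
    have hd0 : 0 < d := by rw [hd]; linarith
    refine ⟨d, hd0, fun t => (1 / (ε * Real.sin (b * ε) * Real.sin (ε / b)) * Real.exp (2 * ε * (z₀.re + d))) * Real.exp (-(2 * d) * |t|), (integrable_exp_abs _ (by positivity)).const_mul _, fun z hz t => (kf_bound h z t).trans ?_⟩
    rw [Metric.mem_ball, dist_eq] at hz
    have r1 := (Complex.abs_re_le_norm (z - z₀)).trans hz.le
    have r2 := (Complex.abs_im_le_norm (z - z₀)).trans hz.le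
    rw [sub_re] at r1
    rw [sub_im] at r2
    have r3 := (abs_le.1 r1).2
    have r4 : |z.im| ≤ |z₀.im| + d := by
      have := abs_sub_abs_le_abs_sub z.im z₀.im
      linarith
    refine mul_le_mul (mul_le_mul_of_nonneg_left (Real.exp_le_exp.2 ?_) (by positivity)) (Real.exp_le_exp.2 ?_) (Real.exp_pos _).le (by positivity)
    · nlinarith
    · refine mul_le_mul_of_nonneg_right ?_ (abs_nonneg t)
      linarith


theorem exp4 (x : ℂ) (hx : ‖x‖ ≤ 1) : ‖cexp x - (1 + x + x^2/2 + x^3/6)‖ ≤ ‖x‖^4 := by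
  have := Complex.exp_bound hx (n := 4) (by norm_num)
  simp only [Finset.sum_range_succ, Finset.sum_range_zero, Nat.factorial] at this
  norm_num at this
  refine this.trans ?_
  have : 0 ≤ ‖x‖^4 := by positivity
  linarith

theorem sinh_tay (x : ℂ) (hx : ‖x‖ ≤ 1) : ‖sinh x - x - x^3/6‖ ≤ ‖x‖^4 := by
  have h1 := exp4 x hx
  have h2 := exp4 (-x) (by rwa [norm_neg])
  rw [norm_neg] at h2
  have e : sinh x - x - x^3/6 = ((cexp x - (1 + x + x^2/2 + x^3/6)) - (cexp (-x) - (1 + (-x) + (-x)^2/2 + (-x)^3/6)))/2 := by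
    rw [Complex.sinh]; ring
  rw [e, norm_div, Complex.norm_ofNat]
  have := norm_sub_le (cexp x - (1 + x + x^2/2 + x^3/6)) (cexp (-x) - (1 + (-x) + (-x)^2/2 + (-x)^3/6))
  linarith

theorem cosh_tay (x : ℂ) (hx : ‖x‖ ≤ 1) : ‖cosh x - 1 - x^2/2‖ ≤ ‖x‖^4 := by
  have h1 := exp4 x hx
  have h2 := exp4 (-x) (by rwa [norm_neg])
  rw [norm_neg] at h2
  have e : cosh x - 1 - x^2/2 = ((cexp x - (1 + x + x^2/2 + x^3/6)) + (cexp (-x) - (1 + (-x) + (-x)^2/2 + (-x)^3/6)))/2 := by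
    rw [Complex.cosh]; ring
  rw [e, norm_div, Complex.norm_ofNat]
  have := norm_add_le (cexp x - (1 + x + x^2/2 + x^3/6)) (cexp (-x) - (1 + (-x) + (-x)^2/2 + (-x)^3/6))
  linarith

theorem ev_small (r : ℝ) (hr : 0 < r) : ∀ᶠ z : ℂ in 𝓝[≠] 0, ‖z‖ ≤ r ∧ z ≠ 0 := by
  have h : ∀ᶠ z : ℂ in 𝓝[≠] 0, ‖z‖ ≤ r := by
    refine nhdsWithin_le_nhds ?_
    filter_upwards [Metric.closedBall_mem_nhds (0:ℂ) hr] with z hz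
    simpa using hz
  filter_upwards [h, self_mem_nhdsWithin] with z h1 h2 using ⟨h1, h2⟩

theorem lim_cosh : Tendsto (fun z : ℂ => (cosh z - 1) / z^2) (𝓝[≠] 0) (𝓝 (1/2)) := by
  rw [← tendsto_sub_nhds_zero_iff]
  have h0 : Tendsto (fun z : ℂ => ‖z‖^2) (𝓝[≠] 0) (𝓝 0) := by
    have : Continuous fun z : ℂ => ‖z‖^2 := by fun_prop
    simpa using (this.tendsto 0).mono_left nhdsWithin_le_nhds
  refine squeeze_zero_norm' ?_ h0
  filter_upwards [ev_small 1 one_pos] with z ⟨h1, h2⟩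
  have := cosh_tay z h1
  have e : (cosh z - 1) / z^2 - 1/2 = (cosh z - 1 - z^2/2)/z^2 := by field_simp
  have p : 0 < ‖z‖ := norm_pos_iff.2 h2
  rw [e, norm_div, norm_pow, div_le_iff₀ (by positivity)]
  calc _ ≤ _ := this
    _ = _ := by ring

theorem lim_sinh3 : Tendsto (fun z : ℂ => (sinh z - z) / z^3) (𝓝[≠] 0) (𝓝 (1/6)) := by
  rw [← tendsto_sub_nhds_zero_iff]
  have h0 : Tendsto (fun z : ℂ => ‖z‖) (𝓝[≠] 0) (𝓝 0) := by
    simpa using (continuous_norm.tendsto (0:ℂ)).mono_left nhdsWithin_le_nhds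
  refine squeeze_zero_norm' ?_ h0
  filter_upwards [ev_small 1 one_pos] with z ⟨h1, h2⟩
  have := sinh_tay z h1
  have e : (sinh z - z) / z^3 - 1/6 = (sinh z - z - z^3/6)/z^3 := by field_simp
  have p : 0 < ‖z‖ := norm_pos_iff.2 h2
  rw [e, norm_div, norm_pow, div_le_iff₀ (by positivity)]
  calc _ ≤ _ := this
    _ = _ := by ring

theorem lim_sinh1 : Tendsto (fun z : ℂ => sinh z / z) (𝓝[≠] 0) (𝓝 1) := by
  have h := (Complex.hasDerivAt_sinh 0)
  rw [hasDerivAt_iff_tendsto_slope, Complex.cosh_zero] at h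
  refine h.congr fun z => ?_
  simp [slope]
  ring

theorem lim_inv : Tendsto (fun z : ℂ => z / sinh z) (𝓝[≠] 0) (𝓝 1) := by
  have := lim_sinh1.inv₀ one_ne_zero
  rw [inv_one] at this
  refine this.congr fun z => ?_
  simp

theorem lim_inv2 : Tendsto (fun z : ℂ => (z / sinh z - 1) / z^2) (𝓝[≠] 0) (𝓝 (-1/6)) := by
  have := (lim_sinh3.mul lim_inv).neg
  have e : -(1/6 * 1) = (-1/6 : ℂ) := by norm_num
  rw [e] at this
  refine this.congr' ?_
  filter_upwards [ev_small 1 one_pos] with z ⟨h1, h2⟩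
  have : sinh z ≠ 0 := by
    refine sinh_ne z h2 ?_
    have := (Complex.abs_im_le_norm z).trans h1
    linarith [Real.pi_gt_three]
  field_simp
  ring

theorem lim_scale {g : ℂ → ℂ} {L : ℂ} (h : Tendsto (fun z : ℂ => g z / z^2) (𝓝[≠] 0) (𝓝 L)) (c : ℂ) (hc : c ≠ 0) :
    Tendsto (fun z : ℂ => g (c * z) / z^2) (𝓝[≠] 0) (𝓝 (c^2 * L)) := by
  have h1 : Tendsto (fun z : ℂ => c * z) (𝓝[≠] 0) (𝓝[≠] 0) := by
    refine tendsto_nhdsWithin_iff.2 ⟨?_, ?_⟩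
    · have : Continuous fun z : ℂ => c * z := by fun_prop
      simpa using (this.tendsto 0).mono_left nhdsWithin_le_nhds
    · filter_upwards [self_mem_nhdsWithin] with z hz
      exact mul_ne_zero hc hz
  refine ((h.comp h1).const_mul (c^2)).congr' ?_
  filter_upwards [self_mem_nhdsWithin] with z hz
  have : z ≠ 0 := hz
  simp only [Function.comp]
  field_simp

theorem kf_bound2 {b ε : ℝ} (h : PP b ε) (z : ℂ) : ∃ C, 0 ≤ C ∧ ∀ x y : ℝ, |y| ≤ ε → 1 ≤ |x| →
    ‖kf b z (x + y * I)‖ ≤ C * Real.exp (-((b + b⁻¹) - 2 * |z.im|) * |x|) := by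
  have hb := h.hb
  set s1 := (1 - Real.exp (-2 * b)) / 2 with hs1
  set s2 := (1 - Real.exp (-2 * b⁻¹)) / 2 with hs2
  have p1 : 0 < s1 := by
    have : Real.exp (-2 * b) < 1 := Real.exp_lt_one_iff.2 (by linarith)
    rw [hs1]; linarith
  have p2 : 0 < s2 := by
    have : Real.exp (-2 * b⁻¹) < 1 := Real.exp_lt_one_iff.2 (by have := inv_pos.2 hb; linarith)
    rw [hs2]; linarith
  refine ⟨1 / (4 * s1 * s2) * Real.exp (2 * ε * |z.re|), by positivity, fun x y hy hx => ?_⟩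
  have l1 := sinh_lb2 (b * x) (b * y) b (by rw [abs_mul, abs_of_pos hb]; nlinarith)
  have l2 := sinh_lb2 (x / b) (y / b) b⁻¹ (by rw [abs_div, abs_of_pos hb, inv_eq_one_div]; gcongr)
  rw [← arg1, abs_mul, abs_of_pos hb, ← hs1] at l1
  rw [← arg2, abs_div, abs_of_pos hb, ← hs2] at l2
  have l3 : 1 ≤ ‖(x:ℂ) + y * I‖ := by
    have := Complex.abs_re_le_norm ((x:ℂ) + y * I)
    simp at this
    linarith
  rw [kf, norm_div, norm_exp_arg, norm_mul, norm_mul, norm_mul, Complex.norm_ofNat]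
  calc _ ≤ Real.exp (2 * (x * z.im + y * z.re)) / (4 * 1 * (s1 * Real.exp (b * |x|)) * (s2 * Real.exp (|x| / b))) := by
        gcongr
    _ = 1 / (4 * s1 * s2) * (Real.exp (2 * (x * z.im + y * z.re)) * Real.exp (-(b * |x|)) * Real.exp (-(|x| / b))) := by
        rw [Real.exp_neg, Real.exp_neg]; field_simp
    _ ≤ 1 / (4 * s1 * s2) * (Real.exp (2 * ε * |z.re|) * Real.exp (-((b + b⁻¹) - 2 * |z.im|) * |x|)) := by
        refine mul_le_mul_of_nonneg_left ?_ (by positivity)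
        rw [← Real.exp_add, ← Real.exp_add, ← Real.exp_add]
        apply Real.exp_le_exp.2
        have t1 : x * z.im ≤ |x| * |z.im| := by rw [← abs_mul]; exact le_abs_self _
        have t2 : y * z.re ≤ |y| * |z.re| := by rw [← abs_mul]; exact le_abs_self _
        have t3 : |y| * |z.re| ≤ ε * |z.re| := by gcongr
        have e : |x| / b = b⁻¹ * |x| := by ring
        rw [e]
        nlinarith
    _ = _ := by ring

theorem kf_neg (b : ℝ) (z T : ℂ) : kf b z (-T) = - kf b (-z) T := by
  have e1 : (b:ℂ) * -T = -(b * T) := by ring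
  have e2 : -T / (b:ℂ) = -(T / b) := by ring
  rw [kf, kf, e1, e2, Complex.sinh_neg, Complex.sinh_neg, ← div_neg]
  congr 1
  · congr 1; ring
  · ring

theorem kf_diff {b ε : ℝ} (h : PP b ε) (z T : ℂ) (hT : T ≠ 0) (hi : |T.im| ≤ ε) : DifferentiableAt ℂ (kf b z) T := by
  have n := mul_ne_zero (mul_ne_zero (mul_ne_zero (by norm_num : (4:ℂ) ≠ 0) hT) (sinh1_ne h T hT hi)) (sinh2_ne h T hT hi)
  unfold kf
  fun_prop (disch := assumption)

theorem kf_lim {b : ℝ} (hb : 0 < b) (z : ℂ) :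
    Tendsto (fun T => T * (kf b z T + kf b (-z) T - (1/2) / T^3 - (-z^2 - ((b:ℂ)^2 + (b:ℂ)⁻¹^2)/12) / T)) (𝓝[≠] 0) (𝓝 0) := by
  have hb' : (b:ℂ) ≠ 0 := by exact_mod_cast hb.ne'
  have g1 := lim_scale (g := fun z => z / sinh z - 1) lim_inv2 b hb'
  have g2 := lim_scale (g := fun z => z / sinh z - 1) lim_inv2 (b:ℂ)⁻¹ (inv_ne_zero hb')
  have g0 : Tendsto (fun T : ℂ => (cosh (2 * I * z * T) - 1) / T^2) (𝓝[≠] 0) (𝓝 (-2 * z^2)) := by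
    by_cases hz : z = 0
    · simp [hz]
    · have := lim_scale (g := fun z => cosh z - 1) lim_cosh (2 * I * z) (by simp [hz])
      convert this using 2
      rw [mul_pow, mul_pow, I_sq]; ring
  set c : ℂ := -z^2 - ((b:ℂ)^2 + (b:ℂ)⁻¹^2)/12 with hc
  have hT : Tendsto (fun T : ℂ => T^2) (𝓝[≠] 0) (𝓝 0) := by
    have : Continuous fun z : ℂ => z^2 := by fun_prop
    simpa using (this.tendsto 0).mono_left nhdsWithin_le_nhds
  have key := (((g0.add g1).add g2).add ((hT.mul (((g0.mul g1).add (g0.mul g2)).add (g1.mul g2))).add ((hT.mul hT).mul ((g0.mul g1).mul g2)))).div_const 2 |>.sub_const c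
  have e : ∀ X Y : ℂ, (-2 * z^2 + (b:ℂ)^2 * (-1/6) + (b:ℂ)⁻¹^2 * (-1/6) + (0 * X + 0 * 0 * Y)) / 2 - c = 0 := by
    intro X Y; rw [hc]; ring
  rw [e] at key
  refine key.congr' ?_
  filter_upwards [self_mem_nhdsWithin, ev_small (min b b⁻¹) (by positivity)] with T hT ⟨hs, _⟩
  have hT : T ≠ 0 := hT
  have hi := (Complex.abs_im_le_norm T).trans hs
  have hP : PP b (min b b⁻¹) := by
    refine ⟨hb, by positivity, ?_, ?_⟩
    · calc b * min b b⁻¹ ≤ b * b⁻¹ := by gcongr; exact min_le_right _ _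
        _ = 1 := mul_inv_cancel₀ hb.ne'
        _ < _ := by linarith [Real.pi_gt_three]
    · calc min b b⁻¹ / b ≤ b / b := by gcongr; exact min_le_left _ _
        _ = 1 := div_self hb.ne'
        _ < _ := by linarith [Real.pi_gt_three]
  have n1 := sinh1_ne hP T hT hi
  have n2 := sinh2_ne hP T hT hi
  have e3 : kf b z T + kf b (-z) T = cosh (2 * I * z * T) / (2 * T * sinh (b * T) * sinh (T / b)) := by
    rw [kf, kf, Complex.cosh]
    have a1 : -(2 * I * T * z) = -(2 * I * z * T) := by ring
    have a2 : -(2 * I * T * -z) = 2 * I * z * T := by ring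
    rw [a1, a2]
    field_simp
    ring
  rw [e3]
  have e4 : (b:ℂ)⁻¹ * T = T / b := by ring
  rw [e4]
  field_simp
  ring

theorem Iw_refl {b ε : ℝ} (h : PP b ε) (z : ℂ) (hz : |z.im| < (b + b⁻¹) / 2) :
    Iw b ε z + Iw b ε (-z) = I * Real.pi * z^2 + I * Real.pi / 12 * ((b:ℂ)^2 + (b:ℂ)⁻¹^2) := by
  have hz' : |(-z).im| < (b + b⁻¹) / 2 := by rwa [neg_im, abs_neg]
  have i1 := kf_int h z hz
  have i2 := kf_int h (-z) hz'
  set f : ℂ → ℂ := fun T => kf b z T + kf b (-z) T with hf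
  have hodd : ∀ T, f (-T) = - f T := by
    intro T; simp only [hf, kf_neg, neg_neg]; ring
  have hm : ∀ x : ℝ, f (x + (-ε : ℝ) * I) = - f (((-x : ℝ):ℂ) + ε * I) := by
    intro x; rw [← hodd]; congr 1; push_cast; ring
  have i3 : Integrable fun x : ℝ => f (x + ε * I) := i1.add i2
  have key := residue_strip f ε h.he (1/2) (-z^2 - ((b:ℂ)^2 + (b:ℂ)⁻¹^2)/12)
  obtain ⟨C1, hC1, b1⟩ := kf_bound2 h z
  obtain ⟨C2, hC2, b2⟩ := kf_bound2 h (-z)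
  obtain ⟨K, hK, hk⟩ := exp_le_inv ((b + b⁻¹) - 2 * |z.im|) (by linarith)
  have key := key ((C1 + C2) * K) (fun T hT hi => (kf_diff h z T hT hi).add (kf_diff h (-z) T hT hi)) (kf_lim h.hb z) ?_ i3 ?_
  · simp_rw [hm] at key
    rw [integral_neg, integral_neg_eq_self (fun x : ℝ => f (x + ε * I)) volume] at key
    have : Iw b ε z + Iw b ε (-z) = ∫ x : ℝ, f (x + ε * I) := by
      rw [Iw, Iw, ← integral_add i1 i2]
    rw [this]
    linear_combination key / 2
  · intro x y hy hx
    have := b1 x y hy hx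
    have h2 := b2 x y hy hx
    rw [neg_im, abs_neg] at h2
    have h3 := hk x
    calc _ ≤ _ := norm_add_le _ _
      _ ≤ (C1 + C2) * Real.exp (-((b + b⁻¹) - 2 * |z.im|) * |x|) := by linarith
      _ ≤ (C1 + C2) * (K * (1 + x^2)⁻¹) := by gcongr
      _ = _ := by ring
  · simp_rw [hm]
    exact (i3.comp_neg).neg

theorem lw_refl {b ε : ℝ} (h : PP b ε) (z : ℂ) (hz : |z.im| < (b + b⁻¹) / 2) :
    lw b ε z + lw b ε (-z) = 0 := by
  have := Iw_refl h z hz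
  rw [lw, lw]
  linear_combination -this


noncomputable def ef (b : ℝ) (z T : ℂ) : ℂ := cexp (-(2 * I * T * z)) / (2 * T * sinh (T / b))
noncomputable def gf (b : ℝ) (z T : ℂ) : ℂ := cexp (-(2 * I * T * z)) / (sinh (T / b))

theorem gf_bound {b : ℝ} (hb : 0 < b) (z : ℂ) (t y s : ℝ) (hs : 0 < s) (hy : s ≤ |Real.sin (y / b)|) :
    ‖gf b z (t + y * I)‖ ≤ 2 / s * Real.exp (2 * y * z.re) * Real.exp (-(b⁻¹ - 2 * |z.im|) * |t|) := by
  have l2 := sinh_lb1 (t / b) (y / b)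
  rw [← arg2, abs_div t, abs_of_pos hb] at l2
  rw [gf, norm_div, norm_exp_arg]
  calc _ ≤ Real.exp (2 * (t * z.im + y * z.re)) / (s * Real.exp (|t| / b) / 2) := by
        gcongr
        refine le_trans ?_ l2
        gcongr
    _ = 2 / s * (Real.exp (2 * (t * z.im + y * z.re)) * Real.exp (-(|t| / b))) := by
        rw [Real.exp_neg]; field_simp
    _ ≤ 2 / s * (Real.exp (2 * y * z.re) * Real.exp (-(b⁻¹ - 2 * |z.im|) * |t|)) := by
        refine mul_le_mul_of_nonneg_left ?_ (by positivity)
        rw [← Real.exp_add, ← Real.exp_add]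
        apply Real.exp_le_exp.2
        have : t * z.im ≤ |t| * |z.im| := by rw [← abs_mul]; exact le_abs_self _
        have e : |t| / b = b⁻¹ * |t| := by ring
        rw [e]
        nlinarith
    _ = _ := by ring

theorem ef_gf (b : ℝ) (z T : ℂ) : ef b z T = gf b z T / (2 * T) := by
  rw [ef, gf, div_div]; congr 1; ring

theorem ef_bound {b ε : ℝ} (h : PP b ε) (z : ℂ) (t : ℝ) :
    ‖ef b z (t + ε * I)‖ ≤ 1 / (ε * Real.sin (ε / b)) * Real.exp (2 * ε * z.re) * Real.exp (-(b⁻¹ - 2 * |z.im|) * |t|) := by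
  have s2 := h.sin2
  have he := h.he
  have := gf_bound h.hb z t ε _ s2 (le_abs_self _)
  have l3 := norm_ln_ge t ε
  rw [abs_of_pos he] at l3
  rw [ef_gf, norm_div, norm_mul, Complex.norm_ofNat]
  calc _ ≤ (2 / Real.sin (ε / b) * Real.exp (2 * ε * z.re) * Real.exp (-(b⁻¹ - 2 * |z.im|) * |t|)) / (2 * ε) := by gcongr
    _ = _ := by field_simp

theorem gf_cont {b : ℝ} (_hb : 0 < b) (z : ℂ) (y : ℝ) (hy : 0 < |Real.sin (y / b)|) :
    Continuous fun t : ℝ => gf b z (t + y * I) := by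
  unfold gf
  refine Continuous.div₀ (by fun_prop) (by fun_prop) fun t => ?_
  rw [← norm_pos_iff, arg2]
  refine lt_of_lt_of_le ?_ (sinh_lb1 _ _)
  positivity

theorem ef_cont {b ε : ℝ} (h : PP b ε) (z : ℂ) : Continuous fun t : ℝ => ef b z (t + ε * I) := by
  simp_rw [ef_gf]
  refine (gf_cont h.hb z ε (abs_pos.2 h.sin2.ne')).div₀ (by fun_prop) fun t => ?_
  exact mul_ne_zero two_ne_zero (ne_ln t ε h.he.ne')

theorem gf_shift (b : ℝ) (hb : 0 < b) (z T : ℂ) :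
    gf b z (T - Real.pi * b * I) = - cexp (-(2 * Real.pi * b * z)) * gf b z T := by
  have hb' : (b:ℂ) ≠ 0 := by exact_mod_cast hb.ne'
  have e1 : (T - Real.pi * b * I) / b = T / b - Real.pi * I := by field_simp
  have e2 : sinh (T / b - Real.pi * I) = - sinh (T / b) := by
    rw [Complex.sinh_sub, Complex.cosh_mul_I, Complex.sinh_mul_I]; simp
  have e3 : -(2 * I * (T - Real.pi * b * I) * z) = -(2 * Real.pi * b * z) + -(2 * I * T * z) := by
    linear_combination (2 * Real.pi * b * z) * I_sq
  rw [gf, gf, e1, e2, e3, Complex.exp_add, div_neg]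
  ring

theorem G_eval {b ε : ℝ} (h : PP b ε) (z : ℂ) (hz : |z.im| < b⁻¹ / 2) :
    (∫ t : ℝ, gf b z (t + ε * I)) * (1 + cexp (-(2 * Real.pi * b * z))) = -2 * Real.pi * I * b := by
  have hb := h.hb
  have hb' : (b:ℂ) ≠ 0 := by exact_mod_cast hb.ne'
  have he := h.he
  have s2 := h.sin2
  have hc : 0 < b⁻¹ - 2 * |z.im| := by linarith
  have i1 : Integrable fun t : ℝ => gf b z (t + ε * I) :=
    integrable_of_exp_bound _ (gf_cont hb z ε (abs_pos.2 h.sin2.ne')) _ _ hc (fun t => gf_bound hb z t ε _ s2 (le_abs_self _))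
  -- shift
  have hsin : ∀ y ∈ uIcc (-ε) (ε - Real.pi * b), Real.sin (ε / b) ≤ |Real.sin (y / b)| := by
    intro y hy
    have h1 : -(y / b) ∈ uIcc (ε / b) (Real.pi - ε / b) := by
      rw [mem_uIcc] at hy ⊢
      have e : Real.pi - ε / b = (Real.pi * b - ε) / b := by field_simp
      rw [e, ← neg_div]
      rcases hy with hy | hy
      · right; constructor <;> apply div_le_div_of_nonneg_right _ hb.le <;> linarith
      · left; constructor <;> apply div_le_div_of_nonneg_right _ hb.le <;> linarith
    have h2 := strictConcaveOn_sin_Icc.concaveOn.min_le_of_mem_segment (x := ε / b) (y := Real.pi - ε / b) (z := -(y/b))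
      ⟨(div_pos he hb).le, h.h2.le⟩ ⟨by linarith [h.h2], by linarith [div_pos he hb]⟩ (by rw [segment_eq_uIcc]; exact h1)
    rw [Real.sin_pi_sub, min_self, Real.sin_neg] at h2
    exact h2.trans (neg_le_abs _)
  obtain ⟨M, hM⟩ : ∃ M, ∀ y ∈ uIcc (-ε) (ε - Real.pi * b), Real.exp (2 * y * z.re) ≤ M := by
    obtain ⟨y0, _, hy0⟩ := IsCompact.exists_isMaxOn (s := uIcc (-ε) (ε - Real.pi * b)) isCompact_uIcc nonempty_uIcc (f := fun y => Real.exp (2 * y * z.re)) (by fun_prop)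
    exact ⟨_, fun y hy => hy0 hy⟩
  obtain ⟨i2, i3, e23⟩ := shift_exp (gf b z) (-ε) (ε - Real.pi * b) (2 / Real.sin (ε / b) * M) _ hc
    (by
      intro T hT
      have : sinh (T / b) ≠ 0 := by
        have := sinh_lb1 (T.re / b) (T.im / b)
        rw [← arg2, re_add_im] at this
        have h3 := hsin _ hT
        rw [← norm_pos_iff]
        refine lt_of_lt_of_le ?_ this
        have : 0 < |Real.sin (T.im / b)| := by linarith
        positivity
      unfold gf
      fun_prop (disch := assumption))
    (by
      intro x y hy
      refine (gf_bound hb z x y _ s2 (hsin y hy)).trans ?_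
      gcongr
      exact hM y hy)
  have e4 : ∫ x : ℝ, gf b z (x + ((ε - Real.pi * b : ℝ)) * I) = - cexp (-(2 * Real.pi * b * z)) * ∫ t : ℝ, gf b z (t + ε * I) := by
    rw [← integral_const_mul]
    congr 1
    ext x
    rw [← gf_shift b hb]
    congr 1
    push_cast; ring
  set s2' := (1 - Real.exp (-2 * b⁻¹)) / 2 with hs2
  have p2 : 0 < s2' := by
    have : Real.exp (-2 * b⁻¹) < 1 := Real.exp_lt_one_iff.2 (by have := inv_pos.2 hb; linarith)
    rw [hs2]; linarith
  obtain ⟨K, hK, hk⟩ := exp_le_inv _ hc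
  have key := residue_strip (gf b z) ε he 0 b (1 / s2' * Real.exp (2 * ε * |z.re|) * K) ?_ ?_ ?_ i1 i2
  · rw [e23, e4] at key
    linear_combination key
  · intro T hT hi
    have := sinh2_ne h T hT hi
    unfold gf
    fun_prop (disch := assumption)
  · have l1 : Tendsto (fun T : ℂ => T / sinh (T / b)) (𝓝[≠] 0) (𝓝 b) := by
      have h1 : Tendsto (fun z : ℂ => z / (b:ℂ)) (𝓝[≠] 0) (𝓝[≠] 0) := by
        refine tendsto_nhdsWithin_iff.2 ⟨?_, ?_⟩
        · have : Continuous fun z : ℂ => z / (b:ℂ) := by fun_prop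
          simpa using (this.tendsto 0).mono_left nhdsWithin_le_nhds
        · filter_upwards [self_mem_nhdsWithin] with z hz
          exact div_ne_zero hz hb'
      have := (lim_inv.comp h1).const_mul (b:ℂ)
      rw [mul_one] at this
      refine this.congr fun T => ?_
      simp only [Function.comp]
      rw [← mul_div_assoc, mul_div_cancel₀ _ hb']
    have l2 : Tendsto (fun T : ℂ => cexp (-(2 * I * T * z))) (𝓝[≠] 0) (𝓝 1) := by
      have : Continuous fun T : ℂ => cexp (-(2 * I * T * z)) := by fun_prop
      simpa using (this.tendsto 0).mono_left nhdsWithin_le_nhds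
    have := (l2.mul l1).sub_const (b:ℂ)
    rw [one_mul, sub_self] at this
    refine this.congr' ?_
    filter_upwards [self_mem_nhdsWithin] with T hT
    have hT : T ≠ 0 := hT
    rw [gf]
    field_simp
    ring
  · intro x y hy hx
    have l2 := sinh_lb2 (x / b) (y / b) b⁻¹ (by rw [abs_div, abs_of_pos hb, inv_eq_one_div]; gcongr)
    rw [← arg2, abs_div, abs_of_pos hb, ← hs2] at l2
    rw [gf, norm_div, norm_exp_arg]
    calc _ ≤ Real.exp (2 * (x * z.im + y * z.re)) / (s2' * Real.exp (|x| / b)) := by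
          gcongr
      _ = 1 / s2' * (Real.exp (2 * (x * z.im + y * z.re)) * Real.exp (-(|x| / b))) := by
          rw [Real.exp_neg]; field_simp
      _ ≤ 1 / s2' * (Real.exp (2 * ε * |z.re|) * Real.exp (-(b⁻¹ - 2 * |z.im|) * |x|)) := by
          refine mul_le_mul_of_nonneg_left ?_ (by positivity)
          rw [← Real.exp_add, ← Real.exp_add]
          apply Real.exp_le_exp.2
          have t1 : x * z.im ≤ |x| * |z.im| := by rw [← abs_mul]; exact le_abs_self _
          have t2 : y * z.re ≤ |y| * |z.re| := by rw [← abs_mul]; exact le_abs_self _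
          have t3 : |y| * |z.re| ≤ ε * |z.re| := by gcongr
          have e : |x| / b = b⁻¹ * |x| := by ring
          rw [e]
          nlinarith
      _ ≤ 1 / s2' * (Real.exp (2 * ε * |z.re|) * (K * (1 + x^2)⁻¹)) := by
          gcongr
          exact hk x
      _ = _ := by ring

noncomputable def Ew (b ε : ℝ) (z : ℂ) : ℂ := ∫ t : ℝ, ef b z (t + ε * I)

theorem Ew_deriv {b ε : ℝ} (h : PP b ε) (z : ℂ) (hz : |z.im| < b⁻¹ / 2) :
    HasDerivAt (Ew b ε) (-I * ∫ t : ℝ, gf b z (t + ε * I)) z := by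
  have := holo_integral_deriv (strip_open (b⁻¹/2)) (fun z t => ef b z (t + ε * I)) (fun z _ => (ef_cont h z).aestronglyMeasurable)
    (fun t => by unfold ef; fun_prop) (fun z₀ hz₀ => ?_) z hz
  · refine HasDerivAt.congr_deriv (f := Ew b ε) this ?_
    rw [← integral_const_mul]
    congr 1
    ext t
    have hn := ne_ln t ε h.he.ne'
    set T := (t:ℂ) + ε * I
    have h1 : HasDerivAt (fun z : ℂ => -(2 * I * T * z)) (-(2 * I * T * 1)) z := ((hasDerivAt_id z).const_mul _).neg
    have h2 := (h1.cexp.div_const (2 * T * sinh (T / b))).deriv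
    have e : (fun z => ef b z T) = fun z => cexp (-(2 * I * T * z)) / (2 * T * sinh (T / b)) := rfl
    rw [e, h2, gf]
    have hn2 : sinh (T / b) ≠ 0 := sinh2_ne h T hn (by simp [T, abs_of_pos h.he])
    field_simp
  · simp only [mem_ofPred_eq] at hz₀
    have s2 := h.sin2
    have he := h.he
    set d := (b⁻¹ / 2 - |z₀.im|) / 2 with hd
    have hd0 : 0 < d := by rw [hd]; linarith
    refine ⟨d, hd0, fun t => (1 / (ε * Real.sin (ε / b)) * Real.exp (2 * ε * (z₀.re + d))) * Real.exp (-(2 * d) * |t|), (integrable_exp_abs _ (by positivity)).const_mul _, fun z hz t => (ef_bound h z t).trans ?_⟩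
    rw [Metric.mem_ball, dist_eq] at hz
    have r1 := (Complex.abs_re_le_norm (z - z₀)).trans hz.le
    have r2 := (Complex.abs_im_le_norm (z - z₀)).trans hz.le
    rw [sub_re] at r1
    rw [sub_im] at r2
    have r3 := (abs_le.1 r1).2
    have r4 : |z.im| ≤ |z₀.im| + d := by
      have := abs_sub_abs_le_abs_sub z.im z₀.im
      linarith
    refine mul_le_mul (mul_le_mul_of_nonneg_left (Real.exp_le_exp.2 ?_) (by positivity)) (Real.exp_le_exp.2 ?_) (Real.exp_pos _).le (by positivity)
    · nlinarith
    · refine mul_le_mul_of_nonneg_right ?_ (abs_nonneg t)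
      linarith

theorem Ew_bound {b ε : ℝ} (h : PP b ε) (δ : ℝ) (hδ : 0 < δ) : ∃ K, 0 ≤ K ∧ ∀ z : ℂ, |z.im| ≤ b⁻¹ / 2 - δ →
    ‖Ew b ε z‖ ≤ K * Real.exp (2 * ε * z.re) := by
  have s2 := h.sin2
  have he := h.he
  set M := 1 / (ε * Real.sin (ε / b)) with hM
  have hM0 : 0 < M := by positivity
  have hi := integrable_exp_abs (2 * δ) (by positivity)
  refine ⟨M * ∫ t : ℝ, Real.exp (-(2 * δ) * |t|), mul_nonneg hM0.le (integral_nonneg fun t => (Real.exp_pos _).le), fun z hz => ?_⟩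
  calc _ ≤ ∫ t : ℝ, M * Real.exp (2 * ε * z.re) * Real.exp (-(2 * δ) * |t|) := by
        refine norm_integral_le_of_norm_le (hi.const_mul _) (Eventually.of_forall fun t => (ef_bound h z t).trans ?_)
        rw [← hM]
        gcongr
        linarith
    _ = _ := by rw [integral_const_mul]; ring

theorem Ew_eval {b ε : ℝ} (h : PP b ε) (z : ℂ) (hz : |z.im| < b⁻¹ / 2) :
    cexp (Ew b ε z) * (1 + cexp (2 * Real.pi * b * z)) = 1 := by
  have hb := h.hb
  set f : ℂ → ℂ := fun z => cexp (Ew b ε z) * (1 + cexp (2 * Real.pi * b * z)) with hf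
  set U := {z : ℂ | |z.im| < b⁻¹ / 2} with hU
  have hder : ∀ z ∈ U, HasDerivAt f 0 z := by
    intro z hz
    have h1 := (Ew_deriv h z hz).cexp
    have h2 : HasDerivAt (fun z : ℂ => 2 * Real.pi * b * z) (2 * Real.pi * b * 1) z := (hasDerivAt_id z).const_mul _
    have h3 := h1.mul (h2.cexp.const_add 1)
    refine h3.congr_deriv ?_
    have g := G_eval h z hz
    rw [Complex.exp_neg] at g
    have n := Complex.exp_ne_zero (2 * Real.pi * b * z)
    set e := cexp (2 * Real.pi * b * z)
    set G := ∫ t : ℝ, gf b z (t + ε * I)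
    have g' : G * (e + 1) = -2 * Real.pi * I * b * e := by
      rw [← g]; field_simp
    linear_combination (cexp (Ew b ε z)) * (-I * g' + 2 * Real.pi * b * e * I_sq)
  have hconv : Convex ℝ U := by
    have : U = Complex.im ⁻¹' (Ioo (-(b⁻¹/2)) (b⁻¹/2)) := by
      ext z; simp [hU, abs_lt]
    rw [this]
    exact (convex_Ioo _ _).linear_preimage Complex.imLm
  have hconst : ∀ w ∈ U, f w = f z := by
    intro w hw
    exact (strip_open _).is_const_of_deriv_eq_zero hconv.isPreconnected
      (fun x hx => (hder x hx).differentiableAt.differentiableWithinAt) (fun x hx => (hder x hx).deriv) hw hz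
  obtain ⟨K, hK, hk⟩ := Ew_bound h (b⁻¹/2 - |z.im|) (by linarith)
  have hlin : ∀ c : ℝ, 0 < c → Tendsto (fun r : ℝ => Real.exp (c * (z.re - r))) atTop (𝓝 0) := by
    intro c hc
    refine Real.tendsto_exp_atBot.comp ?_
    refine Tendsto.const_mul_atBot hc ?_
    exact tendsto_atBot_add_const_left _ _ tendsto_neg_atTop_atBot
  have t1 : Tendsto (fun r : ℝ => Ew b ε (z - r)) atTop (𝓝 0) := by
    have := (hlin (2 * ε) (by have := h.he; positivity)).const_mul K
    rw [mul_zero] at this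
    refine squeeze_zero_norm (fun r => ?_) this
    have := hk (z - r) (by simp)
    simpa using this
  have t2 : Tendsto (fun r : ℝ => cexp (2 * Real.pi * b * (z - r))) atTop (𝓝 0) := by
    rw [tendsto_zero_iff_norm_tendsto_zero]
    refine (hlin (2 * Real.pi * b) (by positivity)).congr fun r => ?_
    rw [Complex.norm_exp]
    congr 1
    have : (2 * Real.pi * b * (z - r) : ℂ) = ((2 * Real.pi * b : ℝ):ℂ) * (z - r) := by push_cast; ring
    rw [this, re_ofReal_mul]; simp
  have t3 : Tendsto (fun r : ℝ => f (z - r)) atTop (𝓝 1) := by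
    have := ((Complex.continuous_exp.tendsto 0).comp t1).mul (t2.const_add 1)
    simpa using this
  have t4 : Tendsto (fun r : ℝ => f (z - r)) atTop (𝓝 (f z)) := by
    refine tendsto_const_nhds.congr fun r => (hconst _ ?_).symm
    simpa [hU] using hz
  exact tendsto_nhds_unique t4 t3


/-- The properties of the dilogarithm that are used below. -/
structure WP (b : ℝ) (W : ℂ → ℂ) : Prop where
  hb : 0 < b
  diff : ∀ z : ℂ, |z.im| < (b + b⁻¹) / 2 → DifferentiableAt ℂ W z
  inv : ∀ z : ℂ, |z.im| < (b + b⁻¹) / 2 → W z * W (-z) = 1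
  feq : ∀ z : ℂ, |z.im| < b⁻¹ / 2 → W (z + b / 2 * I) = 2 * cosh (Real.pi * b * z) * W (z - b / 2 * I)
  bound : ∀ δ : ℝ, 0 < δ → ∃ C : ℝ, 0 < C ∧ ∀ z : ℂ, |z.im| ≤ (b + b⁻¹) / 2 - δ →
    ‖W z‖ ≤ C * Real.exp (Real.pi * |z.re| * z.im)
  crit : W ((b - b⁻¹ : ℝ) / 2 * I) = b

theorem wb_eq (b ε : ℝ) (z : ℂ) : wb b ε z = cexp (lw b ε z) := by
  rw [wb, lw, Iw]
  simp only [kf, mul_comm I (ε:ℂ)]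

theorem PP.symm {b ε : ℝ} (h : PP b ε) : PP b⁻¹ ε := by
  refine ⟨inv_pos.2 h.hb, h.he, ?_, ?_⟩
  · have := h.h2; rwa [div_eq_inv_mul] at this
  · have := h.h1; rwa [div_inv_eq_mul, mul_comm]

theorem wb_symm (b ε : ℝ) (z : ℂ) : wb b⁻¹ ε z = wb b ε z := by
  rw [wb_eq, wb_eq, lw, lw, Iw, Iw]
  congr 2
  · push_cast; rw [inv_inv, add_comm ((b:ℂ)^2)]
  · congr 1
    ext t
    rw [kf, kf]
    congr 1
    push_cast
    rw [div_inv_eq_mul, mul_comm _ (b:ℂ), ← div_eq_inv_mul]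
    ring

theorem Dfun_symm (b ε : ℝ) (α z : ℂ) : Dfun b⁻¹ ε α z = Dfun b ε α z := by
  rw [Dfun, Dfun]
  congr 3
  ext t
  congr 1
  push_cast
  rw [div_inv_eq_mul, mul_comm _ (b:ℂ), ← div_eq_inv_mul]
  ring

theorem wb_inv {b ε : ℝ} (h : PP b ε) (z : ℂ) (hz : |z.im| < (b + b⁻¹) / 2) :
    wb b ε z * wb b ε (-z) = 1 := by
  rw [wb_eq, wb_eq, ← Complex.exp_add, lw_refl h z hz, Complex.exp_zero]

theorem wb_feq {b ε : ℝ} (h : PP b ε) (z : ℂ) (hz : |z.im| < b⁻¹ / 2) :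
    wb b ε (z + b / 2 * I) = 2 * cosh (Real.pi * b * z) * wb b ε (z - b / 2 * I) := by
  have hb := h.hb
  have him : (b / 2 * I : ℂ).im = b / 2 := by
    have : (b / 2 * I : ℂ) = ((b/2 : ℝ):ℂ) * I := by push_cast; ring
    rw [this]; simp
  have i1 : |(z + b / 2 * I).im| < (b + b⁻¹) / 2 := by
    rw [add_im, him]
    rw [abs_lt] at hz ⊢
    constructor <;> linarith
  have i2 : |(z - b / 2 * I).im| < (b + b⁻¹) / 2 := by
    rw [sub_im, him]
    rw [abs_lt] at hz ⊢
    constructor <;> linarith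
  have e1 : Iw b ε (z + b / 2 * I) - Iw b ε (z - b / 2 * I) = Ew b ε z := by
    rw [Iw, Iw, Ew, ← integral_sub (kf_int h _ i1) (kf_int h _ i2)]
    congr 1
    ext t
    have hn := ne_ln t ε h.he.ne'
    have him : |((t:ℂ) + ε * I).im| ≤ ε := by simp [abs_of_pos h.he]
    set T := (t:ℂ) + ε * I
    have n1 := sinh1_ne h T hn him
    have n2 := sinh2_ne h T hn him
    rw [kf, kf, ef]
    have a1 : -(2 * I * T * (z + b / 2 * I)) = -(2 * I * T * z) + b * T := by
      linear_combination (-T * b) * I_sq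
    have a2 : -(2 * I * T * (z - b / 2 * I)) = -(2 * I * T * z) + -(b * T) := by
      linear_combination (T * b) * I_sq
    have a3 : sinh (b * T) = (cexp (b * T) - cexp (-(b * T))) / 2 := rfl
    have a4 : cexp (-(2 * I * T * z)) / (2 * T * sinh (T / b)) = cexp (-(2 * I * T * z)) * (2 * sinh (b * T)) / (4 * T * sinh (b * T) * sinh (T / b)) := by
      rw [div_eq_div_iff (mul_ne_zero (mul_ne_zero two_ne_zero hn) n2) (mul_ne_zero (mul_ne_zero (mul_ne_zero (by norm_num) hn) n1) n2)]
      ring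
    rw [a1, a2, a4, Complex.exp_add, Complex.exp_add, ← sub_div]
    congr 1
    rw [a3]
    ring
  have e2 : lw b ε (z - b / 2 * I) = lw b ε (z + b / 2 * I) + Real.pi * b * z + Ew b ε z := by
    rw [lw, lw, ← e1]
    linear_combination (-Real.pi * b * z) * I_sq
  have e3 := Ew_eval h z hz
  rw [wb_eq, wb_eq, e2, Complex.exp_add, Complex.exp_add, Complex.cosh]
  have e4 : cexp (2 * Real.pi * b * z) = cexp (Real.pi * b * z) * cexp (Real.pi * b * z) := by
    rw [← Complex.exp_add]; congr 1; ring
  rw [e4] at e3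
  have e5 : cexp (Real.pi * b * z) * cexp (-(Real.pi * b * z)) = 1 := by
    rw [← Complex.exp_add, add_neg_cancel, Complex.exp_zero]
  linear_combination (-cexp (lw b ε (z + b / 2 * I))) * e3 - cexp (lw b ε (z + b / 2 * I)) * cexp (Ew b ε z) * e5

theorem wb_bound {b ε : ℝ} (h : PP b ε) (δ : ℝ) (hδ : 0 < δ) : ∃ C : ℝ, 0 < C ∧ ∀ z : ℂ, |z.im| ≤ (b + b⁻¹) / 2 - δ →
    ‖wb b ε z‖ ≤ C * Real.exp (Real.pi * |z.re| * z.im) := by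
  obtain ⟨K, hK, hk⟩ := Iw_bound h δ hδ
  have key : ∀ z : ℂ, |z.im| ≤ (b + b⁻¹) / 2 - δ → z.re ≤ 0 →
      |(lw b ε z).re - Real.pi * |z.re| * z.im| ≤ K := by
    intro z hz hre
    have h1 : (lw b ε z).re - Real.pi * |z.re| * z.im = -(Iw b ε z).re := by
      rw [lw, abs_of_nonpos hre, sub_re, add_re]
      have e1 : (I * Real.pi / 2 * z^2).re = -Real.pi * z.re * z.im := by
        have : (I * Real.pi / 2 * z^2) = I * ((Real.pi / 2 : ℝ) * z^2) := by push_cast; ring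
        rw [this, I_mul_re, im_ofReal_mul, sq, mul_im]; ring
      have e2 : (I * Real.pi / 24 * ((b:ℂ)^2 + (b:ℂ)⁻¹^2)).re = 0 := by
        have : (I * Real.pi / 24 * ((b:ℂ)^2 + (b:ℂ)⁻¹^2)) = I * ((Real.pi / 24 * (b^2 + b⁻¹^2) : ℝ):ℂ) := by push_cast; ring
        rw [this, I_mul_re, ofReal_im, neg_zero]
      rw [e1, e2]; ring
    rw [h1, abs_neg]
    refine (Complex.abs_re_le_norm _).trans ((hk z hz).trans ?_)
    have : Real.exp (2 * ε * z.re) ≤ 1 := Real.exp_le_one_iff.2 (mul_nonpos_of_nonneg_of_nonpos (by linarith [h.he]) hre)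
    nlinarith
  refine ⟨Real.exp K, Real.exp_pos _, fun z hz => ?_⟩
  rw [← Real.exp_add]
  rcases le_total z.re 0 with hre | hre
  · rw [wb_eq, Complex.norm_exp]
    apply Real.exp_le_exp.2
    linarith [(abs_le.1 (key z hz hre)).2]
  · have := lw_refl h z (by linarith)
    have e : lw b ε z = - lw b ε (-z) := by linear_combination this
    rw [wb_eq, e, Complex.norm_exp]
    apply Real.exp_le_exp.2
    have := (abs_le.1 (key (-z) (by rwa [neg_im, abs_neg]) (by simpa using hre))).1
    rw [neg_re (lw b ε (-z))]
    rw [neg_re z, neg_im z, abs_neg] at this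
    linarith

theorem lw_conj {b ε : ℝ} (h : PP b ε) (y : ℝ) (hy : |y| < (b + b⁻¹) / 2) :
    (starRingEnd ℂ) (lw b ε (y * I)) = lw b ε (y * I) := by
  have e1 : Iw b ε (y * I) = - (starRingEnd ℂ) (Iw b ε (-(y * I))) := by
    rw [Iw, ← integral_neg_eq_self _ volume, Iw, ← integral_conj, ← integral_neg]
    congr 1
    ext t
    have a : ((-t : ℝ):ℂ) + ε * I = -(starRingEnd ℂ) ((t:ℂ) + ε * I) := by
      simp only [map_add, map_mul, conj_ofReal, conj_I]; push_cast; ring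
    rw [a]
    set T := (t:ℂ) + ε * I
    rw [kf_neg, kf, kf, map_div₀]
    simp only [map_mul, ← Complex.exp_conj, ← Complex.sinh_conj, map_div₀, conj_ofReal, map_neg, conj_I, map_ofNat]
    congr 3
    ring_nf
  have e2 := lw_refl h (y * I) (by simpa using hy)
  have e3 : (starRingEnd ℂ) (lw b ε (y * I)) = - lw b ε (-(y * I)) := by
    rw [lw, lw, e1]
    simp only [map_sub, map_add, map_mul, map_div₀, map_neg, map_pow, conj_I, conj_ofReal, map_ofNat, Complex.conj_conj, map_inv₀]
    ring
  rw [e3]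
  linear_combination -e2

theorem cosh_quarter (z : ℂ) : cosh (z + Real.pi / 2 * I) = I * sinh z := by
  rw [Complex.cosh_add, Complex.cosh_mul_I, Complex.sinh_mul_I]
  simp
  ring

theorem wb_diff {b ε : ℝ} (h : PP b ε) (z : ℂ) (hz : |z.im| < (b + b⁻¹) / 2) : DifferentiableAt ℂ (wb b ε) z := by
  have : wb b ε = fun z => cexp (lw b ε z) := funext (wb_eq b ε)
  rw [this]
  have := (Iw_diff h).differentiableAt ((strip_open _).mem_nhds hz)
  unfold lw
  fun_prop

theorem sin_div_lim (c : ℝ) : Tendsto (fun t : ℝ => Real.sin (c * t) / t) (𝓝[>] 0) (𝓝 c) := by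
  have h1 : HasDerivAt (fun t : ℝ => Real.sin (c * t)) (Real.cos (c * 0) * (c * 1)) 0 :=
    ((hasDerivAt_id (0:ℝ)).const_mul c).sin
  rw [hasDerivAt_iff_tendsto_slope] at h1
  have := h1.mono_left (nhdsWithin_mono 0 (fun x hx => ne_of_gt hx : Ioi (0:ℝ) ⊆ {0}ᶜ))
  simp only [mul_zero, Real.cos_zero, one_mul, mul_one] at this
  refine this.congr fun t => ?_
  simp [slope]
  ring

theorem wb_feq2 {b ε : ℝ} (h : PP b ε) (τ : ℝ) (h1 : 0 < τ) (h2 : τ < b⁻¹) :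
    wb b ε ((b + b⁻¹) / 2 * I - τ * I) = 2 * Real.sin (Real.pi * b * τ) * wb b ε (-((b - b⁻¹ : ℝ) / 2 * I) - τ * I) := by
  have hb := h.hb
  have hb' : (b:ℂ) ≠ 0 := by exact_mod_cast hb.ne'
  have := wb_feq h (((b⁻¹ / 2 - τ : ℝ):ℂ) * I) (by simp; rw [abs_lt]; constructor <;> linarith)
  have e1 : (b + b⁻¹) / 2 * I - τ * I = ((b⁻¹ / 2 - τ : ℝ):ℂ) * I + b / 2 * I := by push_cast; ring
  have e2 : -((b - b⁻¹ : ℝ) / 2 * I) - τ * I = ((b⁻¹ / 2 - τ : ℝ):ℂ) * I - b / 2 * I := by push_cast; ring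
  have e3 : (Real.pi * b * (((b⁻¹ / 2 - τ : ℝ):ℂ) * I)) = -((Real.pi * b * τ : ℝ) * I) + Real.pi / 2 * I := by
    push_cast; field_simp; ring
  rw [e1, e2, this, e3, cosh_quarter, Complex.sinh_neg, Complex.sinh_mul_I, ofReal_sin]
  linear_combination (-2 * Complex.sin ((Real.pi * b * τ : ℝ):ℂ) * wb b ε (((b⁻¹ / 2 - τ : ℝ):ℂ) * I - b / 2 * I)) * I_sq

theorem wb_crit {b ε : ℝ} (h : PP b ε) : wb b ε ((b - b⁻¹ : ℝ) / 2 * I) = b := by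
  have hb := h.hb
  have hbi := inv_pos.2 hb
  have hb' : (b:ℂ) ≠ 0 := by exact_mod_cast hb.ne'
  set s : ℂ := (b - b⁻¹ : ℝ) / 2 * I with hs
  have hs' : s = (((b - b⁻¹) / 2 : ℝ):ℂ) * I := by rw [hs]; push_cast; ring
  have hy : |(b - b⁻¹) / 2| < (b + b⁻¹) / 2 := by rw [abs_lt]; constructor <;> linarith
  have him : |s.im| < (b + b⁻¹) / 2 := by rw [hs']; simpa using hy
  have him' : |(-s).im| < (b + b⁻¹) / 2 := by rwa [neg_im, abs_neg]
  have key : ∀ᶠ τ : ℝ in 𝓝[>] 0, ((Real.sin (Real.pi * b * τ) / τ : ℝ):ℂ) * wb b ε (-s - τ * I) =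
      ((Real.sin (Real.pi * b⁻¹ * τ) / τ : ℝ):ℂ) * wb b ε (s - τ * I) := by
    filter_upwards [Ioo_mem_nhdsGT (lt_min hb hbi)] with τ hτ
    have f1 := wb_feq2 h τ hτ.1 (hτ.2.trans_le (min_le_right _ _))
    have f2 := wb_feq2 h.symm τ hτ.1 (by rw [inv_inv]; exact hτ.2.trans_le (min_le_left _ _))
    rw [wb_symm, wb_symm] at f2
    have e1 : (((b⁻¹ : ℝ):ℂ) + ((b⁻¹⁻¹:ℝ):ℂ)) / 2 * I - τ * I = ((b:ℂ) + ((b⁻¹ : ℝ):ℂ)) / 2 * I - τ * I := by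
      push_cast; rw [inv_inv]; ring
    have e2 : -((b⁻¹ - b⁻¹⁻¹ : ℝ) / 2 * I) - τ * I = s - τ * I := by
      rw [hs, inv_inv]; push_cast; ring
    rw [e1, f1, e2, ← hs] at f2
    push_cast at f2 ⊢
    linear_combination (1 / (2 * (τ:ℂ))) * f2
  have lim : ∀ p : ℂ, |p.im| < (b + b⁻¹) / 2 → ∀ c : ℝ, Tendsto (fun τ : ℝ => ((Real.sin (c * τ) / τ : ℝ):ℂ) * wb b ε (p - τ * I)) (𝓝[>] 0) (𝓝 (c * wb b ε p)) := by
    intro p hp c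
    refine ((continuous_ofReal.tendsto c).comp (sin_div_lim c)).mul ?_
    have c1 : ContinuousAt (fun τ : ℝ => p - τ * I) 0 := by fun_prop
    have c2 : ContinuousAt (wb b ε) (p - (0:ℝ) * I) := by
      rw [ofReal_zero, zero_mul, sub_zero]; exact (wb_diff h p hp).continuousAt
    have := (ContinuousAt.comp (f := fun τ : ℝ => p - τ * I) c2 c1).tendsto
    simp only [Function.comp, ofReal_zero, zero_mul, sub_zero] at this
    exact this.mono_left nhdsWithin_le_nhds
  have l1 := lim (-s) him' (Real.pi * b)
  have l2 := lim s him (Real.pi * b⁻¹)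
  have e := tendsto_nhds_unique (l1.congr' key) l2
  have i := wb_inv h s him
  have pos : ∃ r : ℝ, 0 < r ∧ wb b ε s = r := by
    refine ⟨Real.exp (lw b ε s).re, Real.exp_pos _, ?_⟩
    have := lw_conj h _ hy
    rw [← hs', conj_eq_iff_re] at this
    rw [wb_eq, ofReal_exp, this]
  obtain ⟨r, hr, hw⟩ := pos
  rw [hw] at e i ⊢
  have hpi : (Real.pi:ℂ) ≠ 0 := by exact_mod_cast Real.pi_ne_zero
  have e' : (b:ℂ) * wb b ε (-s) = (b:ℂ)⁻¹ * r := by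
    apply mul_left_cancel₀ hpi
    push_cast at e
    linear_combination e
  have e2 : (r:ℂ)^2 = (b:ℂ)^2 := by
    have : (b:ℂ)^2 * (r * wb b ε (-s)) = r^2 := by
      have : (b:ℂ) * ((b:ℂ) * wb b ε (-s)) = r := by rw [e']; field_simp
      linear_combination r * this
    rw [← this, i, mul_one]
  have e3 : r^2 = b^2 := by exact_mod_cast e2
  rw [(pow_left_inj₀ hr.le hb.le two_ne_zero).1 e3]

theorem WP_wb {b ε : ℝ} (h : PP b ε) : WP b (wb b ε) :=
  ⟨h.hb, wb_diff h, wb_inv h, wb_feq h, wb_bound h, wb_crit h⟩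

theorem Dfun_eq {b ε : ℝ} (h : PP b ε) (α z : ℂ) (h1 : |(z + α).im| < (b + b⁻¹) / 2) (h2 : |(α - z).im| < (b + b⁻¹) / 2) :
    Dfun b ε α z = wb b ε (z + α) * wb b ε (α - z) := by
  have h1' : |(-(z + α)).im| < (b + b⁻¹) / 2 := by rwa [neg_im, abs_neg]
  have h2' : |(-(α - z)).im| < (b + b⁻¹) / 2 := by rwa [neg_im, abs_neg]
  have r1 := lw_refl h _ h1
  have r2 := lw_refl h _ h2
  have hl : ∀ x, lw b ε x + lw b ε (-x) = 0 → lw b ε x = (Iw b ε (-x) - Iw b ε x) / 2 := by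
    intro x hx
    have : lw b ε x = (lw b ε x - lw b ε (-x)) / 2 := by linear_combination hx / 2
    rw [this, lw, lw]; ring
  rw [wb_eq, wb_eq, ← Complex.exp_add, hl _ r1, hl _ r2, Dfun, ← integral_const_mul]
  congr 1
  rw [Iw, Iw, Iw, Iw, ← integral_sub (kf_int h _ h1') (kf_int h _ h1), ← integral_sub (kf_int h _ h2') (kf_int h _ h2),
    ← integral_div, ← integral_div]
  refine Eq.trans ?_ (integral_add (((kf_int h _ h1').sub (kf_int h _ h1)).div_const 2) (((kf_int h _ h2').sub (kf_int h _ h2)).div_const 2))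
  congr 1
  ext t
  simp only [mul_comm I (ε:ℂ), kf]
  have hn := ne_ln t ε h.he.ne'
  have him : |((t:ℂ) + ε * I).im| ≤ ε := by simp [abs_of_pos h.he]
  set T := (t:ℂ) + ε * I
  have n1 := sinh1_ne h T hn him
  have n2 := sinh2_ne h T hn him
  have hc : cos (2 * T * z) * sin (2 * α * T) = (sin (2 * T * (z + α)) + sin (2 * T * (α - z))) / 2 := by
    have e1 : 2 * T * (z + α) = 2 * α * T + 2 * T * z := by ring
    have e2 : 2 * T * (α - z) = 2 * α * T - 2 * T * z := by ring
    rw [e1, e2, Complex.sin_add, Complex.sin_sub]; ring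
  have hs : ∀ x, I * sin (2 * T * x) = (cexp (-(2 * I * T * -x)) - cexp (-(2 * I * T * x))) / 2 := by
    intro x
    rw [Complex.sin]
    have e1 : -(2 * I * T * -x) = 2 * T * x * I := by ring
    have e2 : -(2 * I * T * x) = -(2 * T * x) * I := by ring
    rw [e1, e2]
    linear_combination (cexp (-(2 * T * x) * I) - cexp (2 * T * x * I)) / 2 * I_sq
  have := hs (z + α)
  have := hs (α - z)
  rw [hc, ← mul_div_assoc, ← mul_div_assoc, mul_add, hs, hs]
  field_simp
  ring


theorem im_ib (b : ℝ) : (b / 2 * I : ℂ).im = b / 2 := by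
  have : (b / 2 * I : ℂ) = ((b/2 : ℝ):ℂ) * I := by push_cast; ring
  rw [this]; simp

theorem re_ib (b : ℝ) : (b / 2 * I : ℂ).re = 0 := by
  have : (b / 2 * I : ℂ) = ((b/2 : ℝ):ℂ) * I := by push_cast; ring
  rw [this]; simp

theorem WP.ne {b : ℝ} {W : ℂ → ℂ} (h : WP b W) (z : ℂ) (hz : |z.im| < (b + b⁻¹) / 2) : W z ≠ 0 := by
  intro h0
  have := h.inv z hz
  rw [h0, zero_mul] at this
  exact zero_ne_one this

/-- Uniform bound. -/
theorem WP.unif {b : ℝ} {W : ℂ → ℂ} (h : WP b W) (δ P : ℝ) (hδ : 0 < δ) (hP : 0 ≤ P) :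
    ∃ K : ℝ, 0 < K ∧ ∀ (p : ℂ) (r : ℝ), |p.im| ≤ (b + b⁻¹) / 2 - δ → |p.re - r| ≤ P →
      ‖W p‖ ≤ K * Real.exp (Real.pi * |r| * p.im) := by
  obtain ⟨C, hC, hb⟩ := h.bound δ hδ
  have hbb := h.hb
  refine ⟨C * Real.exp (Real.pi * (P * ((b + b⁻¹) / 2))), by positivity, fun p r h1 h2 => (hb p h1).trans ?_⟩
  rw [mul_assoc C, ← Real.exp_add]
  refine mul_le_mul_of_nonneg_left (Real.exp_le_exp.2 ?_) hC.le
  have e : (|p.re| - |r|) * p.im ≤ P * ((b + b⁻¹) / 2) := by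
    calc _ ≤ |(|p.re| - |r|) * p.im| := le_abs_self _
      _ = |(|p.re| - |r|)| * |p.im| := abs_mul _ _
      _ ≤ P * ((b + b⁻¹) / 2) := by
        gcongr
        · exact (abs_abs_sub_abs_le_abs_sub _ _).trans h2
        · linarith
  have := Real.pi_pos
  nlinarith

def Pr (W : ℂ → ℂ) (a c X : ℂ) : ℂ := W (X + a) * W (c - X)

theorem WP.pair {b : ℝ} {W : ℂ → ℂ} (h : WP b W) (δ P : ℝ) (hδ : 0 < δ) (hP : 0 ≤ P) :
    ∃ K : ℝ, 0 < K ∧ ∀ (a c X : ℂ) (m : ℝ), a.im = m → c.im = m → |a.re| ≤ P → |c.re| ≤ P →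
      |m| + |X.im| ≤ (b + b⁻¹) / 2 - δ →
      ‖Pr W a c X‖ ≤ K * Real.exp (2 * Real.pi * m * |X.re|) := by
  obtain ⟨K, hK, hk⟩ := h.unif δ P hδ hP
  refine ⟨K * K, by positivity, fun a c X m ha hc har hcr hX => ?_⟩
  have h1 := hk (X + a) X.re (by rw [add_im, ha]; exact (abs_add_le _ _).trans (by linarith)) (by simpa using har)
  have h2 := hk (c - X) (-X.re) (by rw [sub_im, hc]; exact (abs_sub _ _).trans (by linarith)) (by simpa using hcr)
  rw [Pr, norm_mul]
  calc _ ≤ _ := mul_le_mul h1 h2 (norm_nonneg _) (by positivity)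
    _ = K * K * (Real.exp (Real.pi * |X.re| * (X + a).im) * Real.exp (Real.pi * |-X.re| * (c - X).im)) := by ring
    _ = _ := by
      rw [← Real.exp_add, abs_neg, add_im, sub_im, ha, hc]; congr 2; ring

theorem WP.pair_diff {b : ℝ} {W : ℂ → ℂ} (h : WP b W) (a c X : ℂ) (m : ℝ) (ha : a.im = m) (hc : c.im = m)
    (hX : |m| + |X.im| < (b + b⁻¹) / 2) : DifferentiableAt ℂ (Pr W a c) X := by
  have h1 := h.diff (X + a) (by rw [add_im, ha]; exact (abs_add_le _ _).trans_lt (by linarith))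
  have h2 := h.diff (c - X) (by rw [sub_im, hc]; exact (abs_sub _ _).trans_lt (by linarith))
  have e1 : DifferentiableAt ℂ (fun X => W (X + a)) X := h1.comp X (by fun_prop)
  have e2 : DifferentiableAt ℂ (fun X => W (c - X)) X := DifferentiableAt.comp (f := fun X => c - X) X h2 (by fun_prop)
  exact e1.mul e2

theorem pair_sub (W : ℂ → ℂ) (a c X s : ℂ) : Pr W a c (X - s) = W (X - s + a) * W (c - (X - s)) := rfl

/-- three pairs -/
def Phi (W : ℂ → ℂ) (a1 c1 a2 c2 a3 c3 s X : ℂ) : ℂ := Pr W a1 c1 (X - s) * Pr W a2 c2 X * Pr W a3 c3 X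

theorem WP.phi {b : ℝ} {W : ℂ → ℂ} (h : WP b W) (δ P : ℝ) (hδ : 0 < δ) (hP : 0 ≤ P) :
    ∃ K : ℝ, 0 < K ∧ ∀ (a1 c1 a2 c2 a3 c3 s X : ℂ) (m1 m2 m3 : ℝ), a1.im = m1 → c1.im = m1 → a2.im = m2 → c2.im = m2 →
      a3.im = m3 → c3.im = m3 → |a1.re| ≤ P → |c1.re| ≤ P → |a2.re| ≤ P → |c2.re| ≤ P → |a3.re| ≤ P → |c3.re| ≤ P →
      |m1| + |X.im - s.im| ≤ (b + b⁻¹) / 2 - δ → |m2| + |X.im| ≤ (b + b⁻¹) / 2 - δ → |m3| + |X.im| ≤ (b + b⁻¹) / 2 - δ →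
      ‖Phi W a1 c1 a2 c2 a3 c3 s X‖ ≤ K * (Real.exp (2 * Real.pi * m1 * |X.re - s.re|) * Real.exp (2 * Real.pi * (m2 + m3) * |X.re|)) := by
  obtain ⟨K, hK, hk⟩ := h.pair δ P hδ hP
  refine ⟨K * K * K, by positivity, ?_⟩
  intro a1 c1 a2 c2 a3 c3 s X m1 m2 m3 h1 h2 h3 h4 h5 h6 p1 p2 p3 p4 p5 p6 q1 q2 q3
  have k1 := hk a1 c1 (X - s) m1 h1 h2 p1 p2 (by simpa using q1)
  have k2 := hk a2 c2 X m2 h3 h4 p3 p4 q2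
  have k3 := hk a3 c3 X m3 h5 h6 p5 p6 q3
  rw [Phi, norm_mul, norm_mul]
  calc _ ≤ _ := mul_le_mul (mul_le_mul k1 k2 (norm_nonneg _) (by positivity)) k3 (norm_nonneg _) (by positivity)
    _ = K * K * K * (Real.exp (2 * Real.pi * m1 * |(X - s).re|) * (Real.exp (2 * Real.pi * m2 * |X.re|) * Real.exp (2 * Real.pi * m3 * |X.re|))) := by ring
    _ = _ := by
      rw [← Real.exp_add, sub_re]; congr 3; ring

theorem WP.phi_diff {b : ℝ} {W : ℂ → ℂ} (h : WP b W) (a1 c1 a2 c2 a3 c3 s X : ℂ) (m1 m2 m3 : ℝ)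
    (h1 : a1.im = m1) (h2 : c1.im = m1) (h3 : a2.im = m2) (h4 : c2.im = m2) (h5 : a3.im = m3) (h6 : c3.im = m3)
    (q1 : |m1| + |X.im - s.im| < (b + b⁻¹) / 2) (q2 : |m2| + |X.im| < (b + b⁻¹) / 2) (q3 : |m3| + |X.im| < (b + b⁻¹) / 2) :
    DifferentiableAt ℂ (Phi W a1 c1 a2 c2 a3 c3 s) X := by
  have e1 : DifferentiableAt ℂ (fun X => Pr W a1 c1 (X - s)) X :=
    DifferentiableAt.comp (f := fun X => X - s) X (h.pair_diff a1 c1 (X - s) m1 h1 h2 (by simpa using q1)) (by fun_prop)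
  exact (e1.mul (h.pair_diff a2 c2 X m2 h3 h4 q2)).mul (h.pair_diff a3 c3 X m3 h5 h6 q3)

theorem WP.phi_shift {b : ℝ} {W : ℂ → ℂ} (h : WP b W) (a1 c1 a2 c2 a3 c3 s : ℂ) (m1 m2 m3 : ℝ)
    (h1 : a1.im = m1) (h2 : c1.im = m1) (h3 : a2.im = m2) (h4 : c2.im = m2) (h5 : a3.im = m3) (h6 : c3.im = m3)
    (y1 y2 k1 k2 : ℝ) (hy1 : ∀ y ∈ uIcc y1 y2, |y - s.im| ≤ k1) (hy2 : ∀ y ∈ uIcc y1 y2, |y| ≤ k2)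
    (q1 : |m1| + k1 < (b + b⁻¹) / 2) (q2 : |m2| + k2 < (b + b⁻¹) / 2) (q3 : |m3| + k2 < (b + b⁻¹) / 2)
    (T : ℂ → ℂ) (hT : Differentiable ℂ T) (Kt t : ℝ)
    (hKt : ∀ x y : ℝ, y ∈ uIcc y1 y2 → ‖T (x + y * I)‖ ≤ Kt * Real.exp (t * |x|))
    (hneg : 2 * Real.pi * (m1 + m2 + m3) + t < 0) :
    (Integrable fun x : ℝ => Phi W a1 c1 a2 c2 a3 c3 s (x + y1 * I) * T (x + y1 * I)) ∧
    (Integrable fun x : ℝ => Phi W a1 c1 a2 c2 a3 c3 s (x + y2 * I) * T (x + y2 * I)) ∧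
    ∫ x : ℝ, Phi W a1 c1 a2 c2 a3 c3 s (x + y1 * I) * T (x + y1 * I) = ∫ x : ℝ, Phi W a1 c1 a2 c2 a3 c3 s (x + y2 * I) * T (x + y2 * I) := by
  set P := |a1.re| + |c1.re| + |a2.re| + |c2.re| + |a3.re| + |c3.re|
  set δ := min ((b + b⁻¹) / 2 - (|m1| + k1)) (min ((b + b⁻¹) / 2 - (|m2| + k2)) ((b + b⁻¹) / 2 - (|m3| + k2))) with hδ
  have hδ0 : 0 < δ := by
    rw [hδ]; simp only [lt_min_iff]; refine ⟨?_, ?_, ?_⟩ <;> linarith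
  have d1 : δ ≤ (b + b⁻¹) / 2 - (|m1| + k1) := min_le_left _ _
  have d2 : δ ≤ (b + b⁻¹) / 2 - (|m2| + k2) := (min_le_right _ _).trans (min_le_left _ _)
  have d3 : δ ≤ (b + b⁻¹) / 2 - (|m3| + k2) := (min_le_right _ _).trans (min_le_right _ _)
  have n1 := abs_nonneg a1.re
  have n2 := abs_nonneg c1.re
  have n3 := abs_nonneg a2.re
  have n4 := abs_nonneg c2.re
  have n5 := abs_nonneg a3.re
  have n6 := abs_nonneg c3.re
  obtain ⟨K, hK, hk⟩ := h.phi δ P hδ0 (by positivity)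
  have hKt0 : 0 ≤ Kt := by
    have := (norm_nonneg _).trans (hKt 0 y1 left_mem_uIcc)
    simpa using this
  refine shift_exp (fun X => Phi W a1 c1 a2 c2 a3 c3 s X * T X) y1 y2 (K * Real.exp (2 * Real.pi * (|m1| * |s.re|)) * Kt) (-(2 * Real.pi * (m1 + m2 + m3) + t)) (by linarith) ?_ ?_
  · intro X hX
    have := hy1 _ hX
    have := hy2 _ hX
    exact (h.phi_diff a1 c1 a2 c2 a3 c3 s X m1 m2 m3 h1 h2 h3 h4 h5 h6 (by linarith) (by linarith) (by linarith)).mul (hT X)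
  · intro x y hy
    have hh1 := hy1 _ hy
    have hh2 := hy2 _ hy
    have i : ((x:ℂ) + y * I).im = y := by simp
    have r : ((x:ℂ) + y * I).re = x := by simp
    have := hk a1 c1 a2 c2 a3 c3 s (x + y * I) m1 m2 m3 h1 h2 h3 h4 h5 h6 (by linarith) (by linarith) (by linarith) (by linarith) (by linarith) (by linarith)
      (by rw [i]; linarith) (by rw [i]; linarith) (by rw [i]; linarith)
    rw [r] at this
    rw [norm_mul]
    calc _ ≤ _ := mul_le_mul this (hKt x y hy) (norm_nonneg _) (by positivity)
      _ = K * Kt * (Real.exp (2 * Real.pi * m1 * |x - s.re|) * Real.exp (2 * Real.pi * (m2 + m3) * |x|) * Real.exp (t * |x|)) := by ring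
      _ ≤ K * Kt * (Real.exp (2 * Real.pi * (|m1| * |s.re|)) * Real.exp (- -(2 * Real.pi * (m1 + m2 + m3) + t) * |x|)) := by
        refine mul_le_mul_of_nonneg_left ?_ (by positivity)
        rw [← Real.exp_add, ← Real.exp_add, ← Real.exp_add]
        apply Real.exp_le_exp.2
        have e : (|x - s.re| - |x|) * m1 ≤ |m1| * |s.re| := by
          calc _ ≤ |(|x - s.re| - |x|) * m1| := le_abs_self _
            _ = |(|x - s.re| - |x|)| * |m1| := abs_mul _ _
            _ ≤ |s.re| * |m1| := by
              refine mul_le_mul_of_nonneg_right ?_ (abs_nonneg _)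
              have e3 := abs_abs_sub_abs_le_abs_sub (x - s.re) x
              have e4 : |x - s.re - x| = |s.re| := by rw [show x - s.re - x = -s.re by ring, abs_neg]
              rwa [e4] at e3
            _ = _ := mul_comm _ _
        have := Real.pi_pos
        nlinarith
      _ = _ := by ring

theorem hyp_id (u v w : ℂ) : 4 * (sinh (u + v) * sinh (u + w)) + (2 * cosh v) * (2 * cosh w) = (2 * cosh u) * (2 * cosh (u + v + w)) := by
  have h := Complex.cosh_sq_sub_sinh_sq u
  simp only [Complex.sinh_add, Complex.cosh_add]
  linear_combination (-4 * cosh v * cosh w) * h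


theorem per_aux (R : ℂ → ℂ) (b C : ℝ)
    (hp : ∀ s : ℂ, |s.im| < C - b / 2 → R (s + b / 2 * I) = R (s - b / 2 * I)) (s : ℂ) (n : ℤ)
    (h1 : |s.im - b * n| < C) (h2 : |s.im - b * (n + 1)| < C) :
    R (s - b * n * I) = R (s - b * ((n:ℂ) + 1) * I) := by
  have := hp (s - b * n * I - b / 2 * I) ?_
  · convert this using 2 <;> ring
  · have e : (s - b * n * I - b / 2 * I).im = s.im - b * n - b / 2 := by
      rw [sub_im, sub_im, im_ib]
      have : ((b:ℂ) * n * I) = ((b * n : ℝ):ℂ) * I := by push_cast; ring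
      rw [this]; simp
    rw [e]
    rw [abs_lt] at *
    constructor <;> linarith

theorem periodic_const (R : ℂ → ℂ) (b C : ℝ) (hb : 0 < b) (hC : b / 2 < C)
    (hd : ∀ s : ℂ, |s.im| < C → DifferentiableAt ℂ R s)
    (hp : ∀ s : ℂ, |s.im| < C - b / 2 → R (s + b / 2 * I) = R (s - b / 2 * I)) (M : ℝ)
    (hM : ∀ s : ℂ, |s.im| ≤ b / 2 → ‖R s‖ ≤ M) : ∀ s : ℂ, |s.im| < C → R s = R 0 := by
  set r := min C b with hr
  have hrC : r ≤ C := min_le_left _ _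
  have hrb : r ≤ b := min_le_right _ _
  have hr2 : b / 2 < r := lt_min hC (by linarith)
  have him : ∀ (s : ℂ) (n : ℤ), (s - b * n * I).im = s.im - b * n := by
    intro s n
    have : ((b:ℂ) * n * I) = ((b * n : ℝ):ℂ) * I := by push_cast; ring
    rw [sub_im, this]; simp
  have key : ∀ (s : ℂ) (n m : ℤ), |s.im - b * n| < r → |s.im - b * m| < r → n ≤ m →
      R (s - b * n * I) = R (s - b * m * I) := by
    intro s n m h1 h2 hnm
    have h3 : (m:ℝ) - n < 2 := by
      rw [abs_lt] at h1 h2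
      have : b * ((m:ℝ) - n) < b * 2 := by linarith
      exact lt_of_mul_lt_mul_left this hb.le
    have h4 : m - n < 2 := by exact_mod_cast h3
    have h5 : m = n ∨ m = n + 1 := by omega
    rcases h5 with rfl | rfl
    · rfl
    · have := per_aux R b C hp s n (h1.trans_le hrC) (by push_cast at h2; exact h2.trans_le hrC)
      push_cast; exact this
  have key2 : ∀ (s : ℂ) (n m : ℤ), |s.im - b * n| < r → |s.im - b * m| < r →
      R (s - b * n * I) = R (s - b * m * I) := by
    intro s n m h1 h2
    rcases le_total n m with h | h
    · exact key s n m h1 h2 h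
    · exact (key s m n h2 h1 h).symm
  have hrd : ∀ s : ℂ, |s.im - b * round (s.im / b)| ≤ b / 2 := by
    intro s
    have := abs_sub_round (s.im / b)
    have e : s.im - b * round (s.im / b) = b * (s.im / b - round (s.im / b)) := by field_simp
    rw [e, abs_mul, abs_of_pos hb]
    nlinarith
  let F : ℂ → ℂ := fun s => R (s - b * round (s.im / b) * I)
  have hF : ∀ (s : ℂ) (n : ℤ), |s.im - b * n| < r → F s = R (s - b * n * I) := by
    intro s n h
    exact key2 s _ _ ((hrd s).trans_lt hr2) h
  have hFd : Differentiable ℂ F := by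
    intro s
    have hn := (hrd s).trans_lt hr2
    set n := round (s.im / b) with hn'
    have ho : IsOpen {z : ℂ | |z.im - b * n| < r} := isOpen_lt (by fun_prop) (by fun_prop)
    have : F =ᶠ[𝓝 s] fun z => R (z - b * n * I) := by
      filter_upwards [ho.mem_nhds hn] with z hz using hF z n hz
    refine DifferentiableAt.congr_of_eventuallyEq ?_ this
    refine DifferentiableAt.comp (f := fun z => z - b * n * I) s (hd _ ?_) (by fun_prop)
    rw [him]; exact hn.trans_le hrC
  have hFb : Bornology.IsBounded (range F) := by
    rw [isBounded_iff_forall_norm_le]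
    refine ⟨M, ?_⟩
    rintro _ ⟨s, rfl⟩
    refine hM _ ?_
    rw [him]; exact hrd s
  have h0 : ∀ s : ℂ, |s.im| < r → R s = R 0 := by
    intro s hs
    have e1 := hF s 0 (by simpa using hs)
    have e2 := hF 0 0 (by simp; linarith)
    have := hFd.apply_eq_apply_of_bounded hFb s 0
    rw [e1, e2] at this
    simpa using this
  have hopen : IsOpen {z : ℂ | |z.im| < C} := strip_open C
  have hconv : Convex ℝ {z : ℂ | |z.im| < C} := by
    have : {z : ℂ | |z.im| < C} = Complex.imCLM ⁻¹' (Metric.ball (0:ℝ) C) := by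
      ext z; simp
    rw [this]
    exact (convex_ball _ _).is_linear_preimage Complex.imCLM.isLinear
  have han : AnalyticOnNhd ℂ R {z : ℂ | |z.im| < C} :=
    DifferentiableOn.analyticOnNhd (fun s hs => (hd s hs).differentiableWithinAt) hopen
  have hanc : AnalyticOnNhd ℂ (fun _ : ℂ => R 0) {z : ℂ | |z.im| < C} := analyticOnNhd_const
  have hCpos : 0 < C := by linarith
  have m0 : (0:ℂ) ∈ {z : ℂ | |z.im| < C} := by simp [hCpos]
  have := han.eqOn_of_preconnected_of_eventuallyEq hanc hconv.isPreconnected m0 (by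
    have : (0:ℂ) ∈ {z : ℂ | |z.im| < r} := by simp; linarith
    filter_upwards [(strip_open r).mem_nhds this] with z hz using h0 z hz)
  exact fun s hs => this hs


structure Cfg (b : ℝ) (W : ℂ → ℂ) (a1 c1 a2 c2 a3 c3 : ℂ) (A B C θ : ℝ) : Prop where
  wp : WP b W
  ia1 : a1.im = -A
  ic1 : c1.im = -A
  ia2 : a2.im = -B
  ic2 : c2.im = -B
  ia3 : a3.im = -C
  ic3 : c3.im = -C
  sum : a1 + c1 + a2 + c2 + a3 + c3 = ((-(2 * (b + b⁻¹)) : ℝ) : ℂ) * I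
  A0 : 0 < A
  AQ : A < (b + b⁻¹) / 2
  BQ : B < (b + b⁻¹) / 2
  hC : b / 2 < C
  hCB : C ≤ B
  hθ : θ * C = (b + b⁻¹) / 2 - B

section
variable {b : ℝ} {W : ℂ → ℂ} {a1 c1 a2 c2 a3 c3 : ℂ} {A B C θ : ℝ}

theorem Cfg.b0 (h : Cfg b W a1 c1 a2 c2 a3 c3 A B C θ) : 0 < b := h.wp.hb

theorem Cfg.C0 (h : Cfg b W a1 c1 a2 c2 a3 c3 A B C θ) : 0 < C := by
  have := h.b0
  have := h.hC
  linarith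

theorem Cfg.sumQ (h : Cfg b W a1 c1 a2 c2 a3 c3 A B C θ) : A + B + C = b + b⁻¹ := by
  have := congrArg Complex.im h.sum
  simp only [add_im, h.ia1, h.ia2, h.ia3, h.ic1, h.ic2, h.ic3, mul_im, ofReal_re, ofReal_im, I_re, I_im] at this
  linarith

theorem Cfg.hθ' (h : Cfg b W a1 c1 a2 c2 a3 c3 A B C θ) : (1 - θ) * C = (b + b⁻¹) / 2 - A := by
  have := h.hθ
  have := h.sumQ
  linarith

theorem Cfg.θ0 (h : Cfg b W a1 c1 a2 c2 a3 c3 A B C θ) : 0 < θ := by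
  have h1 := h.hθ
  have := h.BQ
  have h2 := h.C0
  by_contra h3
  push Not at h3
  nlinarith

theorem Cfg.θ1 (h : Cfg b W a1 c1 a2 c2 a3 c3 A B C θ) : θ < 1 := by
  have h1 := h.hθ'
  have := h.AQ
  have h2 := h.C0
  by_contra h3
  push Not at h3
  nlinarith

theorem Cfg.bd (h : Cfg b W a1 c1 a2 c2 a3 c3 A B C θ) (τ : ℝ) (hτ : τ < C) :
    ∃ K : ℝ, 0 < K ∧ ∀ s X : ℂ, |s.im| ≤ τ → X.im = θ * s.im →
      ‖Phi W a1 c1 a2 c2 a3 c3 s X‖ ≤ K * (Real.exp (2 * Real.pi * (-A) * |X.re - s.re|) *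
        Real.exp (2 * Real.pi * (-B + -C) * |X.re|)) := by
  have t0 := h.θ0
  have t1 := h.θ1
  set δ := min ((1 - θ) * (C - τ)) (θ * (C - τ)) with hδ
  have hδ0 : 0 < δ := lt_min (mul_pos (by linarith) (by linarith)) (mul_pos t0 (by linarith))
  have d1 : δ ≤ (1 - θ) * (C - τ) := min_le_left _ _
  have d2 : δ ≤ θ * (C - τ) := min_le_right _ _
  set P := |a1.re| + |c1.re| + |a2.re| + |c2.re| + |a3.re| + |c3.re|
  have n1 := abs_nonneg a1.re
  have n2 := abs_nonneg c1.re
  have n3 := abs_nonneg a2.re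
  have n4 := abs_nonneg c2.re
  have n5 := abs_nonneg a3.re
  have n6 := abs_nonneg c3.re
  obtain ⟨K, hK, hk⟩ := h.wp.phi δ P hδ0 (by positivity)
  refine ⟨K, hK, fun s X hs hX => ?_⟩
  have hA := h.A0
  have hC := h.C0
  have hB := h.hCB
  have e1 : |X.im - s.im| = (1 - θ) * |s.im| := by
    rw [hX, show θ * s.im - s.im = -((1 - θ) * s.im) by ring, abs_neg, abs_mul, abs_of_pos (by linarith)]
  have e2 : |X.im| = θ * |s.im| := by rw [hX, abs_mul, abs_of_pos t0]
  have f1 : (1 - θ) * |s.im| ≤ (1 - θ) * τ := mul_le_mul_of_nonneg_left hs (by linarith)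
  have f2 : θ * |s.im| ≤ θ * τ := by gcongr
  have g1 := h.hθ
  have g2 := h.hθ'
  refine hk a1 c1 a2 c2 a3 c3 s X (-A) (-B) (-C) h.ia1 h.ic1 h.ia2 h.ic2 h.ia3 h.ic3 (by linarith) (by linarith) (by linarith) (by linarith) (by linarith) (by linarith) ?_ ?_ ?_
  · rw [abs_neg, abs_of_pos hA, e1]; linarith
  · rw [abs_neg, abs_of_pos (by linarith), e2]; linarith
  · rw [abs_neg, abs_of_pos (by linarith), e2]; linarith

theorem Cfg.cond (h : Cfg b W a1 c1 a2 c2 a3 c3 A B C θ) (σ : ℝ) (hσ : |σ| < C) :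
    |-A| + |θ * σ - σ| < (b + b⁻¹) / 2 ∧ |-B| + |θ * σ| < (b + b⁻¹) / 2 ∧ |-C| + |θ * σ| < (b + b⁻¹) / 2 := by
  have t0 := h.θ0
  have t1 := h.θ1
  have hA := h.A0
  have hC := h.C0
  have hB := h.hCB
  have g1 := h.hθ
  have g2 := h.hθ'
  have e1 : |θ * σ - σ| = (1 - θ) * |σ| := by
    rw [show θ * σ - σ = -((1 - θ) * σ) by ring, abs_neg, abs_mul, abs_of_pos (by linarith)]
  have e2 : |θ * σ| = θ * |σ| := by rw [abs_mul, abs_of_pos t0]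
  have f1 : (1 - θ) * |σ| < (1 - θ) * C := mul_lt_mul_of_pos_left hσ (by linarith)
  have f2 : θ * |σ| < θ * C := mul_lt_mul_of_pos_left hσ t0
  rw [e1, e2, abs_neg, abs_neg, abs_neg, abs_of_pos hA, abs_of_pos hC, abs_of_pos (show 0 < B by linarith)]
  refine ⟨?_, ?_, ?_⟩ <;> linarith

/-- The main integral. -/
noncomputable def JJ (W : ℂ → ℂ) (a1 c1 a2 c2 a3 c3 : ℂ) (θ : ℝ) (s : ℂ) : ℂ :=
  ∫ x : ℝ, Phi W a1 c1 a2 c2 a3 c3 s (x + θ * s)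

theorem im_th (θ x : ℝ) (s : ℂ) : ((x:ℂ) + θ * s).im = θ * s.im := by simp
theorem re_th (θ x : ℝ) (s : ℂ) : ((x:ℂ) + θ * s).re = x + θ * s.re := by simp

theorem Cfg.J_diff (h : Cfg b W a1 c1 a2 c2 a3 c3 A B C θ) (s : ℂ) (hs : |s.im| < C) :
    DifferentiableAt ℂ (JJ W a1 c1 a2 c2 a3 c3 θ) s := by
  have hB := h.hCB
  have hC := h.C0
  suffices hh : DifferentiableOn ℂ (JJ W a1 c1 a2 c2 a3 c3 θ) {z | |z.im| < C} from
    (hh s hs).differentiableAt ((strip_open C).mem_nhds hs)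
  refine holo_integral (strip_open C) (fun s x => Phi W a1 c1 a2 c2 a3 c3 s (x + θ * s)) ?_ ?_ ?_
  · intro z hz
    obtain ⟨q1, q2, q3⟩ := h.cond z.im hz
    refine Continuous.aestronglyMeasurable ?_
    refine continuous_iff_continuousAt.2 fun x => ?_
    have := (h.wp.phi_diff a1 c1 a2 c2 a3 c3 z (x + θ * z) (-A) (-B) (-C) h.ia1 h.ic1 h.ia2 h.ic2 h.ia3 h.ic3
      (by rw [im_th]; exact q1) (by rw [im_th]; exact q2) (by rw [im_th]; exact q3)).continuousAt
    exact ContinuousAt.comp (f := fun x : ℝ => (x:ℂ) + θ * z) this (by fun_prop)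
  · intro x z hz
    obtain ⟨q1, q2, q3⟩ := h.cond z.im hz
    have e1 : DifferentiableAt ℂ (fun z => Pr W a1 c1 (x + θ * z - z)) z :=
      DifferentiableAt.comp (f := fun z : ℂ => (x:ℂ) + θ * z - z) z (h.wp.pair_diff a1 c1 _ (-A) h.ia1 h.ic1 (by rw [sub_im, im_th]; exact q1)) (by fun_prop)
    have e2 : DifferentiableAt ℂ (fun z => Pr W a2 c2 (x + θ * z)) z :=
      DifferentiableAt.comp (f := fun z : ℂ => (x:ℂ) + θ * z) z (h.wp.pair_diff a2 c2 _ (-B) h.ia2 h.ic2 (by rw [im_th]; exact q2)) (by fun_prop)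
    have e3 : DifferentiableAt ℂ (fun z => Pr W a3 c3 (x + θ * z)) z :=
      DifferentiableAt.comp (f := fun z : ℂ => (x:ℂ) + θ * z) z (h.wp.pair_diff a3 c3 _ (-C) h.ia3 h.ic3 (by rw [im_th]; exact q3)) (by fun_prop)
    exact ((e1.mul e2).mul e3).differentiableWithinAt
  · intro z₀ hz₀
    have hz₀ : |z₀.im| < C := hz₀
    set r := (C - |z₀.im|) / 2 with hr
    have hr0 : 0 < r := by linarith
    obtain ⟨K, hK, hk⟩ := h.bd (|z₀.im| + r) (by linarith)
    set ρ := |z₀.re| + r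
    refine ⟨r, hr0, fun x => K * Real.exp (2 * Real.pi * (B + C) * ρ) * Real.exp (-(2 * Real.pi * (B + C)) * |x|), ?_, ?_⟩
    · exact (integrable_exp_abs _ (by have := Real.pi_pos; have : 0 < B + C := by linarith
                                      positivity)).const_mul _
    · intro z hz x
      have hz' : ‖z - z₀‖ < r := by simpa [dist_eq_norm] using hz
      have hi : |z.im| ≤ |z₀.im| + r := by
        have := (abs_im_le_norm (z - z₀)).trans hz'.le
        have h2 := abs_add_le z₀.im (z - z₀).im
        rw [sub_im, add_sub_cancel] at h2
        rw [sub_im] at this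
        linarith
      have hre : |z.re| ≤ ρ := by
        have := (abs_re_le_norm (z - z₀)).trans hz'.le
        have h2 := abs_add_le z₀.re (z - z₀).re
        rw [sub_re, add_sub_cancel] at h2
        rw [sub_re] at this
        simp only [ρ]
        linarith
      have := hk z (x + θ * z) hi (im_th _ _ _)
      refine this.trans ?_
      show _ ≤ K * _ * _
      rw [mul_assoc K]
      refine mul_le_mul_of_nonneg_left ?_ hK.le
      rw [← Real.exp_add, ← Real.exp_add]
      apply Real.exp_le_exp.2
      rw [re_th]
      have p := Real.pi_pos
      have n1 := abs_nonneg (x + θ * z.re - z.re)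
      have n2 : |x| - ρ ≤ |x + θ * z.re| := by
        have h1 := abs_sub (x + θ * z.re) (θ * z.re)
        rw [add_sub_cancel_right, abs_mul, abs_of_pos h.θ0] at h1
        have := h.θ1
        have := abs_nonneg z.re
        nlinarith
      have m1 : 0 ≤ Real.pi * (A * |x + θ * z.re - z.re|) := by have := h.A0; positivity
      have m2 : 0 ≤ Real.pi * ((B + C) * (|x + θ * z.re| - (|x| - ρ))) :=
        mul_nonneg p.le (mul_nonneg (by linarith) (by linarith))
      linarith

theorem J_trans (W : ℂ → ℂ) (a1 c1 a2 c2 a3 c3 : ℂ) (θ : ℝ) (s : ℂ) :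
    JJ W a1 c1 a2 c2 a3 c3 θ s = ∫ x : ℝ, Phi W a1 c1 a2 c2 a3 c3 s (x + (θ * s.im : ℝ) * I) := by
  rw [← integral_add_right_eq_self _ (θ * s.re)]
  unfold JJ
  congr 1
  ext x
  congr 1
  conv_lhs => rw [← re_add_im s]
  push_cast
  ring

theorem Cfg.J_bound (h : Cfg b W a1 c1 a2 c2 a3 c3 A B C θ) :
    ∃ K : ℝ, ∀ s : ℂ, |s.im| ≤ b / 2 → ‖JJ W a1 c1 a2 c2 a3 c3 θ s‖ ≤ K * Real.exp (2 * Real.pi * (-A) * |s.re|) := by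
  obtain ⟨K, hK, hk⟩ := h.bd (b / 2) h.hC
  have hp := Real.pi_pos
  have hc : 0 < 2 * Real.pi * (B + C - A) := by
    have := h.sumQ
    have := h.AQ
    have : 0 < B + C - A := by linarith
    positivity
  refine ⟨K * ∫ x : ℝ, Real.exp (-(2 * Real.pi * (B + C - A)) * |x|), fun s hs => ?_⟩
  rw [J_trans]
  have : ∀ x : ℝ, ‖Phi W a1 c1 a2 c2 a3 c3 s (x + (θ * s.im : ℝ) * I)‖ ≤
      K * Real.exp (2 * Real.pi * (-A) * |s.re|) * Real.exp (-(2 * Real.pi * (B + C - A)) * |x|) := by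
    intro x
    have e1 : ((x:ℂ) + (θ * s.im : ℝ) * I).im = θ * s.im := by rw [add_im, im_ofReal_mul]; simp
    have e2 : ((x:ℂ) + (θ * s.im : ℝ) * I).re = x := by rw [add_re]; simp
    have := hk s _ hs e1
    rw [e2] at this
    refine this.trans ?_
    rw [mul_assoc K]
    refine mul_le_mul_of_nonneg_left ?_ hK.le
    rw [← Real.exp_add, ← Real.exp_add]
    apply Real.exp_le_exp.2
    have h1 := abs_sub x (x - s.re)
    rw [sub_sub_cancel] at h1
    have : 0 ≤ Real.pi * (A * (|x| + |x - s.re| - |s.re|)) := mul_nonneg hp.le (mul_nonneg h.A0.le (by linarith))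
    linarith
  refine (norm_integral_le_of_norm_le ((integrable_exp_abs _ hc).const_mul _) (Eventually.of_forall this)).trans ?_
  rw [integral_const_mul]
  apply le_of_eq; ring

end


theorem Pr_neg (W : ℂ → ℂ) (a c X : ℂ) : Pr W c a (-X) = Pr W a c X := by
  unfold Pr
  rw [mul_comm]
  congr 2 <;> ring

theorem Phi_neg (W : ℂ → ℂ) (a1 c1 a2 c2 a3 c3 s X : ℂ) :
    Phi W c1 a1 c2 a2 c3 a3 (-s) (-X) = Phi W a1 c1 a2 c2 a3 c3 s X := by
  unfold Phi
  rw [show -X - -s = -(X - s) by ring, Pr_neg, Pr_neg, Pr_neg]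

theorem norm_cosh_le (z : ℂ) : ‖cosh z‖ ≤ Real.exp |z.re| := by
  have e : cosh z = (exp z + exp (-z)) / 2 := rfl
  rw [e, norm_div]
  have h1 : ‖exp z‖ ≤ Real.exp |z.re| := by rw [norm_exp]; exact Real.exp_le_exp.2 (le_abs_self _)
  have h2 : ‖exp (-z)‖ ≤ Real.exp |z.re| := by rw [norm_exp, neg_re]; exact Real.exp_le_exp.2 (neg_le_abs _)
  have h3 := norm_add_le (exp z) (exp (-z))
  have : ‖(2:ℂ)‖ = 2 := by simp
  rw [this]
  linarith

section
variable {b : ℝ} {W : ℂ → ℂ} {a1 c1 a2 c2 a3 c3 : ℂ} {A B C θ : ℝ}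

theorem Cfg.swap (h : Cfg b W a1 c1 a2 c2 a3 c3 A B C θ) : Cfg b W c1 a1 c2 a2 c3 a3 A B C θ where
  wp := h.wp
  ia1 := h.ic1
  ic1 := h.ia1
  ia2 := h.ic2
  ic2 := h.ia2
  ia3 := h.ic3
  ic3 := h.ia3
  sum := by rw [← h.sum]; ring
  A0 := h.A0
  AQ := h.AQ
  BQ := h.BQ
  hC := h.hC
  hCB := h.hCB
  hθ := h.hθ

theorem Cfg.pt (h : Cfg b W a1 c1 a2 c2 a3 c3 A B C θ) (s X : ℂ) (hs : |s.im| < C - b / 2)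
    (hX : X.im = θ * (s.im + b / 2)) :
    Phi W (a1 + b / 2 * I) (c1 + b / 2 * I) a2 c2 a3 c3 s X * (2 * cosh (Real.pi * b * (a1 - s + c2 + c3 + b * I - X))) =
    4 * (sinh (Real.pi * b * (a1 - s + c2 + b / 2 * I)) * sinh (Real.pi * b * (a1 - s + c3 + b / 2 * I))) *
      Phi W a1 c1 a2 c2 a3 c3 (s + b / 2 * I) X
    + Phi W a1 c1 (a2 + b / 2 * I) (c2 + b / 2 * I) (a3 + b / 2 * I) (c3 + b / 2 * I) s (X - b / 2 * I) := by
  have t0 := h.θ0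
  have t1 := h.θ1
  have hA := h.A0
  have hC := h.C0
  have hB := h.hCB
  have g1 := h.hθ
  have g2 := h.hθ'
  have gs := h.sumQ
  have gb := h.b0
  have gC := h.hC
  have gB := h.BQ
  have gA := h.AQ
  have f1 : (1 - θ) * |s.im| < (1 - θ) * (C - b / 2) := mul_lt_mul_of_pos_left hs (by linarith)
  have f2 : θ * |s.im| < θ * (C - b / 2) := mul_lt_mul_of_pos_left hs t0
  have f3 : θ * b < θ * (2 * C) := mul_lt_mul_of_pos_left (by linarith) t0
  have f4 : 0 < θ * b := mul_pos t0 gb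
  have f5 : 0 < (1 - θ) * b := mul_pos (by linarith) gb
  have l1 : (1 - θ) * s.im ≤ (1 - θ) * |s.im| := mul_le_mul_of_nonneg_left (le_abs_self _) (by linarith)
  have l2 : (1 - θ) * (-s.im) ≤ (1 - θ) * |s.im| := mul_le_mul_of_nonneg_left (neg_le_abs _) (by linarith)
  have l3 : θ * s.im ≤ θ * |s.im| := mul_le_mul_of_nonneg_left (le_abs_self _) (by linarith)
  have l4 : θ * (-s.im) ≤ θ * |s.im| := mul_le_mul_of_nonneg_left (neg_le_abs _) (by linarith)
  have e1 := h.wp.feq (X - s + a1) (by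
    rw [add_im, sub_im, hX, h.ia1, abs_lt]; constructor <;> linarith)
  have e2 := h.wp.feq (c2 - X + b / 2 * I) (by
    rw [add_im, sub_im, hX, h.ic2, im_ib, abs_lt]; constructor <;> linarith)
  have e3 := h.wp.feq (c3 - X + b / 2 * I) (by
    rw [add_im, sub_im, hX, h.ic3, im_ib, abs_lt]; constructor <;> linarith)
  have id := hyp_id (Real.pi * b * (X - s + a1)) (Real.pi * b * (c2 - X + b / 2 * I)) (Real.pi * b * (c3 - X + b / 2 * I))
  unfold Phi Pr
  have r1 : X - s + (a1 + b / 2 * I) = X - s + a1 + b / 2 * I := by ring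
  have r2 : X - b / 2 * I + (a2 + b / 2 * I) = X + a2 := by ring
  have r3 : X - b / 2 * I + (a3 + b / 2 * I) = X + a3 := by ring
  have r4 : c2 + b / 2 * I - (X - b / 2 * I) = c2 - X + b / 2 * I + b / 2 * I := by ring
  have r5 : c3 + b / 2 * I - (X - b / 2 * I) = c3 - X + b / 2 * I + b / 2 * I := by ring
  have r6 : c2 - X + b / 2 * I - b / 2 * I = c2 - X := by ring
  have r7 : c3 - X + b / 2 * I - b / 2 * I = c3 - X := by ring
  have r8 : X - (s + b / 2 * I) + a1 = X - s + a1 - b / 2 * I := by ring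
  have r9 : X - b / 2 * I - s + a1 = X - s + a1 - b / 2 * I := by ring
  have r10 : c1 - (X - (s + b / 2 * I)) = c1 + b / 2 * I - (X - s) := by ring
  have r11 : c1 - (X - b / 2 * I - s) = c1 + b / 2 * I - (X - s) := by ring
  rw [r1, r2, r3, r4, r5, r8, r9, r10, r11, e1, e2, e3, r6, r7]
  have i1 : (Real.pi * b * (a1 - s + c2 + c3 + b * I - X) : ℂ) = Real.pi * b * (X - s + a1) + Real.pi * b * (c2 - X + b / 2 * I) + Real.pi * b * (c3 - X + b / 2 * I) := by ring
  have i2 : (Real.pi * b * (a1 - s + c2 + b / 2 * I) : ℂ) = Real.pi * b * (X - s + a1) + Real.pi * b * (c2 - X + b / 2 * I) := by ring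
  have i3 : (Real.pi * b * (a1 - s + c3 + b / 2 * I) : ℂ) = Real.pi * b * (X - s + a1) + Real.pi * b * (c3 - X + b / 2 * I) := by ring
  rw [i1, i2, i3]
  linear_combination (-(W (X - s + a1 - b / 2 * I) * W (c1 + b / 2 * I - (X - s)) * (W (X + a2) * W (c2 - X)) * (W (X + a3) * W (c3 - X)))) * id

/-- first kappa -/
noncomputable def kap (b : ℝ) (a1 c2 c3 s : ℂ) : ℂ :=
  4 * (sinh (Real.pi * b * (a1 - s + c2 + b / 2 * I)) * sinh (Real.pi * b * (a1 - s + c3 + b / 2 * I)))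

theorem Cfg.tau (h : Cfg b W a1 c1 a2 c2 a3 c3 A B C θ) (s X : ℂ) :
    cosh (Real.pi * b * (c1 - -s + a2 + a3 + b * I - -X)) = cosh (Real.pi * b * (a1 - s + c2 + c3 + b * I - X)) := by
  have hs := h.sum
  have gb : (b:ℂ) ≠ 0 := by exact_mod_cast h.b0.ne'
  have e : (Real.pi * b * (c1 - -s + a2 + a3 + b * I - -X) : ℂ) = -(Real.pi * b * (a1 - s + c2 + c3 + b * I - X) + 2 * Real.pi * I) := by
    rw [show ((-(2 * (b + b⁻¹)) : ℝ) : ℂ) = -(2 * ((b:ℂ) + (b:ℂ)⁻¹)) by push_cast; ring] at hs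
    have : (b:ℂ) * (b:ℂ)⁻¹ = 1 := mul_inv_cancel₀ gb
    linear_combination (Real.pi * b : ℂ) * hs - 2 * Real.pi * I * this
  rw [e, cosh_neg, cosh_add, cosh_mul_I, sinh_mul_I]
  simp

theorem Cfg.Jdiff (h : Cfg b W a1 c1 a2 c2 a3 c3 A B C θ) (s : ℂ) (hs : |s.im| < C - b / 2) :
    kap b a1 c2 c3 s * JJ W a1 c1 a2 c2 a3 c3 θ (s + b / 2 * I) = kap b c1 a2 a3 (-s) * JJ W a1 c1 a2 c2 a3 c3 θ (s - b / 2 * I) := by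
  have t0 := h.θ0
  have t1 := h.θ1
  have hA := h.A0
  have hC := h.C0
  have hB := h.hCB
  have g1 := h.hθ
  have g2 := h.hθ'
  have gs := h.sumQ
  have gb := h.b0
  have gC := h.hC
  have gB := h.BQ
  have gA := h.AQ
  have f1 : (1 - θ) * |s.im| < (1 - θ) * (C - b / 2) := mul_lt_mul_of_pos_left hs (by linarith)
  have f2 : θ * |s.im| < θ * (C - b / 2) := mul_lt_mul_of_pos_left hs t0
  have f3 : θ * b < θ * (2 * C) := mul_lt_mul_of_pos_left (by linarith) t0
  have f4 : 0 < θ * b := mul_pos t0 gb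
  have f5 : 0 < (1 - θ) * b := mul_pos (by linarith) gb
  have l1 : (1 - θ) * s.im ≤ (1 - θ) * |s.im| := mul_le_mul_of_nonneg_left (le_abs_self _) (by linarith)
  have l2 : (1 - θ) * (-s.im) ≤ (1 - θ) * |s.im| := mul_le_mul_of_nonneg_left (neg_le_abs _) (by linarith)
  have l3 : θ * s.im ≤ θ * |s.im| := mul_le_mul_of_nonneg_left (le_abs_self _) (by linarith)
  have l4 : θ * (-s.im) ≤ θ * |s.im| := mul_le_mul_of_nonneg_left (neg_le_abs _) (by linarith)
  have bi : 0 < b⁻¹ := inv_pos.2 gb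
  have pp := Real.pi_pos
  set yp := θ * (s.im + b / 2) with hyp
  set ym := θ * (s.im - b / 2) with hym
  -- tau
  set ω := a1 - s + c2 + c3 + b * I with hω
  let T : ℂ → ℂ := fun X => 2 * cosh (Real.pi * b * (ω - X))
  have hT : Differentiable ℂ T := by
    intro X
    simp only [T]
    fun_prop
  have S0 := h.wp.phi_shift (a1 + b / 2 * I) (c1 + b / 2 * I) a2 c2 a3 c3 s (-A + b / 2) (-B) (-C)
    (by rw [add_im, im_ib, h.ia1]) (by rw [add_im, im_ib, h.ic1]) h.ia2 h.ic2 h.ia3 h.ic3 yp ym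
    (θ * b / 2 + (1 - θ) * |s.im|) (θ * |s.im| + θ * b / 2)
    (by
      intro y hy
      rw [uIcc_of_ge (by linarith)] at hy
      rw [abs_le]; constructor <;> linarith [hy.1, hy.2])
    (by
      intro y hy
      rw [uIcc_of_ge (by linarith)] at hy
      rw [abs_le]; constructor <;> linarith [hy.1, hy.2])
    (by rcases abs_cases (-A + b / 2) with hh | hh <;> rw [hh.1] <;> linarith)
    (by rw [abs_neg, abs_of_pos (by linarith)]; linarith)
    (by rw [abs_neg, abs_of_pos (by linarith)]; linarith)
    T hT (2 * Real.exp (Real.pi * b * |ω.re|)) (Real.pi * b)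
    (by
      intro x y _
      simp only [T]
      rw [norm_mul, mul_assoc (2:ℝ), ← Real.exp_add]
      have e : ‖(2:ℂ)‖ = 2 := by simp
      rw [e]
      refine mul_le_mul_of_nonneg_left ((norm_cosh_le _).trans (Real.exp_le_exp.2 ?_)) (by norm_num)
      have e2 : (Real.pi * b * (ω - (x + y * I)) : ℂ) = ((Real.pi * b : ℝ) : ℂ) * (ω - (x + y * I)) := by push_cast; ring
      rw [e2, re_ofReal_mul, abs_mul, abs_of_pos (by positivity)]
      have e3 : (ω - (x + y * I)).re = ω.re - x := by simp
      rw [e3]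
      have := abs_sub ω.re x
      have pb : 0 < Real.pi * b := by positivity
      nlinarith)
    (by
      have : 0 < Real.pi * b⁻¹ := by positivity
      have : 2 * Real.pi * (-A + b / 2 + -B + -C) + Real.pi * b = - 2 * (Real.pi * b⁻¹) := by
        linear_combination (- 2 * Real.pi) * gs
      linarith)
  have S1 := h.wp.phi_shift a1 c1 (a2 + b / 2 * I) (c2 + b / 2 * I) (a3 + b / 2 * I) (c3 + b / 2 * I) s (-A) (-B + b / 2) (-C + b / 2)
    h.ia1 h.ic1 (by rw [add_im, im_ib, h.ia2]) (by rw [add_im, im_ib, h.ic2]) (by rw [add_im, im_ib, h.ia3]) (by rw [add_im, im_ib, h.ic3])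
    (yp - b / 2) (ym + b / 2)
    ((1 - θ) * |s.im| + (1 - θ) * b / 2) (θ * |s.im| + (1 - θ) * b / 2)
    (by
      intro y hy
      rw [uIcc_of_le (by linarith)] at hy
      rw [abs_le]; constructor <;> linarith [hy.1, hy.2])
    (by
      intro y hy
      rw [uIcc_of_le (by linarith)] at hy
      rw [abs_le]; constructor <;> linarith [hy.1, hy.2])
    (by rw [abs_neg, abs_of_pos (by linarith)]; linarith)
    (by rcases abs_cases (-B + b / 2) with hh | hh <;> rw [hh.1] <;> linarith)
    (by rcases abs_cases (-C + b / 2) with hh | hh <;> rw [hh.1] <;> linarith)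
    (fun _ => 1) (by fun_prop) 1 0 (by intro x y _; simp)
    (by
      have : 0 < Real.pi * b⁻¹ := by positivity
      have : 2 * Real.pi * (-A + (-B + b / 2) + (-C + b / 2)) + 0 = - 2 * (Real.pi * b⁻¹) := by
        linear_combination (- 2 * Real.pi) * gs
      linarith)
  obtain ⟨i1, i2, i3⟩ := S0
  simp only [mul_one] at S1
  obtain ⟨j1, j2, j3⟩ := S1
  have P1 : ∀ x : ℝ, kap b a1 c2 c3 s * Phi W a1 c1 a2 c2 a3 c3 (s + b / 2 * I) (x + yp * I) =
      Phi W (a1 + b / 2 * I) (c1 + b / 2 * I) a2 c2 a3 c3 s (x + yp * I) * T (x + yp * I) -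
      Phi W a1 c1 (a2 + b / 2 * I) (c2 + b / 2 * I) (a3 + b / 2 * I) (c3 + b / 2 * I) s (x + (yp - b / 2 : ℝ) * I) := by
    intro x
    have := h.pt s (x + yp * I) hs (by simp [hyp])
    have e : (x + (yp - b / 2 : ℝ) * I : ℂ) = x + yp * I - b / 2 * I := by push_cast; ring
    rw [e]
    simp only [T]
    rw [this, kap]
    ring
  have P2 : ∀ x : ℝ, kap b c1 a2 a3 (-s) * Phi W a1 c1 a2 c2 a3 c3 (s - b / 2 * I) (x + ym * I) =
      Phi W (a1 + b / 2 * I) (c1 + b / 2 * I) a2 c2 a3 c3 s (x + ym * I) * T (x + ym * I) -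
      Phi W a1 c1 (a2 + b / 2 * I) (c2 + b / 2 * I) (a3 + b / 2 * I) (c3 + b / 2 * I) s (x + (ym + b / 2 : ℝ) * I) := by
    intro x
    have := h.swap.pt (-s) (-(x + ym * I)) (by simpa using hs) (by simp [hym]; ring)
    have e : (x + (ym + b / 2 : ℝ) * I : ℂ) = x + ym * I + b / 2 * I := by push_cast; ring
    rw [e]
    simp only [T]
    rw [h.tau, Phi_neg, show -s + b / 2 * I = -(s - b / 2 * I) by ring, Phi_neg,
      show -(x + ym * I : ℂ) - b / 2 * I = -(x + ym * I + b / 2 * I) by ring, Phi_neg] at this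
    rw [this, kap]
    ring
  rw [J_trans, J_trans, ← integral_const_mul, ← integral_const_mul, show θ * (s + b / 2 * I).im = yp by rw [add_im, im_ib],
    show θ * (s - b / 2 * I).im = ym by rw [sub_im, im_ib]]
  simp_rw [P1, P2]
  rw [integral_sub i1 j1, integral_sub i2 j2, i3, j3]

end


noncomputable def qI (b : ℝ) : ℂ := (((b + b⁻¹) / 2 : ℝ) : ℂ) * I

theorem qI_im (b : ℝ) : (qI b).im = (b + b⁻¹) / 2 := by rw [qI]; simp
theorem qI_re (b : ℝ) : (qI b).re = 0 := by rw [qI]; simp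

noncomputable def ZZ (W : ℂ → ℂ) (b : ℝ) (a1 c1 a2 c2 a3 c3 s : ℂ) : ℂ :=
  Pr W (-(a1 + c2 + qI b)) (-(c1 + a2 + qI b)) s * Pr W (-(a1 + c3 + qI b)) (-(c1 + a3 + qI b)) s

theorem cosh_qI (b : ℝ) (hb : 0 < b) (p s : ℂ) : cosh (Real.pi * b * (s - (p + qI b))) = I * sinh (Real.pi * b * (p - s + b / 2 * I)) := by
  rw [← cosh_quarter, ← cosh_neg]
  congr 1
  have gb : (b:ℂ) ≠ 0 := by exact_mod_cast hb.ne'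
  have : (b:ℂ) * (b:ℂ)⁻¹ = 1 := mul_inv_cancel₀ gb
  rw [qI]
  push_cast
  linear_combination (Real.pi / 2 * I : ℂ) * this

section
variable {b : ℝ} {W : ℂ → ℂ} {a1 c1 a2 c2 a3 c3 : ℂ} {A B C θ : ℝ}

theorem Cfg.ims (h : Cfg b W a1 c1 a2 c2 a3 c3 A B C θ) :
    (-(a1 + c2 + qI b)).im = (b + b⁻¹) / 2 - C ∧ (-(c1 + a2 + qI b)).im = (b + b⁻¹) / 2 - C ∧
    (-(a1 + c3 + qI b)).im = (b + b⁻¹) / 2 - B ∧ (-(c1 + a3 + qI b)).im = (b + b⁻¹) / 2 - B := by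
  have := h.sumQ
  simp only [neg_im, add_im, h.ia1, h.ic1, h.ia2, h.ic2, h.ia3, h.ic3, qI_im]
  refine ⟨?_, ?_, ?_, ?_⟩ <;> linarith

theorem Cfg.Z_diff (h : Cfg b W a1 c1 a2 c2 a3 c3 A B C θ) (s : ℂ) (hs : |s.im| < C) :
    DifferentiableAt ℂ (ZZ W b a1 c1 a2 c2 a3 c3) s := by
  have hB := h.hCB
  have gB := h.BQ
  obtain ⟨i1, i2, i3, i4⟩ := h.ims
  exact (h.wp.pair_diff _ _ s _ i1 i2 (by rw [abs_of_pos (by linarith)]; linarith)).mul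
    (h.wp.pair_diff _ _ s _ i3 i4 (by rw [abs_of_pos (by linarith)]; linarith))

theorem Cfg.Z_bound (h : Cfg b W a1 c1 a2 c2 a3 c3 A B C θ) :
    ∃ K : ℝ, 0 ≤ K ∧ ∀ s : ℂ, |s.im| ≤ b / 2 → ‖ZZ W b a1 c1 a2 c2 a3 c3 s‖ ≤ K * Real.exp (2 * Real.pi * A * |s.re|) := by
  have hB := h.hCB
  have gB := h.BQ
  have hC := h.hC
  have hs := h.sumQ
  obtain ⟨i1, i2, i3, i4⟩ := h.ims
  set P := |(-(a1 + c2 + qI b)).re| + |(-(c1 + a2 + qI b)).re| + |(-(a1 + c3 + qI b)).re| + |(-(c1 + a3 + qI b)).re|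
  have n1 := abs_nonneg (-(a1 + c2 + qI b)).re
  have n2 := abs_nonneg (-(c1 + a2 + qI b)).re
  have n3 := abs_nonneg (-(a1 + c3 + qI b)).re
  have n4 := abs_nonneg (-(c1 + a3 + qI b)).re
  obtain ⟨K, hK, hk⟩ := h.wp.pair (C - b / 2) P (by linarith) (by positivity)
  refine ⟨K * K, by positivity, fun s hs => ?_⟩
  have k1 := hk _ _ s _ i1 i2 (by linarith) (by linarith) (by rw [abs_of_pos (by linarith)]; linarith)
  have k2 := hk _ _ s _ i3 i4 (by linarith) (by linarith) (by rw [abs_of_pos (by linarith)]; linarith)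
  rw [ZZ, norm_mul]
  calc _ ≤ _ := mul_le_mul k1 k2 (norm_nonneg _) (by positivity)
    _ = K * K * (Real.exp (2 * Real.pi * ((b + b⁻¹) / 2 - C) * |s.re|) * Real.exp (2 * Real.pi * ((b + b⁻¹) / 2 - B) * |s.re|)) := by ring
    _ = _ := by
      rw [← Real.exp_add]; congr 2
      rw [show A = b + b⁻¹ - B - C by linarith]; ring

theorem Cfg.feqs (h : Cfg b W a1 c1 a2 c2 a3 c3 A B C θ) (s : ℂ) (hs : |s.im| < C - b / 2) :
    kap b a1 c2 c3 s ≠ 0 ∧ 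
    W (s + b / 2 * I + -(a1 + c2 + qI b)) * W (s + b / 2 * I + -(a1 + c3 + qI b)) =
      - kap b a1 c2 c3 s * (W (s - b / 2 * I + -(a1 + c2 + qI b)) * W (s - b / 2 * I + -(a1 + c3 + qI b))) := by
  have hB := h.hCB
  have gB := h.BQ
  have hC := h.hC
  have gb := h.b0
  obtain ⟨i1, i2, i3, i4⟩ := h.ims
  rw [neg_im] at i1 i3
  have hs' := abs_lt.1 hs
  have e1 := h.wp.feq (s - (a1 + c2 + qI b)) (by rw [sub_im, abs_lt]; constructor <;> linarith)
  have e2 := h.wp.feq (s - (a1 + c3 + qI b)) (by rw [sub_im, abs_lt]; constructor <;> linarith)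
  have n1 := h.wp.ne (s - (a1 + c2 + qI b) + b / 2 * I) (by rw [add_im, im_ib, sub_im, abs_lt]; constructor <;> linarith)
  have n2 := h.wp.ne (s - (a1 + c3 + qI b) + b / 2 * I) (by rw [add_im, im_ib, sub_im, abs_lt]; constructor <;> linarith)
  have key : (2 * cosh (Real.pi * b * (s - (a1 + c2 + qI b)))) * (2 * cosh (Real.pi * b * (s - (a1 + c3 + qI b)))) = - kap b a1 c2 c3 s := by
    rw [cosh_qI b gb, cosh_qI b gb, kap, show a1 + c2 - s = a1 - s + c2 by ring, show a1 + c3 - s = a1 - s + c3 by ring]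
    linear_combination (4 * (sinh (Real.pi * b * (a1 - s + c2 + b / 2 * I)) * sinh (Real.pi * b * (a1 - s + c3 + b / 2 * I)))) * I_sq
  constructor
  · intro h0
    rw [h0, neg_zero, mul_eq_zero] at key
    rcases key with k | k
    · rw [k, zero_mul] at e1; exact n1 e1
    · rw [k, zero_mul] at e2; exact n2 e2
  · rw [show s + b / 2 * I + -(a1 + c2 + qI b) = s - (a1 + c2 + qI b) + b / 2 * I by ring,
      show s + b / 2 * I + -(a1 + c3 + qI b) = s - (a1 + c3 + qI b) + b / 2 * I by ring,
      show s - b / 2 * I + -(a1 + c2 + qI b) = s - (a1 + c2 + qI b) - b / 2 * I by ring,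
      show s - b / 2 * I + -(a1 + c3 + qI b) = s - (a1 + c3 + qI b) - b / 2 * I by ring, e1, e2, ← key]
    ring

theorem Cfg.const (h : Cfg b W a1 c1 a2 c2 a3 c3 A B C θ) (s : ℂ) (hs : |s.im| < C) :
    JJ W a1 c1 a2 c2 a3 c3 θ s * ZZ W b a1 c1 a2 c2 a3 c3 s = JJ W a1 c1 a2 c2 a3 c3 θ 0 * ZZ W b a1 c1 a2 c2 a3 c3 0 := by
  obtain ⟨K1, h1⟩ := h.J_bound
  obtain ⟨K2, hK2, h2⟩ := h.Z_bound
  refine periodic_const (fun s => JJ W a1 c1 a2 c2 a3 c3 θ s * ZZ W b a1 c1 a2 c2 a3 c3 s) b C h.b0 h.hC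
    (fun s hs => (h.J_diff s hs).mul (h.Z_diff s hs)) ?_ (K1 * K2) ?_ s hs
  · intro s hs
    obtain ⟨n1, e1⟩ := h.feqs s hs
    obtain ⟨n2, e2⟩ := h.swap.feqs (-s) (by simpa using hs)
    have e3 := h.Jdiff s hs
    set x1 := W (s + b / 2 * I + -(a1 + c2 + qI b))
    set x2 := W (s + b / 2 * I + -(a1 + c3 + qI b))
    set x3 := W (s - b / 2 * I + -(a1 + c2 + qI b))
    set x4 := W (s - b / 2 * I + -(a1 + c3 + qI b))
    have z1 : ZZ W b a1 c1 a2 c2 a3 c3 (s + b / 2 * I) = x1 * x2 * (W (-s - b / 2 * I + -(c1 + a2 + qI b)) * W (-s - b / 2 * I + -(c1 + a3 + qI b))) := by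
      unfold ZZ Pr
      rw [show -(c1 + a2 + qI b) - (s + b / 2 * I) = -s - b / 2 * I + -(c1 + a2 + qI b) by ring,
        show -(c1 + a3 + qI b) - (s + b / 2 * I) = -s - b / 2 * I + -(c1 + a3 + qI b) by ring]
      simp only [x1, x2]; ring
    have z2 : ZZ W b a1 c1 a2 c2 a3 c3 (s - b / 2 * I) = x3 * x4 * (W (-s + b / 2 * I + -(c1 + a2 + qI b)) * W (-s + b / 2 * I + -(c1 + a3 + qI b))) := by
      unfold ZZ Pr
      rw [show -(c1 + a2 + qI b) - (s - b / 2 * I) = -s + b / 2 * I + -(c1 + a2 + qI b) by ring,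
        show -(c1 + a3 + qI b) - (s - b / 2 * I) = -s + b / 2 * I + -(c1 + a3 + qI b) by ring]
      simp only [x3, x4]; ring
    show _ * _ = _ * _
    rw [z1, z2, e1, e2]
    linear_combination (-(x3 * x4 * (W (-s - b / 2 * I + -(c1 + a2 + qI b)) * W (-s - b / 2 * I + -(c1 + a3 + qI b))))) * e3
  · intro s hs
    rw [norm_mul]
    calc _ ≤ _ := mul_le_mul (h1 s hs) (h2 s hs) (norm_nonneg _) ((norm_nonneg _).trans (h1 s hs))
      _ = K1 * K2 * (Real.exp (2 * Real.pi * (-A) * |s.re|) * Real.exp (2 * Real.pi * A * |s.re|)) := by ring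
      _ = K1 * K2 := by
        rw [← Real.exp_add]
        ring_nf
        simp

end


theorem WP.edge {b : ℝ} {W : ℂ → ℂ} (h : WP b W) (z : ℂ) (h1 : 0 < z.im) (h2 : z.im < b⁻¹) :
    W (-qI b + b * I + z) = -(2 * I * sinh (Real.pi * b * z)) * W (-qI b + z) := by
  have gb : (b:ℂ) ≠ 0 := by exact_mod_cast h.hb.ne'
  have bb : (b:ℂ) * (b:ℂ)⁻¹ = 1 := mul_inv_cancel₀ gb
  have := h.feq (-qI b + b / 2 * I + z) (by
    rw [add_im, add_im, neg_im, qI_im, im_ib, abs_lt]; constructor <;> linarith)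
  rw [show -qI b + b / 2 * I + z + b / 2 * I = -qI b + b * I + z by ring,
    show -qI b + b / 2 * I + z - b / 2 * I = -qI b + z by ring] at this
  rw [this]
  have e : (Real.pi * b * (-qI b + b / 2 * I + z) : ℂ) = -((-(Real.pi * b * z)) + Real.pi / 2 * I) := by
    rw [qI]; push_cast
    linear_combination (-Real.pi / 2 * I : ℂ) * bb
  rw [e, cosh_neg, cosh_quarter, sinh_neg]
  ring

theorem WP.edge2 {b : ℝ} {W : ℂ → ℂ} (h : WP b W) (z : ℂ) (h1 : 0 < z.im) (h2 : z.im < b⁻¹) :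
    z * W (-qI b + z) = I / (2 * Real.pi * b) * ((Real.pi * b * z) / sinh (Real.pi * b * z)) * W (-qI b + b * I + z) := by
  have gb : (b:ℂ) ≠ 0 := by exact_mod_cast h.hb.ne'
  have gp : (Real.pi:ℂ) ≠ 0 := by exact_mod_cast Real.pi_ne_zero
  have e := h.edge z h1 h2
  have n : sinh (Real.pi * b * z) ≠ 0 := by
    intro h0
    rw [h0] at e
    refine h.ne _ ?_ (e.trans (by simp))
    have := h.hb
    rw [add_im, add_im, neg_im, qI_im, abs_lt]
    simp
    constructor <;> linarith
  rw [e]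
  generalize sinh (Real.pi * b * z) = S at n
  have e3 : I / (2 * Real.pi * b) * (Real.pi * b * z / S) * (-(2 * I * S) * W (-qI b + z)) = -(I ^ 2) * (z * W (-qI b + z)) := by
    field_simp
  rw [e3, I_sq]; ring

theorem WP.V0 {b : ℝ} {W : ℂ → ℂ} (h : WP b W) : ContinuousAt (fun z => W (-qI b + b * I + z)) 0 ∧ W (-qI b + b * I + 0) = b := by
  have gb := h.hb
  have bi : 0 < b⁻¹ := inv_pos.2 gb
  constructor
  · have : DifferentiableAt ℂ W (-qI b + b * I + 0) := by
      apply h.diff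
      rw [add_im, add_im, neg_im, qI_im, abs_lt]
      simp only [mul_im, ofReal_re, ofReal_im, I_re, I_im, zero_im]
      constructor <;> linarith
    exact ContinuousAt.comp (f := fun z => -qI b + b * I + z) this.continuousAt (by fun_prop)
  · have e : -qI b + b * I + 0 = ((b - b⁻¹ : ℝ):ℂ) / 2 * I := by
      rw [qI]; push_cast; ring
    rw [e, h.crit]

theorem WP.w_lim {b : ℝ} {W : ℂ → ℂ} (h : WP b W) :
    Tendsto (fun z => z * W (-qI b + z)) (𝓝[{z : ℂ | 0 < z.im}] 0) (𝓝 (I / (2 * Real.pi))) := by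
  have gb : (b:ℂ) ≠ 0 := by exact_mod_cast h.hb.ne'
  have gp : (Real.pi:ℂ) ≠ 0 := by exact_mod_cast Real.pi_ne_zero
  obtain ⟨v1, v2⟩ := h.V0
  have hl : Tendsto (fun z : ℂ => Real.pi * b * z) (𝓝[{z : ℂ | 0 < z.im}] 0) (𝓝[≠] 0) := by
    refine tendsto_nhdsWithin_iff.2 ⟨?_, ?_⟩
    · have : ContinuousAt (fun z : ℂ => Real.pi * b * z) 0 := by fun_prop
      have := this.tendsto
      simp only [mul_zero] at this
      exact this.mono_left nhdsWithin_le_nhds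
    · filter_upwards [self_mem_nhdsWithin] with z hz
      have : z ≠ 0 := by
        rintro rfl
        simp at hz
      simp [gb, this]
  have t1 := (lim_inv.comp hl).const_mul (I / (2 * Real.pi * b))
  have t2 : Tendsto (fun z => W (-qI b + b * I + z)) (𝓝[{z : ℂ | 0 < z.im}] 0) (𝓝 b) := by
    have t := v1.tendsto
    rw [v2] at t
    exact t.mono_left nhdsWithin_le_nhds
  have t3 := t1.mul t2
  have e : I / (2 * Real.pi * b) * 1 * b = I / (2 * Real.pi) := by field_simp
  rw [e] at t3
  refine t3.congr' ?_
  have ho : IsOpen {z : ℂ | z.im < b⁻¹} := isOpen_lt (by fun_prop) (by fun_prop)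
  have hm : (0:ℂ) ∈ {z : ℂ | z.im < b⁻¹} := by have := h.hb; simp [this]
  filter_upwards [self_mem_nhdsWithin, nhdsWithin_le_nhds (ho.mem_nhds hm)] with z hz1 hz2
  rw [h.edge2 z hz1 hz2]
  rfl

theorem WP.w_bdd {b : ℝ} {W : ℂ → ℂ} (h : WP b W) :
    ∃ η : ℝ, 0 < η ∧ ∃ M : ℝ, 0 < M ∧ ∀ z : ℂ, 0 < z.im → z.im ≤ η → ‖z * W (-qI b + z)‖ ≤ M := by
  have gb := h.hb
  have bi : 0 < b⁻¹ := inv_pos.2 gb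
  have pp := Real.pi_pos
  have hl := h.w_lim.norm
  have hev := hl.eventually_lt_const (lt_add_one _)
  rw [eventually_nhdsWithin_iff, Metric.eventually_nhds_iff] at hev
  obtain ⟨ρ, hρ, hr⟩ := hev
  set M1 := ‖I / (2 * (Real.pi:ℂ))‖ + 1
  have hM1 : 0 < M1 := by positivity
  obtain ⟨K, hK, hk⟩ := h.bound (min b (b⁻¹ / 2)) (lt_min gb (by linarith))
  have k1 : min b (b⁻¹ / 2) ≤ b := min_le_left _ _
  have k2 : min b (b⁻¹ / 2) ≤ b⁻¹ / 2 := min_le_right _ _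
  set η := min (ρ / 2) (min ((b + b⁻¹) / 4) (b⁻¹ / 2)) with hη
  have η0 : 0 < η := by rw [hη]; simp only [lt_min_iff]; refine ⟨?_, ?_, ?_⟩ <;> linarith
  have η1 : η ≤ ρ / 2 := min_le_left _ _
  have η2 : η ≤ (b + b⁻¹) / 4 := (min_le_right _ _).trans (min_le_left _ _)
  have η3 : η ≤ b⁻¹ / 2 := (min_le_right _ _).trans (min_le_right _ _)
  set c := (1 - Real.exp (-2 * (Real.pi * b * (ρ / 2)))) / 2 with hc
  have c0 : 0 < c := by
    have : Real.exp (-2 * (Real.pi * b * (ρ / 2))) < 1 := by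
      rw [Real.exp_lt_one_iff]
      have : 0 < Real.pi * b * (ρ / 2) := by positivity
      linarith
    linarith
  set κ := Real.pi * ((b + b⁻¹) / 4) with hκ
  have κ0 : 0 < κ := by positivity
  refine ⟨η, η0, M1 + 1 / (2 * c) * K * (1 / κ + η), by positivity, fun z hz1 hz2 => ?_⟩
  by_cases hz : |z.re| < ρ / 2
  · have : ‖z‖ < ρ := by
      have := norm_le_abs_re_add_abs_im z
      rw [abs_of_pos hz1] at this
      linarith
    have := hr (by simpa using this) hz1
    have : 0 ≤ 1 / (2 * c) * K * (1 / κ + η) := by positivity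
    linarith
  · push Not at hz
    have e := h.edge z hz1 (by linarith)
    have lb := sinh_lb2 (Real.pi * b * z.re) (Real.pi * b * z.im) (Real.pi * b * (ρ / 2)) (by
      rw [abs_mul, abs_of_pos (by positivity : 0 < Real.pi * b)]; gcongr)
    rw [← hc, show (((Real.pi * b * z.re : ℝ):ℂ) + ((Real.pi * b * z.im : ℝ):ℂ) * I) = Real.pi * b * z by
      conv_rhs => rw [← re_add_im z]
      push_cast; ring] at lb
    rw [abs_mul, abs_of_pos (by positivity : 0 < Real.pi * b)] at lb
    have vi : (-qI b + b * I + z).im = (b - b⁻¹) / 2 + z.im := by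
      rw [add_im, add_im, neg_im, qI_im]; simp; ring
    have vr : (-qI b + b * I + z).re = z.re := by
      rw [add_re, add_re, neg_re, qI_re]; simp
    have vb := hk (-qI b + b * I + z) (by rw [vi, abs_le]; constructor <;> linarith)
    rw [vi, vr] at vb
    have en := congrArg norm e
    rw [norm_mul, norm_neg, norm_mul, norm_mul, norm_I, mul_one] at en
    have : ‖(2:ℂ)‖ = 2 := by simp
    rw [this] at en
    have q : 2 * (c * Real.exp (Real.pi * b * |z.re|)) * ‖W (-qI b + z)‖ ≤ K * Real.exp (Real.pi * |z.re| * ((b - b⁻¹) / 2 + z.im)) := by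
      rw [en] at vb
      refine le_trans ?_ vb
      gcongr
    have q2 : ‖W (-qI b + z)‖ ≤ 1 / (2 * c) * K * Real.exp (-κ * |z.re|) := by
      have x1 : 0 < Real.exp (Real.pi * b * |z.re|) := Real.exp_pos _
      have x2 : Real.exp (Real.pi * |z.re| * ((b - b⁻¹) / 2 + z.im)) ≤ Real.exp (-κ * |z.re|) * Real.exp (Real.pi * b * |z.re|) := by
        rw [← Real.exp_add]
        apply Real.exp_le_exp.2
        have : 0 ≤ Real.pi * (|z.re| * ((b + b⁻¹) / 4 - z.im)) := mul_nonneg pp.le (mul_nonneg (abs_nonneg _) (by linarith))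
        rw [hκ]
        linarith
      have x3 : 2 * c * ‖W (-qI b + z)‖ ≤ K * Real.exp (-κ * |z.re|) := by
        refine le_of_mul_le_mul_right ?_ x1
        calc _ = 2 * (c * Real.exp (Real.pi * b * |z.re|)) * ‖W (-qI b + z)‖ := by ring
          _ ≤ _ := q
          _ ≤ K * (Real.exp (-κ * |z.re|) * Real.exp (Real.pi * b * |z.re|)) := by gcongr
          _ = _ := by ring
      rw [mul_assoc, one_div, ← div_eq_inv_mul, le_div_iff₀ (by positivity)]
      linarith
    have x4 : |z.re| * Real.exp (-κ * |z.re|) ≤ 1 / κ := by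
      have := Real.add_one_le_exp (κ * |z.re|)
      rw [neg_mul, Real.exp_neg, ← div_eq_mul_inv, div_le_div_iff₀ (Real.exp_pos _) κ0]
      linarith
    have x5 : Real.exp (-κ * |z.re|) ≤ 1 := by
      rw [Real.exp_le_one_iff]
      have := mul_nonneg κ0.le (abs_nonneg z.re)
      linarith
    have x6 : ‖z‖ ≤ |z.re| + η := by
      have := norm_le_abs_re_add_abs_im z
      rw [abs_of_pos hz1] at this
      linarith
    rw [norm_mul]
    calc _ ≤ _ := mul_le_mul x6 q2 (norm_nonneg _) (by positivity)
      _ = 1 / (2 * c) * K * (|z.re| * Real.exp (-κ * |z.re|) + η * Real.exp (-κ * |z.re|)) := by ring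
      _ ≤ 1 / (2 * c) * K * (1 / κ + η * 1) := by gcongr
      _ ≤ _ := by rw [mul_one]; linarith


def HH (W : ℂ → ℂ) (q a1 c1 a2 c2 a3 c3 u v : ℂ) : ℂ :=
  W (a1 + c1 + q - u) * W (a2 + c2 + q - v) * W (a3 + c2 + q - v) * W (c3 - c2 - q + v)

theorem pinch_alg (W : ℂ → ℂ) (q a1 c1 a2 c2 a3 c3 d y t : ℂ) :
    Phi W a1 c1 a2 c2 a3 c3 (a1 + c2 + 2 * q - d * I) (c2 + q + d * (y - t * I)) =
    W (-q + d * (y + (1 - t) * I)) * W (-q + d * (t * I - y)) * HH W q a1 c1 a2 c2 a3 c3 (d * (y + (1 - t) * I)) (d * (t * I - y)) := by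
  unfold Phi Pr HH
  rw [show c2 + q + d * (y - t * I) - (a1 + c2 + 2 * q - d * I) + a1 = -q + d * (y + (1 - t) * I) by ring,
    show c1 - (c2 + q + d * (y - t * I) - (a1 + c2 + 2 * q - d * I)) = a1 + c1 + q - d * (y + (1 - t) * I) by ring,
    show c2 + q + d * (y - t * I) + a2 = a2 + c2 + q - d * (t * I - y) by ring,
    show c2 + q + d * (y - t * I) + a3 = a3 + c2 + q - d * (t * I - y) by ring,
    show c2 - (c2 + q + d * (y - t * I)) = -q + d * (t * I - y) by ring,
    show c3 - (c2 + q + d * (y - t * I)) = c3 - c2 - q + d * (t * I - y) by ring]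
  ring

theorem h1_im (d y θ : ℝ) : ((d:ℂ) * (y + (1 - θ) * I)).im = d * (1 - θ) := by simp
theorem h1_re (d y θ : ℝ) : ((d:ℂ) * (y + (1 - θ) * I)).re = d * y := by simp
theorem h2_im (d y θ : ℝ) : ((d:ℂ) * (θ * I - y)).im = d * θ := by simp
theorem h2_re (d y θ : ℝ) : ((d:ℂ) * (θ * I - y)).re = -(d * y) := by simp

theorem pole_fact (θ : ℝ) (t0 : 0 < θ) (t1 : θ < 1) :
    (Integrable fun y : ℝ => ((y + (1 - θ) * I) * (θ * I - y) : ℂ)⁻¹) ∧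
    ∫ y : ℝ, ((y + (1 - θ) * I) * (θ * I - y) : ℂ)⁻¹ = -2 * Real.pi := by
  obtain ⟨h1, h2⟩ := int_pole_diff (1 - θ) (-θ) (by linarith) (by linarith)
  have e : ∀ y : ℝ, ((y + (1 - θ) * I) * (θ * I - y) : ℂ)⁻¹ = -I * ((y + (1 - θ : ℝ) * I : ℂ)⁻¹ - (y + (-θ : ℝ) * I : ℂ)⁻¹) := by
    intro y
    have n1 := ne_ln y (1 - θ) (by linarith)
    have n2 := ne_ln y (-θ) (by linarith)
    push_cast at n1 n2 ⊢
    have n3 : (θ * I - y : ℂ) ≠ 0 := by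
      intro hh
      apply n2
      linear_combination -hh
    apply inv_eq_of_mul_eq_one_left
    have m1 := inv_mul_cancel₀ n1
    have m2 := inv_mul_cancel₀ n2
    linear_combination (-I * (θ * I - y)) * m1 + (-I * (y + (1 - θ) * I)) * m2 - I_sq
  simp_rw [e]
  refine ⟨h1.const_mul _, ?_⟩
  rw [integral_const_mul, h2, sign_pos (by linarith), sign_neg (by linarith)]
  simp only [SignType.coe_one, SignType.coe_neg_one, ofReal_one, ofReal_neg]
  linear_combination (2 * Real.pi : ℂ) * I_sq

section
variable {b : ℝ} {W : ℂ → ℂ} {a1 c1 a2 c2 a3 c3 : ℂ} {A B C θ : ℝ}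

theorem Cfg.HH_bound (h : Cfg b W a1 c1 a2 c2 a3 c3 A B C θ) (hCB : C < B) :
    ∃ d0 : ℝ, 0 < d0 ∧ ∃ K : ℝ, 0 < K ∧ ∀ d : ℝ, 0 < d → d < d0 → ∀ y : ℝ,
      ‖HH W (qI b) a1 c1 a2 c2 a3 c3 (d * (y + (1 - θ) * I)) (d * (θ * I - y))‖ ≤ K := by
  have t0 := h.θ0
  have t1 := h.θ1
  have hA := h.A0
  have hC := h.C0
  have gs := h.sumQ
  have gB := h.BQ
  have gA := h.AQ
  have gb := h.b0
  have bi : 0 < b⁻¹ := inv_pos.2 gb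
  have pp := Real.pi_pos
  set Q := b + b⁻¹ with hQ
  set e := min A (min (Q / 2 - A) (min (B - C) (min (Q / 2 - B) C))) with he
  have e0 : 0 < e := by rw [he]; simp only [lt_min_iff]; refine ⟨?_, ?_, ?_, ?_, ?_⟩ <;> linarith
  have e1 : e ≤ A := min_le_left _ _
  have e2 : e ≤ Q / 2 - A := (min_le_right _ _).trans (min_le_left _ _)
  have e3 : e ≤ B - C := (min_le_right _ _).trans ((min_le_right _ _).trans (min_le_left _ _))
  have e4 : e ≤ Q / 2 - B := (min_le_right _ _).trans ((min_le_right _ _).trans ((min_le_right _ _).trans (min_le_left _ _)))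
  have e5 : e ≤ C := (min_le_right _ _).trans ((min_le_right _ _).trans ((min_le_right _ _).trans (min_le_right _ _)))
  set P := |(a1 + c1).re| + |(a2 + c2).re| + |(a3 + c2).re| + |(c3 - c2).re|
  have n1 := abs_nonneg (a1 + c1).re
  have n2 := abs_nonneg (a2 + c2).re
  have n3 := abs_nonneg (a3 + c2).re
  have n4 := abs_nonneg (c3 - c2).re
  obtain ⟨K, hK, hk⟩ := h.wp.unif (e / 2) P (by linarith) (by positivity)
  refine ⟨e / 2, by linarith, K * K * K * K, by positivity, fun d d0 d1 y => ?_⟩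
  have dt : 0 < d * θ := mul_pos d0 t0
  have dt1 : 0 < d * (1 - θ) := mul_pos d0 (by linarith)
  have i1 : (a1 + c1 + qI b - d * (y + (1 - θ) * I)).im = -2 * A + Q / 2 - d * (1 - θ) := by
    rw [sub_im, h1_im, add_im, add_im, h.ia1, h.ic1, qI_im]; ring
  have i2 : (a2 + c2 + qI b - d * (θ * I - y)).im = -2 * B + Q / 2 - d * θ := by
    rw [sub_im, h2_im, add_im, add_im, h.ia2, h.ic2, qI_im]; ring
  have i3 : (a3 + c2 + qI b - d * (θ * I - y)).im = -B - C + Q / 2 - d * θ := by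
    rw [sub_im, h2_im, add_im, add_im, h.ia3, h.ic2, qI_im]; ring
  have i4 : (c3 - c2 - qI b + d * (θ * I - y)).im = B - C - Q / 2 + d * θ := by
    rw [add_im, h2_im, sub_im, sub_im, h.ic3, h.ic2, qI_im]; ring
  have r1 : (a1 + c1 + qI b - d * (y + (1 - θ) * I)).re - (-(d * y)) = (a1 + c1).re := by
    rw [sub_re, h1_re, add_re (a1 + c1), qI_re]; ring
  have r2 : (a2 + c2 + qI b - d * (θ * I - y)).re - d * y = (a2 + c2).re := by
    rw [sub_re, h2_re, add_re (a2 + c2), qI_re]; ring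
  have r3 : (a3 + c2 + qI b - d * (θ * I - y)).re - d * y = (a3 + c2).re := by
    rw [sub_re, h2_re, add_re (a3 + c2), qI_re]; ring
  have r4 : (c3 - c2 - qI b + d * (θ * I - y)).re - (-(d * y)) = (c3 - c2).re := by
    rw [add_re, h2_re, sub_re (c3 - c2), qI_re]; ring
  have b1 := hk _ (-(d * y)) (by rw [i1, abs_le]; constructor <;> linarith) (by rw [r1]; linarith)
  have b2 := hk _ (d * y) (by rw [i2, abs_le]; constructor <;> linarith) (by rw [r2]; linarith)
  have b3 := hk _ (d * y) (by rw [i3, abs_le]; constructor <;> linarith) (by rw [r3]; linarith)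
  have b4 := hk _ (-(d * y)) (by rw [i4, abs_le]; constructor <;> linarith) (by rw [r4]; linarith)
  rw [i1, abs_neg] at b1
  rw [i2] at b2
  rw [i3] at b3
  rw [i4, abs_neg] at b4
  rw [HH, norm_mul, norm_mul, norm_mul]
  calc _ ≤ _ := mul_le_mul (mul_le_mul (mul_le_mul b1 b2 (norm_nonneg _) (by positivity)) b3 (norm_nonneg _) (by positivity)) b4 (norm_nonneg _) (by positivity)
    _ = K * K * K * K * (Real.exp (Real.pi * |d * y| * (-2 * A + Q / 2 - d * (1 - θ))) * Real.exp (Real.pi * |d * y| * (-2 * B + Q / 2 - d * θ)) * Real.exp (Real.pi * |d * y| * (-B - C + Q / 2 - d * θ)) * Real.exp (Real.pi * |d * y| * (B - C - Q / 2 + d * θ))) := by ring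
    _ ≤ K * K * K * K * 1 := by
      refine mul_le_mul_of_nonneg_left ?_ (by positivity)
      rw [← Real.exp_add, ← Real.exp_add, ← Real.exp_add, Real.exp_le_one_iff]
      have : 0 ≤ Real.pi * (|d * y| * (2 * A + 2 * B + 2 * C - Q + d)) := mul_nonneg pp.le (mul_nonneg (abs_nonneg _) (by linarith))
      linarith
    _ = _ := mul_one _

theorem Cfg.HH_lim (h : Cfg b W a1 c1 a2 c2 a3 c3 A B C θ) (hCB : C < B) (y : ℝ) :
    Tendsto (fun d : ℝ => HH W (qI b) a1 c1 a2 c2 a3 c3 (d * (y + (1 - θ) * I)) (d * (θ * I - y))) (𝓝[>] 0)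
      (𝓝 (HH W (qI b) a1 c1 a2 c2 a3 c3 0 0)) := by
  have hA := h.A0
  have hC := h.C0
  have gs := h.sumQ
  have gB := h.BQ
  have gA := h.AQ
  have aux : ∀ (p k : ℂ), |p.im| < (b + b⁻¹) / 2 → ContinuousAt (fun d : ℝ => W (p + d * k)) 0 := by
    intro p k hp
    have e : p + (0:ℝ) * k = p := by simp
    have := h.wp.diff (p + (0:ℝ) * k) (by rw [e]; exact hp)
    exact ContinuousAt.comp (f := fun d : ℝ => p + d * k) this.continuousAt (by fun_prop)
  have k1 := aux (a1 + c1 + qI b) (-(y + (1 - θ) * I)) (by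
    rw [add_im, add_im, h.ia1, h.ic1, qI_im, abs_lt]; constructor <;> linarith)
  have k2 := aux (a2 + c2 + qI b) (-(θ * I - y)) (by
    rw [add_im, add_im, h.ia2, h.ic2, qI_im, abs_lt]; constructor <;> linarith)
  have k3 := aux (a3 + c2 + qI b) (-(θ * I - y)) (by
    rw [add_im, add_im, h.ia3, h.ic2, qI_im, abs_lt]; constructor <;> linarith)
  have k4 := aux (c3 - c2 - qI b) (θ * I - y) (by
    rw [sub_im, sub_im, h.ic3, h.ic2, qI_im, abs_lt]; constructor <;> linarith)
  have k := (((k1.tendsto.mul k2.tendsto).mul k3.tendsto).mul k4.tendsto)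
  have k' := k.mono_left (nhdsWithin_le_nhds (s := Ioi 0))
  unfold HH
  simpa only [ofReal_zero, zero_mul, sub_zero, add_zero, mul_neg, ← sub_eq_add_neg] using k'

theorem Cfg.J_scale (h : Cfg b W a1 c1 a2 c2 a3 c3 A B C θ) (d : ℝ) (hd : 0 < d) :
    d * JJ W a1 c1 a2 c2 a3 c3 θ (a1 + c2 + 2 * qI b - d * I) =
    ∫ y : ℝ, (d:ℂ) ^ 2 * Phi W a1 c1 a2 c2 a3 c3 (a1 + c2 + 2 * qI b - d * I) (c2 + qI b + d * (y - θ * I)) := by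
  have gs := h.sumQ
  have g1 := h.hθ
  set x0 := (c2 - θ * (a1 + c2 + 2 * qI b) + qI b).re with hx0
  have ex0 : (x0 : ℂ) = c2 - θ * (a1 + c2 + 2 * qI b) + qI b := by
    apply Complex.ext
    · simp [hx0]
    · have : (2 * qI b).im = b + b⁻¹ := by rw [two_mul, add_im, qI_im]; ring
      rw [ofReal_im, add_im, sub_im, im_ofReal_mul, add_im, add_im, this, qI_im, h.ic2, h.ia1]
      rw [show -A + -B + (b + b⁻¹) = C by linarith]
      linarith
  rw [JJ, ← integral_add_right_eq_self _ x0]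
  have e := Measure.integral_comp_mul_left (fun x : ℝ => Phi W a1 c1 a2 c2 a3 c3 (a1 + c2 + 2 * qI b - d * I) (((x + x0 : ℝ):ℂ) + θ * (a1 + c2 + 2 * qI b - d * I))) d
  rw [abs_of_pos (inv_pos.2 hd), real_smul] at e
  rw [integral_const_mul]
  have e2 : (∫ y : ℝ, Phi W a1 c1 a2 c2 a3 c3 (a1 + c2 + 2 * qI b - d * I) (c2 + qI b + d * (y - θ * I))) =
      ∫ (x : ℝ), Phi W a1 c1 a2 c2 a3 c3 (a1 + c2 + 2 * qI b - d * I) (((d * x + x0 : ℝ):ℂ) + θ * (a1 + c2 + 2 * qI b - d * I)) := by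
    congr 1; ext y; congr 1
    push_cast
    rw [ex0]
    ring
  rw [e2, e]
  push_cast
  have : (d:ℂ) ≠ 0 := by exact_mod_cast hd.ne'
  field_simp

end


section
variable {b : ℝ} {W : ℂ → ℂ} {a1 c1 a2 c2 a3 c3 : ℂ} {A B C θ : ℝ}

theorem Cfg.pinch_im (h : Cfg b W a1 c1 a2 c2 a3 c3 A B C θ) (d : ℝ) :
    (a1 + c2 + 2 * qI b - d * I).im = C - d := by
  have gs := h.sumQ
  have e2 : (2 * qI b).im = b + b⁻¹ := by rw [two_mul, add_im, qI_im]; ring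
  have e3 : ((d:ℂ) * I).im = d := by simp
  rw [sub_im, add_im, add_im, h.ia1, h.ic2, e2, e3]; linarith

theorem Cfg.pinch_lim (h : Cfg b W a1 c1 a2 c2 a3 c3 A B C θ) (hCB : C < B) :
    Tendsto (fun d : ℝ => d * JJ W a1 c1 a2 c2 a3 c3 θ (a1 + c2 + 2 * qI b - d * I)) (𝓝[>] 0)
      (𝓝 (HH W (qI b) a1 c1 a2 c2 a3 c3 0 0 / (2 * Real.pi))) := by
  have t0 := h.θ0
  have t1 := h.θ1
  have hC := h.C0
  have gB := h.BQ
  obtain ⟨d0, hd0, K, hK, hk⟩ := h.HH_bound hCB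
  obtain ⟨η, hη, M, hM, hm⟩ := h.wp.w_bdd
  obtain ⟨pi1, pi2⟩ := pole_fact θ t0 t1
  have n1 : ∀ y : ℝ, (y + (1 - θ) * I : ℂ) ≠ 0 := by
    intro y
    have := ne_ln y (1 - θ) (by linarith)
    push_cast at this
    exact this
  have n2 : ∀ y : ℝ, (θ * I - y : ℂ) ≠ 0 := by
    intro y hh
    have := ne_ln y (-θ) (by linarith)
    apply this
    push_cast
    linear_combination -hh
  set s0 := HH W (qI b) a1 c1 a2 c2 a3 c3 0 0
  -- the factorised form
  have fac : ∀ d y : ℝ, (d:ℂ) ^ 2 * Phi W a1 c1 a2 c2 a3 c3 (a1 + c2 + 2 * qI b - d * I) (c2 + qI b + d * (y - θ * I)) =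
      ((d * (y + (1 - θ) * I)) * W (-qI b + d * (y + (1 - θ) * I))) * ((d * (θ * I - y)) * W (-qI b + d * (θ * I - y))) *
      HH W (qI b) a1 c1 a2 c2 a3 c3 (d * (y + (1 - θ) * I)) (d * (θ * I - y)) * ((y + (1 - θ) * I) * (θ * I - y) : ℂ)⁻¹ := by
    intro d y
    rw [pinch_alg]
    have m1 := n1 y
    have m2 := n2 y
    generalize HH W (qI b) a1 c1 a2 c2 a3 c3 (d * (y + (1 - θ) * I)) (d * (θ * I - y)) = H
    generalize W (-qI b + d * (y + (1 - θ) * I)) = W1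
    generalize W (-qI b + d * (θ * I - y)) = W2
    generalize (y + (1 - θ) * I : ℂ) = p at *
    generalize (θ * I - y : ℂ) = q at *
    field_simp
  have lim : Tendsto (fun d : ℝ => ∫ y : ℝ, (d:ℂ) ^ 2 * Phi W a1 c1 a2 c2 a3 c3 (a1 + c2 + 2 * qI b - d * I) (c2 + qI b + d * (y - θ * I))) (𝓝[>] 0)
      (𝓝 (∫ y : ℝ, (I / (2 * Real.pi)) * (I / (2 * Real.pi)) * s0 * ((y + (1 - θ) * I) * (θ * I - y) : ℂ)⁻¹)) := by
    refine tendsto_integral_filter_of_dominated_convergence (fun y : ℝ => M * M * K * ‖((y + (1 - θ) * I) * (θ * I - y) : ℂ)⁻¹‖) ?_ ?_ ?_ ?_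
    · filter_upwards [Ioo_mem_nhdsGT (show (0:ℝ) < C by linarith)] with d hd
      refine Continuous.aestronglyMeasurable ?_
      refine continuous_const.mul (continuous_iff_continuousAt.2 fun y => ?_)
      have hi : (c2 + qI b + d * (y - θ * I)).im = θ * (C - d) := by
        have e : ((d:ℂ) * (y - θ * I)).im = - (d * θ) := by simp
        rw [add_im, add_im, e, h.ic2, qI_im]; linarith [h.hθ]
      obtain ⟨q1, q2, q3⟩ := h.cond (C - d) (by rw [abs_lt]; constructor <;> linarith [hd.1, hd.2])
      have := h.wp.phi_diff a1 c1 a2 c2 a3 c3 (a1 + c2 + 2 * qI b - d * I) (c2 + qI b + d * (y - θ * I)) (-A) (-B) (-C) h.ia1 h.ic1 h.ia2 h.ic2 h.ia3 h.ic3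
        (by rw [hi, h.pinch_im]; exact q1) (by rw [hi]; exact q2) (by rw [hi]; exact q3)
      exact ContinuousAt.comp (f := fun y : ℝ => c2 + qI b + d * (y - θ * I)) this.continuousAt (by fun_prop)
    · filter_upwards [Ioo_mem_nhdsGT (show (0:ℝ) < min d0 η from lt_min hd0 hη)] with d hd
      refine Eventually.of_forall fun y => ?_
      have dp := hd.1
      have dd := lt_min_iff.1 hd.2
      rw [fac, norm_mul, norm_mul, norm_mul]
      have b1 := hm (d * (y + (1 - θ) * I)) (by rw [h1_im]; exact mul_pos dp (by linarith)) (by rw [h1_im]; nlinarith)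
      have b2 := hm (d * (θ * I - y)) (by rw [h2_im]; exact mul_pos dp t0) (by rw [h2_im]; nlinarith)
      have b3 := hk d dp dd.1 y
      gcongr
    · exact pi1.norm.const_mul _
    · refine Eventually.of_forall fun y => ?_
      simp only [fac]
      refine Tendsto.mul_const _ ((Tendsto.mul ?_ ?_).mul (h.HH_lim hCB y))
      · refine h.wp.w_lim.comp (tendsto_nhdsWithin_iff.2 ⟨?_, ?_⟩)
        · have : ContinuousAt (fun d : ℝ => (d:ℂ) * (y + (1 - θ) * I)) 0 := by fun_prop
          have := this.tendsto.mono_left (nhdsWithin_le_nhds (s := Ioi 0))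
          simpa using this
        · filter_upwards [self_mem_nhdsWithin] with d hd
          change 0 < ((d:ℂ) * (y + (1 - θ) * I)).im
          rw [h1_im]; exact mul_pos hd (by linarith)
      · refine h.wp.w_lim.comp (tendsto_nhdsWithin_iff.2 ⟨?_, ?_⟩)
        · have : ContinuousAt (fun d : ℝ => (d:ℂ) * (θ * I - y)) 0 := by fun_prop
          have := this.tendsto.mono_left (nhdsWithin_le_nhds (s := Ioi 0))
          simpa using this
        · filter_upwards [self_mem_nhdsWithin] with d hd
          change 0 < ((d:ℂ) * (θ * I - y)).im
          rw [h2_im]; exact mul_pos hd t0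
  rw [integral_const_mul, pi2] at lim
  have e : I / (2 * Real.pi) * (I / (2 * Real.pi)) * s0 * (-2 * Real.pi) = s0 / (2 * Real.pi) := by
    have : (Real.pi : ℂ) ≠ 0 := by exact_mod_cast Real.pi_ne_zero
    field_simp
    linear_combination (-s0) * I_sq
  rw [e] at lim
  refine lim.congr' ?_
  filter_upwards [self_mem_nhdsWithin] with d hd
  rw [h.J_scale d hd]

theorem Cfg.eval_lt (h : Cfg b W a1 c1 a2 c2 a3 c3 A B C θ) (hCB : C < B) :
    JJ W a1 c1 a2 c2 a3 c3 θ 0 = W (a1 + c1 + qI b) * W (a2 + c2 + qI b) * W (a3 + c3 + qI b) *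
      (W (a1 + c2 + qI b) * W (c1 + a2 + qI b)) * (W (a1 + c3 + qI b) * W (c1 + a3 + qI b)) *
      (W (a2 + c3 + qI b) * W (c2 + a3 + qI b)) := by
  have hA := h.A0
  have hC := h.C0
  have gs := h.sumQ
  have gB := h.BQ
  have gA := h.AQ
  obtain ⟨i1, i2, i3, i4⟩ := h.ims
  have sm : a1 + c1 + a2 + c2 + a3 + c3 = -(4 * qI b) := by
    rw [h.sum, qI]; push_cast; ring
  have dI : ∀ d : ℝ, ((d:ℂ) * I).im = d := fun d => by simp
  -- key identity
  have key : ∀ d : ℝ, 0 < d → d < C →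
      JJ W a1 c1 a2 c2 a3 c3 θ 0 * ZZ W b a1 c1 a2 c2 a3 c3 0 * (d * W (-qI b + d * I)) =
      d * JJ W a1 c1 a2 c2 a3 c3 θ (a1 + c2 + 2 * qI b - d * I) *
      (W (a3 + c3 + qI b + d * I) * W (c2 - c3 + qI b - d * I) * W (a2 + c3 + qI b + d * I)) := by
    intro d hd hdC
    have hc := h.const (a1 + c2 + 2 * qI b - d * I) (by rw [h.pinch_im, abs_lt]; constructor <;> linarith)
    rw [← hc]
    have iv := h.wp.inv (qI b - d * I) (by rw [sub_im, qI_im, dI, abs_lt]; constructor <;> linarith)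
    rw [neg_sub, show (d:ℂ) * I - qI b = -qI b + d * I by ring] at iv
    unfold ZZ Pr
    rw [show a1 + c2 + 2 * qI b - d * I + -(a1 + c2 + qI b) = qI b - d * I by ring,
      show -(c1 + a2 + qI b) - (a1 + c2 + 2 * qI b - d * I) = a3 + c3 + qI b + d * I by linear_combination -sm,
      show a1 + c2 + 2 * qI b - d * I + -(a1 + c3 + qI b) = c2 - c3 + qI b - d * I by ring,
      show -(c1 + a3 + qI b) - (a1 + c2 + 2 * qI b - d * I) = a2 + c3 + qI b + d * I by linear_combination -sm]
    linear_combination (JJ W a1 c1 a2 c2 a3 c3 θ (a1 + c2 + 2 * qI b - d * I) * W (a3 + c3 + qI b + d * I) * W (c2 - c3 + qI b - d * I) * W (a2 + c3 + qI b + d * I) * d) * iv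
  have aux : ∀ (p k : ℂ), |p.im| < (b + b⁻¹) / 2 → Tendsto (fun d : ℝ => W (p + d * k)) (𝓝[>] 0) (𝓝 (W p)) := by
    intro p k hp
    have e : p + (0:ℝ) * k = p := by simp
    have := h.wp.diff (p + (0:ℝ) * k) (by rw [e]; exact hp)
    have := ContinuousAt.comp (f := fun d : ℝ => p + d * k) (x := 0) this.continuousAt (by fun_prop)
    have := this.tendsto.mono_left (nhdsWithin_le_nhds (s := Ioi 0))
    rw [Function.comp_def] at this
    beta_reduce at this
    rw [e] at this
    exact this
  have z1 : |(a3 + c3 + qI b).im| < (b + b⁻¹) / 2 := by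
    rw [add_im, add_im, h.ia3, h.ic3, qI_im, abs_lt]; constructor <;> linarith
  have z2 : |(c2 - c3 + qI b).im| < (b + b⁻¹) / 2 := by
    rw [add_im, sub_im, h.ic2, h.ic3, qI_im, abs_lt]; constructor <;> linarith
  have z3 : |(a2 + c3 + qI b).im| < (b + b⁻¹) / 2 := by
    rw [add_im, add_im, h.ia2, h.ic3, qI_im, abs_lt]; constructor <;> linarith
  have l1 := aux _ I z1
  have l2 := aux _ (-I) z2
  have l3 := aux _ I z3
  have l4 : Tendsto (fun d : ℝ => (d:ℂ) * W (-qI b + d * I)) (𝓝[>] 0) (𝓝 (1 / (2 * Real.pi))) := by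
    have : Tendsto (fun d : ℝ => ((d:ℂ) * I) * W (-qI b + d * I)) (𝓝[>] 0) (𝓝 (I / (2 * Real.pi))) := by
      refine h.wp.w_lim.comp (f := fun d : ℝ => (d:ℂ) * I) (tendsto_nhdsWithin_iff.2 ⟨?_, ?_⟩)
      · have : ContinuousAt (fun d : ℝ => (d:ℂ) * I) 0 := by fun_prop
        have := this.tendsto.mono_left (nhdsWithin_le_nhds (s := Ioi 0))
        simpa using this
      · filter_upwards [self_mem_nhdsWithin] with d hd
        change 0 < ((d:ℂ) * I).im
        rw [dI]; exact hd
    have := this.const_mul (-I)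
    convert this using 1
    · ext d
      linear_combination ((d:ℂ) * W (-qI b + d * I)) * I_sq
    · congr 1
      have : (Real.pi : ℂ) ≠ 0 := by exact_mod_cast Real.pi_ne_zero
      field_simp
      linear_combination I_sq
  have lhs := l4.const_mul (JJ W a1 c1 a2 c2 a3 c3 θ 0 * ZZ W b a1 c1 a2 c2 a3 c3 0)
  have rhs := (h.pinch_lim hCB).mul ((l1.mul l2).mul l3)
  have lhs' := lhs.congr' (f₂ := _) (by
    filter_upwards [Ioo_mem_nhdsGT hC] with d hd
    exact key d hd.1 hd.2)
  simp only [mul_neg, ← sub_eq_add_neg] at rhs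
  have fin := tendsto_nhds_unique lhs' rhs
  have iv0 := h.wp.inv (c2 - c3 + qI b) z2
  rw [show -(c2 - c3 + qI b) = c3 - c2 - qI b by ring] at iv0
  have v1 := h.wp.inv _ (show |(-(a1 + c2 + qI b)).im| < _ by rw [i1, abs_lt]; constructor <;> linarith)
  have v2 := h.wp.inv _ (show |(-(c1 + a2 + qI b)).im| < _ by rw [i2, abs_lt]; constructor <;> linarith)
  have v3 := h.wp.inv _ (show |(-(a1 + c3 + qI b)).im| < _ by rw [i3, abs_lt]; constructor <;> linarith)
  have v4 := h.wp.inv _ (show |(-(c1 + a3 + qI b)).im| < _ by rw [i4, abs_lt]; constructor <;> linarith)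
  rw [neg_neg] at v1 v2 v3 v4
  have pp : (Real.pi : ℂ) ≠ 0 := by exact_mod_cast Real.pi_ne_zero
  unfold ZZ Pr HH at fin
  simp only [sub_zero, add_zero, zero_add] at fin
  rw [add_comm a3 c2] at fin
  generalize JJ W a1 c1 a2 c2 a3 c3 θ 0 = J at *
  generalize W (a1 + c1 + qI b) = w11 at *
  generalize W (a2 + c2 + qI b) = w22 at *
  generalize W (a3 + c3 + qI b) = w33 at *
  generalize W (c2 + a3 + qI b) = w32 at *
  generalize W (a2 + c3 + qI b) = w23 at *
  generalize W (c2 - c3 + qI b) = p at *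
  generalize W (c3 - c2 - qI b) = q at *
  generalize W (a1 + c2 + qI b) = w12 at *
  generalize W (c1 + a2 + qI b) = w21 at *
  generalize W (a1 + c3 + qI b) = w13 at *
  generalize W (c1 + a3 + qI b) = w31 at *
  generalize W (-(a1 + c2 + qI b)) = y12 at *
  generalize W (-(c1 + a2 + qI b)) = y21 at *
  generalize W (-(a1 + c3 + qI b)) = y13 at *
  generalize W (-(c1 + a3 + qI b)) = y31 at *
  have fin2 : J * (y12 * y21 * (y13 * y31)) = w11 * w22 * w32 * w33 * w23 := by
    field_simp at fin
    linear_combination fin + w11 * w22 * w32 * w33 * w23 * iv0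
  calc J = J * (y12 * y21 * (y13 * y31)) * (w12 * w21 * (w13 * w31)) := by
        rw [show J * (y12 * y21 * (y13 * y31)) * (w12 * w21 * (w13 * w31)) = J * ((y12 * w12) * (y21 * w21) * (y13 * w13) * (y31 * w31)) by ring, v1, v2, v3, v4]; ring
    _ = _ := by rw [fin2]; ring

end


noncomputable def GG (W : ℂ → ℂ) (b : ℝ) (a1 c1 a2 c2 a3 c3 : ℂ) : ℂ :=
  W (a1 + c1 + qI b) * W (a2 + c2 + qI b) * W (a3 + c3 + qI b) *
      (W (a1 + c2 + qI b) * W (c1 + a2 + qI b)) * (W (a1 + c3 + qI b) * W (c1 + a3 + qI b)) *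
      (W (a2 + c3 + qI b) * W (c2 + a3 + qI b))

theorem eval1 {b : ℝ} {W : ℂ → ℂ} (hw : WP b W) {a1 c1 a2 c2 a3 c3 : ℂ} {A B C : ℝ}
    (ia1 : a1.im = -A) (ic1 : c1.im = -A) (ia2 : a2.im = -B) (ic2 : c2.im = -B) (ia3 : a3.im = -C) (ic3 : c3.im = -C)
    (sum : a1 + c1 + a2 + c2 + a3 + c3 = ((-(2 * (b + b⁻¹)) : ℝ) : ℂ) * I)
    (A0 : 0 < A) (AQ : A < (b + b⁻¹) / 2) (BQ : B < (b + b⁻¹) / 2) (hC : b / 2 < C) (hCB : C < B) :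
    ∫ x : ℝ, Phi W a1 c1 a2 c2 a3 c3 0 x = GG W b a1 c1 a2 c2 a3 c3 := by
  have hb := hw.hb
  have h : Cfg b W a1 c1 a2 c2 a3 c3 A B C (((b + b⁻¹) / 2 - B) / C) :=
    ⟨hw, ia1, ic1, ia2, ic2, ia3, ic3, sum, A0, AQ, BQ, hC, hCB.le, div_mul_cancel₀ _ (by linarith)⟩
  have := h.eval_lt hCB
  rw [JJ] at this
  rw [GG, ← this]
  simp only [mul_zero, add_zero]

theorem eval2 {b : ℝ} {W : ℂ → ℂ} (hw : WP b W) {a1 c1 a2 c2 a3 c3 : ℂ} {A B : ℝ}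
    (ia1 : a1.im = -A) (ic1 : c1.im = -A) (ia2 : a2.im = -B) (ic2 : c2.im = -B) (ia3 : a3.im = -B) (ic3 : c3.im = -B)
    (sum : a1 + c1 + a2 + c2 + a3 + c3 = ((-(2 * (b + b⁻¹)) : ℝ) : ℂ) * I)
    (A0 : 0 < A) (AQ : A < (b + b⁻¹) / 2) (BQ : B < (b + b⁻¹) / 2) (hC : b / 2 < B) :
    ∫ x : ℝ, Phi W a1 c1 a2 c2 a3 c3 0 x = GG W b a1 c1 a2 c2 a3 c3 := by
  have hb := hw.hb
  have hsQ : A + B + B = b + b⁻¹ := by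
    have := congrArg Complex.im sum
    simp only [add_im, ia1, ia2, ia3, ic1, ic2, ic3, mul_im, ofReal_re, ofReal_im, I_re, I_im] at this
    linarith
  set e := min (B - b / 2) (min ((b + b⁻¹) / 2 - B) ((b + b⁻¹) / 2 - A)) / 2 with he
  have e0 : 0 < e := by
    rw [he]; apply half_pos; simp only [lt_min_iff]; refine ⟨?_, ?_, ?_⟩ <;> linarith
  have e1 : 2 * e ≤ B - b / 2 := by rw [he, mul_div_cancel₀ _ two_ne_zero]; exact min_le_left _ _
  have e2 : 2 * e ≤ (b + b⁻¹) / 2 - B := by rw [he, mul_div_cancel₀ _ two_ne_zero]; exact (min_le_right _ _).trans (min_le_left _ _)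
  have e3 : 2 * e ≤ (b + b⁻¹) / 2 - A := by rw [he, mul_div_cancel₀ _ two_ne_zero]; exact (min_le_right _ _).trans (min_le_right _ _)
  have dI : ∀ d : ℝ, ((d:ℂ) * I).im = d := fun d => by simp
  have dR : ∀ d : ℝ, ((d:ℂ) * I).re = 0 := fun d => by simp
  have ev : ∀ d : ℝ, 0 < d → d < e → ∫ x : ℝ, Phi W a1 c1 (a2 - d * I) (c2 - d * I) (a3 + d * I) (c3 + d * I) 0 x = GG W b a1 c1 (a2 - d * I) (c2 - d * I) (a3 + d * I) (c3 + d * I) := by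
    intro d d0 d1
    refine eval1 hw (A := A) (B := B + d) (C := B - d) ia1 ic1 ?_ ?_ ?_ ?_ ?_ A0 AQ (by linarith) (by linarith) (by linarith)
    · rw [sub_im, ia2, dI]; ring
    · rw [sub_im, ic2, dI]; ring
    · rw [add_im, ia3, dI]; ring
    · rw [add_im, ic3, dI]; ring
    · linear_combination sum
  have aux : ∀ (p k : ℂ), |p.im| < (b + b⁻¹) / 2 → Tendsto (fun d : ℝ => W (p + d * k)) (𝓝[>] 0) (𝓝 (W p)) := by
    intro p k hp
    have e : p + (0:ℝ) * k = p := by simp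
    have := hw.diff (p + (0:ℝ) * k) (by rw [e]; exact hp)
    have := ContinuousAt.comp (f := fun d : ℝ => p + d * k) (x := 0) this.continuousAt (by fun_prop)
    have := this.tendsto.mono_left (nhdsWithin_le_nhds (s := Ioi 0))
    rw [Function.comp_def] at this
    beta_reduce at this
    rw [e] at this
    exact this
  have aux' : ∀ (p k : ℂ) (f : ℝ → ℂ), |p.im| < (b + b⁻¹) / 2 → (∀ d : ℝ, f d = p + d * k) → Tendsto (fun d : ℝ => W (f d)) (𝓝[>] 0) (𝓝 (W p)) := by
    intro p k f hp hf
    simp only [hf]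
    exact aux p k hp
  have rl : Tendsto (fun d : ℝ => GG W b a1 c1 (a2 - d * I) (c2 - d * I) (a3 + d * I) (c3 + d * I)) (𝓝[>] 0) (𝓝 (GG W b a1 c1 a2 c2 a3 c3)) := by
    unfold GG
    refine ((((((aux' _ 0 _ ?_ ?_).mul (aux' _ (-2 * I) _ ?_ ?_)).mul (aux' _ (2 * I) _ ?_ ?_)).mul ((aux' _ (-I) _ ?_ ?_).mul (aux' _ (-I) _ ?_ ?_))).mul ((aux' _ I _ ?_ ?_).mul (aux' _ I _ ?_ ?_))).mul ((aux' _ 0 _ ?_ ?_).mul (aux' _ 0 _ ?_ ?_)))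
    all_goals first
      | (intro d; ring)
      | (simp only [add_im, ia1, ic1, ia2, ic2, ia3, ic3, qI_im, abs_lt]; constructor <;> linarith)
  have ll : Tendsto (fun d : ℝ => ∫ x : ℝ, Phi W a1 c1 (a2 - d * I) (c2 - d * I) (a3 + d * I) (c3 + d * I) 0 x) (𝓝[>] 0) (𝓝 (∫ x : ℝ, Phi W a1 c1 a2 c2 a3 c3 0 x)) := by
    set P := |a1.re| + |c1.re| + |a2.re| + |c2.re| + |a3.re| + |c3.re|
    have n1 := abs_nonneg a1.re
    have n2 := abs_nonneg c1.re
    have n3 := abs_nonneg a2.re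
    have n4 := abs_nonneg c2.re
    have n5 := abs_nonneg a3.re
    have n6 := abs_nonneg c3.re
    obtain ⟨K, hK, hk⟩ := hw.phi e P e0 (by positivity)
    refine tendsto_integral_filter_of_dominated_convergence (fun x : ℝ => K * Real.exp (-(2 * Real.pi * (2 * B)) * |x|)) ?_ ?_ ?_ ?_
    · filter_upwards [Ioo_mem_nhdsGT e0] with d hd
      refine Continuous.aestronglyMeasurable (continuous_iff_continuousAt.2 fun y => ?_)
      have d0 := hd.1
      have d1 := hd.2
      have := hw.phi_diff a1 c1 (a2 - d * I) (c2 - d * I) (a3 + d * I) (c3 + d * I) 0 y (-A) (-(B + d)) (-(B - d)) ia1 ic1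
        (by rw [sub_im, ia2, dI]; ring) (by rw [sub_im, ic2, dI]; ring) (by rw [add_im, ia3, dI]; ring) (by rw [add_im, ic3, dI]; ring)
        (by rw [ofReal_im, zero_im, sub_zero, abs_zero, abs_neg, abs_of_pos (by linarith)]; linarith)
        (by rw [ofReal_im, abs_zero, abs_neg, abs_of_pos (by linarith)]; linarith)
        (by rw [ofReal_im, abs_zero, abs_neg, abs_of_pos (by linarith)]; linarith)
      exact ContinuousAt.comp (f := fun y : ℝ => (y:ℂ)) this.continuousAt (by fun_prop)
    · filter_upwards [Ioo_mem_nhdsGT e0] with d hd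
      refine Eventually.of_forall fun y => ?_
      have d0 := hd.1
      have d1 := hd.2
      have := hk a1 c1 (a2 - d * I) (c2 - d * I) (a3 + d * I) (c3 + d * I) 0 y (-A) (-(B + d)) (-(B - d)) ia1 ic1
        (by rw [sub_im, ia2, dI]; ring) (by rw [sub_im, ic2, dI]; ring) (by rw [add_im, ia3, dI]; ring) (by rw [add_im, ic3, dI]; ring)
        (by linarith) (by linarith) (by rw [sub_re, dR, sub_zero]; linarith) (by rw [sub_re, dR, sub_zero]; linarith)
        (by rw [add_re, dR, add_zero]; linarith) (by rw [add_re, dR, add_zero]; linarith)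
        (by rw [ofReal_im, zero_im, sub_zero, abs_zero, abs_neg, abs_of_pos (by linarith)]; linarith)
        (by rw [ofReal_im, abs_zero, abs_neg, abs_of_pos (by linarith)]; linarith)
        (by rw [ofReal_im, abs_zero, abs_neg, abs_of_pos (by linarith)]; linarith)
      refine this.trans (mul_le_mul_of_nonneg_left ?_ hK.le)
      rw [← Real.exp_add, Real.exp_le_exp, ofReal_re, zero_re, sub_zero]
      have : 0 ≤ Real.pi * (A * |y|) := by positivity
      linarith
    · exact (integrable_exp_abs _ (by have := Real.pi_pos; have : 0 < B := by linarith
                                      positivity)).const_mul K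
    · refine Eventually.of_forall fun y => ?_
      unfold Phi Pr
      refine ((aux' _ 0 _ ?_ ?_).mul (aux' _ 0 _ ?_ ?_)).mul ((aux' _ (-I) _ ?_ ?_).mul (aux' _ (-I) _ ?_ ?_)) |>.mul ((aux' _ I _ ?_ ?_).mul (aux' _ I _ ?_ ?_))
      all_goals first
        | (intro d; ring)
        | (simp only [add_im, sub_im, ofReal_im, zero_im, ia1, ic1, ia2, ic2, ia3, ic3, abs_lt]; constructor <;> linarith)
  refine tendsto_nhds_unique ll (rl.congr' ?_)
  filter_upwards [Ioo_mem_nhdsGT e0] with d hd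
  exact (ev d hd.1 hd.2).symm

theorem eval3 {b : ℝ} {W : ℂ → ℂ} (hw : WP b W) {a1 c1 a2 c2 a3 c3 : ℂ} {A B C : ℝ}
    (ia1 : a1.im = -A) (ic1 : c1.im = -A) (ia2 : a2.im = -B) (ic2 : c2.im = -B) (ia3 : a3.im = -C) (ic3 : c3.im = -C)
    (sum : a1 + c1 + a2 + c2 + a3 + c3 = ((-(2 * (b + b⁻¹)) : ℝ) : ℂ) * I)
    (A0 : 0 < A) (AQ : A < (b + b⁻¹) / 2) (BQ : B < (b + b⁻¹) / 2) (CQ : C < (b + b⁻¹) / 2) (hB : b / 2 < B) (hC : b / 2 < C) :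
    ∫ x : ℝ, Phi W a1 c1 a2 c2 a3 c3 0 x = GG W b a1 c1 a2 c2 a3 c3 := by
  rcases lt_trichotomy C B with h | h | h
  · exact eval1 hw ia1 ic1 ia2 ic2 ia3 ic3 sum A0 AQ BQ hC h
  · subst h
    exact eval2 hw ia1 ic1 ia2 ic2 ia3 ic3 sum A0 AQ BQ hC
  · have := eval1 hw ia1 ic1 ia3 ic3 ia2 ic2 (by linear_combination sum) A0 AQ CQ hB h
    have e1 : ∀ x, Phi W a1 c1 a3 c3 a2 c2 0 x = Phi W a1 c1 a2 c2 a3 c3 0 x := fun x => by unfold Phi; ring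
    simp only [e1] at this
    rw [this, GG, GG, add_comm a3 c2, add_comm c3 a2]
    ring

/-- all three evaluations, without ordering assumption, for `b ≤ 1` -/
theorem eval4 {b : ℝ} {W : ℂ → ℂ} (hw : WP b W) (hb1 : b ≤ 1) {a1 c1 a2 c2 a3 c3 : ℂ} {A B C : ℝ}
    (ia1 : a1.im = -A) (ic1 : c1.im = -A) (ia2 : a2.im = -B) (ic2 : c2.im = -B) (ia3 : a3.im = -C) (ic3 : c3.im = -C)
    (sum : a1 + c1 + a2 + c2 + a3 + c3 = ((-(2 * (b + b⁻¹)) : ℝ) : ℂ) * I)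
    (A0 : 0 < A) (B0 : 0 < B) (C0 : 0 < C) (AQ : A < (b + b⁻¹) / 2) (BQ : B < (b + b⁻¹) / 2) (CQ : C < (b + b⁻¹) / 2) :
    (Integrable fun x : ℝ => Phi W a1 c1 a2 c2 a3 c3 0 x) ∧
    ∫ x : ℝ, Phi W a1 c1 a2 c2 a3 c3 0 x = GG W b a1 c1 a2 c2 a3 c3 := by
  have hb := hw.hb
  have hsQ : A + B + C = b + b⁻¹ := by
    have := congrArg Complex.im sum
    simp only [add_im, ia1, ia2, ia3, ic1, ic2, ic3, mul_im, ofReal_re, ofReal_im, I_re, I_im] at this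
    linarith
  have hbi : 1 ≤ b⁻¹ := (one_le_inv₀ hb).2 hb1
  constructor
  · have := (hw.phi_shift a1 c1 a2 c2 a3 c3 0 (-A) (-B) (-C) ia1 ic1 ia2 ic2 ia3 ic3 0 0 0 0
      (by intro y hy; simp at hy; simp [hy]) (by intro y hy; simp at hy; simp [hy])
      (by rw [abs_neg, abs_of_pos A0]; linarith) (by rw [abs_neg, abs_of_pos B0]; linarith) (by rw [abs_neg, abs_of_pos C0]; linarith)
      (fun _ => 1) (by fun_prop) 1 0 (by intro x y _; simp) (by
        have := mul_pos Real.pi_pos (show 0 < A + B + C by linarith)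
        linarith)).1
    simpa using this
  · by_cases hB : b / 2 < B
    · by_cases hC : b / 2 < C
      · exact eval3 hw ia1 ic1 ia2 ic2 ia3 ic3 sum A0 AQ BQ CQ hB hC
      · have := eval3 hw ia3 ic3 ia1 ic1 ia2 ic2 (by linear_combination sum) C0 CQ AQ BQ (by linarith) hB
        have e1 : ∀ x, Phi W a3 c3 a1 c1 a2 c2 0 x = Phi W a1 c1 a2 c2 a3 c3 0 x := fun x => by unfold Phi; simp only [sub_zero]; ring
        simp only [e1] at this
        rw [this, GG, GG, add_comm a3 c1, add_comm c3 a1, add_comm a3 c2, add_comm c3 a2]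
        ring
    · have := eval3 hw ia2 ic2 ia1 ic1 ia3 ic3 (by linear_combination sum) B0 BQ AQ CQ (by linarith) (by linarith)
      have e1 : ∀ x, Phi W a2 c2 a1 c1 a3 c3 0 x = Phi W a1 c1 a2 c2 a3 c3 0 x := fun x => by unfold Phi; simp only [sub_zero]; ring
      simp only [e1] at this
      rw [this, GG, GG, add_comm a2 c1, add_comm c2 a1]
      ring


theorem main_aux (b ε : ℝ) (h : PP b ε) (hb1 : b ≤ 1) (α β γ : ℂ)
    (hsum : α + β + γ = -(Complex.I * (((b + b⁻¹) : ℝ) : ℂ)))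
    (hα1 : -((b + b⁻¹) / 2) < α.im) (hα2 : α.im < 0)
    (hβ1 : -((b + b⁻¹) / 2) < β.im) (hβ2 : β.im < 0)
    (hγ1 : -((b + b⁻¹) / 2) < γ.im) (hγ2 : γ.im < 0)
    (u v w : ℝ) :
    Integrable (fun x : ℝ =>
        Dfun b ε α ((x : ℂ) - (u : ℂ)) * Dfun b ε β ((x : ℂ) - (v : ℂ)) *
          Dfun b ε γ ((x : ℂ) - (w : ℂ))) ∧
      ∫ x : ℝ,
          Dfun b ε α ((x : ℂ) - (u : ℂ)) * Dfun b ε β ((x : ℂ) - (v : ℂ)) *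
            Dfun b ε γ ((x : ℂ) - (w : ℂ)) =
        wb b ε (2 * α + Complex.I * (((b + b⁻¹) / 2 : ℝ) : ℂ)) *
          wb b ε (2 * β + Complex.I * (((b + b⁻¹) / 2 : ℝ) : ℂ)) *
          wb b ε (2 * γ + Complex.I * (((b + b⁻¹) / 2 : ℝ) : ℂ)) *
          Dfun b ε (-(Complex.I * (((b + b⁻¹) / 2 : ℝ) : ℂ)) - α) ((w : ℂ) - (v : ℂ)) *
          Dfun b ε (-(Complex.I * (((b + b⁻¹) / 2 : ℝ) : ℂ)) - β) ((u : ℂ) - (w : ℂ)) *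
          Dfun b ε (-(Complex.I * (((b + b⁻¹) / 2 : ℝ) : ℂ)) - γ) ((v : ℂ) - (u : ℂ)) := by
  have hw := WP_wb h
  have hq : Complex.I * (((b + b⁻¹) / 2 : ℝ) : ℂ) = qI b := by rw [qI, mul_comm]
  have hs2 : α + β + γ = -(2 * qI b) := by rw [hsum, qI]; push_cast; ring
  have hsI : α.im + β.im + γ.im = -(b + b⁻¹) := by
    have := congrArg Complex.im hs2
    rw [add_im, add_im, neg_im, two_mul, add_im, qI_im] at this
    linarith
  have D1 : ∀ (p : ℂ) (x y : ℝ), -((b + b⁻¹) / 2) < p.im → p.im < 0 →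
      Dfun b ε p ((x:ℂ) - y) = Pr (wb b ε) (p - y) (p + y) x := by
    intro p x y p1 p2
    rw [Dfun_eq h, Pr]
    · congr 2 <;> ring
    · simp only [add_im, sub_im, ofReal_im, abs_lt]; constructor <;> linarith
    · simp only [sub_im, ofReal_im, abs_lt]; constructor <;> linarith
  have D2 : ∀ x : ℝ, Dfun b ε α ((x : ℂ) - (u : ℂ)) * Dfun b ε β ((x : ℂ) - (v : ℂ)) *
          Dfun b ε γ ((x : ℂ) - (w : ℂ)) = Phi (wb b ε) (α - u) (α + u) (β - v) (β + v) (γ - w) (γ + w) 0 x := by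
    intro x
    rw [D1 _ _ _ hα1 hα2, D1 _ _ _ hβ1 hβ2, D1 _ _ _ hγ1 hγ2, Phi, sub_zero]
  have im1 : ∀ (p : ℂ) (x : ℝ), (p - x).im = -(-p.im) := fun p x => by simp
  have im2 : ∀ (p : ℂ) (x : ℝ), (p + x).im = -(-p.im) := fun p x => by simp
  obtain ⟨r1, r2⟩ := eval4 hw hb1 (im1 α u) (im2 α u) (im1 β v) (im2 β v) (im1 γ w) (im2 γ w)
    (by push_cast at hsum ⊢; linear_combination 2 * hsum) (by linarith) (by linarith) (by linarith) (by linarith) (by linarith) (by linarith)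
  simp only [D2]
  refine ⟨r1, ?_⟩
  rw [r2, hq]
  have qi : ∀ p : ℂ, (-qI b - p).im = -((b + b⁻¹) / 2) - p.im := fun p => by rw [sub_im, neg_im, qI_im]
  rw [D1 _ _ _ (by rw [qi]; linarith) (by rw [qi]; linarith), D1 _ _ _ (by rw [qi]; linarith) (by rw [qi]; linarith), D1 _ _ _ (by rw [qi]; linarith) (by rw [qi]; linarith)]
  rw [GG, Pr, Pr, Pr]
  rw [show (w:ℂ) + (-qI b - α - v) = β - v + (γ + w) + qI b by linear_combination -hs2,
    show -qI b - α + v - w = β + v + (γ - w) + qI b by linear_combination -hs2,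
    show (u:ℂ) + (-qI b - β - w) = α + u + (γ - w) + qI b by linear_combination -hs2,
    show -qI b - β + w - u = α - u + (γ + w) + qI b by linear_combination -hs2,
    show (v:ℂ) + (-qI b - γ - u) = α - u + (β + v) + qI b by linear_combination -hs2,
    show -qI b - γ + u - v = α + u + (β - v) + qI b by linear_combination -hs2,
    show α - u + (α + u) + qI b = 2 * α + qI b by ring,
    show β - v + (β + v) + qI b = 2 * β + qI b by ring,
    show γ - w + (γ + w) + qI b = 2 * γ + qI b by ring]
  ring

theorem main_fin (b ε : ℝ) (hb : 0 < b) (hε0 : 0 < ε)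
    (hε : ε < Real.pi * min b b⁻¹) (α β γ : ℂ)
    (hsum : α + β + γ = -(Complex.I * (((b + b⁻¹) : ℝ) : ℂ)))
    (hα1 : -((b + b⁻¹) / 2) < α.im) (hα2 : α.im < 0)
    (hβ1 : -((b + b⁻¹) / 2) < β.im) (hβ2 : β.im < 0)
    (hγ1 : -((b + b⁻¹) / 2) < γ.im) (hγ2 : γ.im < 0)
    (u v w : ℝ) :
    Integrable (fun x : ℝ =>
        Dfun b ε α ((x : ℂ) - (u : ℂ)) * Dfun b ε β ((x : ℂ) - (v : ℂ)) *
          Dfun b ε γ ((x : ℂ) - (w : ℂ))) ∧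
      ∫ x : ℝ,
          Dfun b ε α ((x : ℂ) - (u : ℂ)) * Dfun b ε β ((x : ℂ) - (v : ℂ)) *
            Dfun b ε γ ((x : ℂ) - (w : ℂ)) =
        wb b ε (2 * α + Complex.I * (((b + b⁻¹) / 2 : ℝ) : ℂ)) *
          wb b ε (2 * β + Complex.I * (((b + b⁻¹) / 2 : ℝ) : ℂ)) *
          wb b ε (2 * γ + Complex.I * (((b + b⁻¹) / 2 : ℝ) : ℂ)) *
          Dfun b ε (-(Complex.I * (((b + b⁻¹) / 2 : ℝ) : ℂ)) - α) ((w : ℂ) - (v : ℂ)) *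
          Dfun b ε (-(Complex.I * (((b + b⁻¹) / 2 : ℝ) : ℂ)) - β) ((u : ℂ) - (w : ℂ)) *
          Dfun b ε (-(Complex.I * (((b + b⁻¹) / 2 : ℝ) : ℂ)) - γ) ((v : ℂ) - (u : ℂ)) := by
  have pp := Real.pi_pos
  have h1 : ε < Real.pi * b := hε.trans_le (mul_le_mul_of_nonneg_left (min_le_left _ _) pp.le)
  have h2 : ε < Real.pi * b⁻¹ := hε.trans_le (mul_le_mul_of_nonneg_left (min_le_right _ _) pp.le)
  have h : PP b ε := by
    refine ⟨hb, hε0, ?_, (div_lt_iff₀ hb).2 h1⟩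
    rw [← div_eq_mul_inv, lt_div_iff₀ hb] at h2
    linarith
  rcases le_total b 1 with hb1 | hb1
  · exact main_aux b ε h hb1 α β γ hsum hα1 hα2 hβ1 hβ2 hγ1 hγ2 u v w
  · have e : b⁻¹ + b⁻¹⁻¹ = b + b⁻¹ := by rw [inv_inv, add_comm]
    have := main_aux b⁻¹ ε h.symm (inv_le_one_of_one_le₀ hb1) α β γ
    rw [e] at this
    have := this hsum hα1 hα2 hβ1 hβ2 hγ1 hγ2 u v w
    simpa only [wb_symm, Dfun_symm] using this

end Helpers

/-- The three-factor star–triangle type integral identity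
(identity `(D3)` of the paper). -/
theorem Dfun_three_factor_identity (b ε : ℝ) (hb : 0 < b) (hε0 : 0 < ε)
    (hε : ε < Real.pi * min b b⁻¹) (α β γ : ℂ)
    (hsum : α + β + γ = -(Complex.I * (((b + b⁻¹) : ℝ) : ℂ)))
    (hα1 : -((b + b⁻¹) / 2) < α.im) (hα2 : α.im < 0)
    (hβ1 : -((b + b⁻¹) / 2) < β.im) (hβ2 : β.im < 0)
    (hγ1 : -((b + b⁻¹) / 2) < γ.im) (hγ2 : γ.im < 0)
    (u v w : ℝ) :
    Integrable (fun x : ℝ =>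
        Dfun b ε α ((x : ℂ) - (u : ℂ)) * Dfun b ε β ((x : ℂ) - (v : ℂ)) *
          Dfun b ε γ ((x : ℂ) - (w : ℂ))) ∧
      ∫ x : ℝ,
          Dfun b ε α ((x : ℂ) - (u : ℂ)) * Dfun b ε β ((x : ℂ) - (v : ℂ)) *
            Dfun b ε γ ((x : ℂ) - (w : ℂ)) =
        wb b ε (2 * α + Complex.I * (((b + b⁻¹) / 2 : ℝ) : ℂ)) *
          wb b ε (2 * β + Complex.I * (((b + b⁻¹) / 2 : ℝ) : ℂ)) *
          wb b ε (2 * γ + Complex.I * (((b + b⁻¹) / 2 : ℝ) : ℂ)) *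
          Dfun b ε (-(Complex.I * (((b + b⁻¹) / 2 : ℝ) : ℂ)) - α) ((w : ℂ) - (v : ℂ)) *
          Dfun b ε (-(Complex.I * (((b + b⁻¹) / 2 : ℝ) : ℂ)) - β) ((u : ℂ) - (w : ℂ)) *
          Dfun b ε (-(Complex.I * (((b + b⁻¹) / 2 : ℝ) : ℂ)) - γ) ((v : ℂ) - (u : ℂ)) := by
  exact main_fin b ε hb hε0 hε α β γ hsum hα1 hα2 hβ1 hβ2 hγ1 hγ2 u v w
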